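/- arXiv:2007.12151 — 8 statements merged into one kernel-verified Lean document; each statement's English description precedes it below -/
import Mathlib

section
/- Let (h,⟨·,·⟩) be a pseudo-Euclidean Lie algebra, (e₁,…,e_n) a basis of the derived ideal [h,h], and (J₁,…,J_n) the associated Lie structure endomorphisms, i.e. the unique skew-symmetric endomorphisms of h with [u,v] = Σᵢ ⟨Jᵢu, v⟩ eᵢ for all u,v ∈ h. Let 𝒥₁ and 𝒥₂ be the symmetric endomorphisms of h defined by ⟨𝒥₁u, v⟩ = tr(ad_u ∘ ad_v*) and ⟨𝒥₂u, v⟩ = tr(J_u ∘ J_v*). Then 𝒥₁ = −Σ_{i,j=1}^n ⟨eᵢ,eⱼ⟩ Jᵢ∘Jⱼ and, for every u ∈ h, 𝒥₂u = −Σ_{i,j=1}^n ⟨eᵢ,u⟩ tr(Jᵢ∘Jⱼ) eⱼ. In particular tr(𝒥₁) = tr(𝒥₂). -/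
open Module LinearMap

noncomputable section

/-- The derived ideal `[h,h]` viewed as the submodule spanned by all brackets. -/
def derivedSubmodule (H : Type*) [LieRing H] [LieAlgebra ℝ H] : Submodule ℝ H :=
  Submodule.span ℝ {x : H | ∃ u v : H, x = ⁅u, v⁆}

/-- A bilinear form whose left kernel is trivial separates vectors. -/
theorem eq_of_forall_bilin_eq {H : Type*} [AddCommGroup H] [Module ℝ H]
    {B : H →ₗ[ℝ] H →ₗ[ℝ] ℝ} (hnd : ∀ u : H, (∀ v : H, B u v = 0) → u = 0)
    {x y : H} (h : ∀ w, B x w = B y w) : x = y :=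
  sub_eq_zero.mp <| hnd _ fun w => by simp [h w]

/-- Let `(h, ⟨·,·⟩)` be a pseudo-Euclidean Lie algebra, `(e₁,…,e_n)` a basis of
the derived ideal `[h,h]` and `(J₁,…,J_n)` the associated Lie structure endomorphisms, i.e. the
skew-symmetric endomorphisms with `[u,v] = Σᵢ ⟨Jᵢu,v⟩ eᵢ`.  Let `𝒥₁, 𝒥₂` be the symmetric
endomorphisms with `⟨𝒥₁u,v⟩ = tr(ad_u ∘ ad_v*)` and `⟨𝒥₂u,v⟩ = tr(J_u ∘ J_v*) = −tr(J_u ∘ J_v)`.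
Then `𝒥₁ = −Σᵢⱼ ⟨eᵢ,eⱼ⟩ Jᵢ∘Jⱼ`, `𝒥₂u = −Σᵢⱼ ⟨eᵢ,u⟩ tr(Jᵢ∘Jⱼ) eⱼ`, and `tr 𝒥₁ = tr 𝒥₂`. -/
theorem statement0
    {H : Type*} [LieRing H] [LieAlgebra ℝ H] [Module.Finite ℝ H]
    (B : H →ₗ[ℝ] H →ₗ[ℝ] ℝ)
    (hsymm : ∀ u v : H, B u v = B v u)
    (hnd : ∀ u : H, (∀ v : H, B u v = 0) → u = 0)
    {n : ℕ} (e : Fin n → H)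
    (he_mem : ∀ i, e i ∈ derivedSubmodule H)
    (he_li : LinearIndependent ℝ e)
    (he_span : Submodule.span ℝ (Set.range e) = derivedSubmodule H)
    (J : Fin n → Module.End ℝ H)
    (hJskew : ∀ i, ∀ u v : H, B (J i u) v = - B u (J i v))
    (hJstruct : ∀ u v : H, ⁅u, v⁆ = ∑ i, B (J i u) v • e i)
    -- `adStar u` is the adjoint of `ad u` with respect to `B`
    (adStar : H → Module.End ℝ H)
    (hadStar : ∀ u v w : H, B (adStar u v) w = B v ⁅u, w⁆)
    -- `Jm u` is the skew-symmetric endomorphism `J_u(v) = ad_v*(u)`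
    (Jm : H → Module.End ℝ H)
    (hJm : ∀ u v w : H, B (Jm u v) w = B u ⁅v, w⁆)
    (𝒥₁ 𝒥₂ : Module.End ℝ H)
    (h𝒥₁ : ∀ u v : H, B (𝒥₁ u) v
      = LinearMap.trace ℝ H ((LieAlgebra.ad ℝ H u : Module.End ℝ H) ∘ₗ adStar v))
    (h𝒥₂ : ∀ u v : H, B (𝒥₂ u) v = - LinearMap.trace ℝ H (Jm u ∘ₗ Jm v)) :
    (𝒥₁ = - ∑ i, ∑ j, B (e i) (e j) • (J i ∘ₗ J j)) ∧
    (∀ u : H, 𝒥₂ u = - ∑ i, ∑ j,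
      (B (e i) u * LinearMap.trace ℝ H (J i ∘ₗ J j)) • e j) ∧
    LinearMap.trace ℝ H 𝒥₁ = LinearMap.trace ℝ H 𝒥₂ := by
  have adStar_apply : ∀ v, adStar v = ∑ j, (B (e j)).smulRight (J j v) := by
    intro v
    ext x
    refine eq_of_forall_bilin_eq hnd fun w => ?_
    rw [hadStar, hJstruct]
    simp [mul_comm, hsymm x]
  have Jm_apply : ∀ u, Jm u = ∑ i, B (e i) u • J i := by
    intro u
    ext x
    refine eq_of_forall_bilin_eq hnd fun w => ?_
    rw [hJm, hJstruct]
    simp [mul_comm, hsymm u]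
  have first : 𝒥₁ = - ∑ i, ∑ j, B (e i) (e j) • (J i ∘ₗ J j) := by
    ext u
    refine eq_of_forall_bilin_eq hnd fun v => ?_
    have comp_eq : (LieAlgebra.ad ℝ H u : Module.End ℝ H) ∘ₗ adStar v
        = ∑ j, (B (e j)).smulRight ⁅u, J j v⁆ := by
      ext x
      simp [adStar_apply]
    rw [h𝒥₁, comp_eq]
    simp only [map_sum, LinearMap.trace_smulRight, hJstruct, map_smul, smul_eq_mul,
      LinearMap.neg_apply, LinearMap.sum_apply, LinearMap.smul_apply, map_neg,
      LinearMap.comp_apply, hJskew, ← Finset.sum_neg_distrib]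
    exact Finset.sum_congr rfl fun j _ => Finset.sum_congr rfl fun i _ => by ring
  have second : ∀ u : H, 𝒥₂ u = - ∑ i, ∑ j,
      (B (e i) u * LinearMap.trace ℝ H (J i ∘ₗ J j)) • e j := by
    intro u
    refine eq_of_forall_bilin_eq hnd fun v => ?_
    have comp_eq : Jm u ∘ₗ Jm v = ∑ i, ∑ j, (B (e i) u * B (e j) v) • (J i ∘ₗ J j) := by
      ext x
      simp [Jm_apply, Finset.smul_sum, mul_smul]
    rw [h𝒥₂, comp_eq]
    simp only [map_sum, map_smul, smul_eq_mul, LinearMap.neg_apply, LinearMap.sum_apply,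
      LinearMap.smul_apply, map_neg, neg_inj]
    exact Finset.sum_congr rfl fun i _ => Finset.sum_congr rfl fun j _ => by ring
  refine ⟨first, second, ?_⟩
  have second_eq : 𝒥₂ = - ∑ i, ∑ j,
      LinearMap.trace ℝ H (J i ∘ₗ J j) • (B (e i)).smulRight (e j) := by
    ext u
    simp [second, smul_smul, mul_comm]
  rw [first, second_eq]
  simp [mul_comm]
end
end

section
/- Let (h,[·,·],⟨·,·⟩) be a Lorentzian nilpotent Lie algebra with nondegenerate Euclidean center, with attributes (g,⟨·,·⟩_g,[·,·]_g), (Z(h),⟨·,·⟩_z) and ω, and let D : g → g be the symmetric endomorphism defined by ⟨Du, v⟩_g = tr(ω_u* ∘ ω_v). If ω(ad_u* v, w) + ω(v, ad_u* w) = 0 for all u, v, w ∈ g (where ad_u* is the adjoint of ad_u^g with respect to ⟨·,·⟩_g), then D is a derivation of the Lie algebra (g,[·,·]_g). -/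
open Module LinearMap

noncomputable section

/-- A bilinear form is Lorentzian if it admits an orthonormal basis with exactly one
timelike vector, i.e. it has signature `(1, dim − 1)`. -/
def IsLorentzianForm {H : Type*} [AddCommGroup H] [Module ℝ H]
    (B : H →ₗ[ℝ] H →ₗ[ℝ] ℝ) : Prop :=
  ∃ (n : ℕ) (b : Basis (Fin (n + 1)) ℝ H),
    (∀ i j, i ≠ j → B (b i) (b j) = 0) ∧
    B (b 0) (b 0) = -1 ∧ ∀ i, i ≠ 0 → B (b i) (b i) = 1

/-- The trace of an endomorphism, computed in a pair of bases dual for a nondegenerate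
bilinear form. -/
theorem trace_eq_sum_dualBasis {V ι : Type*} [AddCommGroup V] [Module ℝ V]
    [Module.Finite ℝ V] [Fintype ι] [DecidableEq ι] (β : LinearMap.BilinForm ℝ V)
    (hβ : β.Nondegenerate) (b : Basis ι ℝ V) (T : Module.End ℝ V) :
    LinearMap.trace ℝ V T = ∑ i, β (T (β.dualBasis hβ b i)) (b i) := by
  rw [LinearMap.trace_eq_matrix_trace ℝ (β.dualBasis hβ b), Matrix.trace]
  refine Finset.sum_congr rfl fun i _ => ?_
  rw [Matrix.diag_apply, LinearMap.toMatrix_apply, LinearMap.BilinForm.dualBasis_repr_apply]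

/-- Let `(h,[·,·],⟨·,·⟩)` be a Lorentzian nilpotent Lie algebra with
nondegenerate Euclidean center, with attributes `(g, ⟨·,·⟩_g, [·,·]_g)`, `(Z(h), ⟨·,·⟩_z)` and
`ω` (here `g = Z(h)^⊥`, `[u,v]_g = P⁅u,v⁆` and `ω(u,v) = Q⁅u,v⁆`), and let `D : g → g` be the
symmetric endomorphism defined by `⟨Du,v⟩_g = tr(ω_u* ∘ ω_v)`.  If
`ω(ad_u* v, w) + ω(v, ad_u* w) = 0` for all `u,v,w ∈ g` then `D` is a derivation of
`(g, [·,·]_g)`. -/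
theorem statement2
    {H : Type*} [LieRing H] [LieAlgebra ℝ H] [Module.Finite ℝ H]
    (B : H →ₗ[ℝ] H →ₗ[ℝ] ℝ)
    (hsymm : ∀ u v : H, B u v = B v u)
    (hnd : ∀ u : H, (∀ v : H, B u v = 0) → u = 0)
    (hLor : IsLorentzianForm B)
    (hnilp : ∃ k, LieModule.lowerCentralSeries ℝ H H k = ⊥)
    (hZnd : ∀ z ∈ LieAlgebra.center ℝ H,
      (∀ w ∈ LieAlgebra.center ℝ H, B z w = 0) → z = 0)
    (hZeucl : ∀ z ∈ LieAlgebra.center ℝ H, z ≠ 0 → 0 < B z z)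
    -- `g` is the orthogonal complement of the center
    (g : Submodule ℝ H)
    (hg : ∀ u : H, u ∈ g ↔ ∀ z ∈ LieAlgebra.center ℝ H, B u z = 0)
    -- `P`, `Q` are the projections onto `g` and `Z(h)` in `h = g ⊕ Z(h)`
    (P Q : H →ₗ[ℝ] H)
    (hP : ∀ u : H, P u ∈ g)
    (hQ : ∀ u : H, Q u ∈ LieAlgebra.center ℝ H)
    (hPQ : ∀ u : H, P u + Q u = u)
    -- `W u` is the extension to `h` of `ω_u* : Z(h) → g` (vanishing on `g`), characterized by
    -- `⟨ω_u*(x), v⟩_g = ⟨ω(u,v), x⟩_z`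
    (W : H → Module.End ℝ H)
    (hWg : ∀ u x : H, W u x ∈ g)
    (hWz : ∀ u : H, ∀ v ∈ g, W u v = 0)
    (hWdef : ∀ u ∈ g, ∀ x ∈ LieAlgebra.center ℝ H, ∀ v ∈ g,
      B (W u x) v = B (Q ⁅u, v⁆) x)
    -- `D : g → g` is the symmetric endomorphism with `⟨Du, v⟩_g = tr(ω_u* ∘ ω_v)`
    (D : Module.End ℝ H)
    (hDg : ∀ u ∈ g, D u ∈ g)
    (hDdef : ∀ u ∈ g, ∀ v ∈ g,
      B (D u) v = LinearMap.trace ℝ H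
        (W u ∘ₗ (Q ∘ₗ (LieAlgebra.ad ℝ H v : Module.End ℝ H))))
    -- `adgStar u` is the adjoint of `ad_u^g` with respect to `⟨·,·⟩_g`
    (adgStar : H → Module.End ℝ H)
    (hadgStarg : ∀ u ∈ g, ∀ v ∈ g, adgStar u v ∈ g)
    (hadgStar : ∀ u ∈ g, ∀ v ∈ g, ∀ w ∈ g, B (adgStar u v) w = B v (P ⁅u, w⁆))
    -- the hypothesis `ω(ad_u* v, w) + ω(v, ad_u* w) = 0` for all `u,v,w ∈ g`
    (hom : ∀ u ∈ g, ∀ v ∈ g, ∀ w ∈ g,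
      Q ⁅adgStar u v, w⁆ + Q ⁅v, adgStar u w⁆ = 0) :
    -- conclusion: `D` is a derivation of `(g, [·,·]_g)`
    ∀ u ∈ g, ∀ v ∈ g, D (P ⁅u, v⁆) = P ⁅D u, v⁆ + P ⁅u, D v⁆ := by
  set Z := LieAlgebra.center ℝ H
  have central : ∀ z ∈ Z, ∀ a : H, ⁅a, z⁆ = 0 := fun z hz a =>
    (LieModule.mem_maxTrivSubmodule ℝ H H z).1 hz a
  have bracket_P : ∀ a c : H, ⁅a, P c⁆ = ⁅a, c⁆ := fun a c => by
    conv_rhs => rw [← hPQ c, lie_add, central _ (hQ c), add_zero]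
  have bracket_skew : ∀ (F : H →ₗ[ℝ] H) (a c : H), F ⁅a, c⁆ = -F ⁅c, a⁆ := fun F a c => by
    rw [← lie_skew, map_neg]
  have ext_g : ∀ a ∈ g, ∀ c ∈ g, (∀ w ∈ g, B a w = B c w) → a = c := by
    intro a ha c hc h
    refine sub_eq_zero.1 (hnd _ fun w => ?_)
    rw [← hPQ w, map_add, (hg _).1 (g.sub_mem ha hc) _ (hQ w), map_sub, LinearMap.sub_apply,
      h _ (hP w), sub_self, add_zero]
  have W_sub : ∀ a ∈ g, ∀ c ∈ g, ∀ x ∈ Z, W (a - c) x = W a x - W c x := by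
    intro a ha c hc x hx
    refine ext_g _ (hWg _ _) _ (g.sub_mem (hWg _ _) (hWg _ _)) fun w hw => ?_
    rw [hWdef _ (g.sub_mem ha hc) x hx w hw, map_sub, LinearMap.sub_apply, hWdef a ha x hx w hw,
      hWdef c hc x hx w hw, sub_lie, map_sub, map_sub, LinearMap.sub_apply]
  have W_skew : ∀ a ∈ g, ∀ c ∈ g, ∀ x ∈ Z, B (W a x) c = -B (W c x) a := by
    intro a ha c hc x hx
    rw [hWdef a ha x hx c hc, hWdef c hc x hx a ha, bracket_skew Q, map_neg, LinearMap.neg_apply]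
  have W_bracket : ∀ u ∈ g, ∀ v ∈ g, ∀ x ∈ Z,
      W (P ⁅u, v⁆) x = adgStar v (W u x) - adgStar u (W v x) := by
    intro u hu v hv x hx
    refine ext_g _ (hWg _ _) _
      (g.sub_mem (hadgStarg v hv _ (hWg _ _)) (hadgStarg u hu _ (hWg _ _))) fun w hw => ?_
    rw [hWdef _ (hP _) x hx w hw, map_sub, LinearMap.sub_apply, hadgStar v hv _ (hWg _ _) w hw,
      hadgStar u hu _ (hWg _ _) w hw, hWdef u hu x hx _ (hP _), hWdef v hv x hx _ (hP _),
      bracket_P, bracket_P, bracket_skew Q, bracket_P, ← bracket_skew Q, lie_lie, map_sub,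
      map_sub, LinearMap.sub_apply]
  have W_adgStar : ∀ u ∈ g, ∀ a ∈ g, ∀ y ∈ Z, W (adgStar u a) y = -P ⁅u, W a y⁆ := by
    intro u hu a ha y hy
    refine ext_g _ (hWg _ _) _ (g.neg_mem (hP _)) fun w hw => ?_
    rw [hWdef _ (hadgStarg u hu a ha) y hy w hw, eq_neg_of_add_eq_zero_left (hom u hu a ha w hw),
      map_neg, LinearMap.neg_apply, ← hWdef a ha y hy _ (hadgStarg u hu w hw), hsymm,
      hadgStar u hu w hw _ (hWg _ _), hsymm, map_neg, LinearMap.neg_apply]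
  have W_W_derivation : ∀ u ∈ g, ∀ v ∈ g, ∀ x ∈ Z, ∀ y ∈ Z,
      W (W (P ⁅u, v⁆) x) y = P ⁅W (W u x) y, v⁆ + P ⁅u, W (W v x) y⁆ := by
    intro u hu v hv x hx y hy
    rw [W_bracket u hu v hv x hx, W_sub _ (hadgStarg v hv _ (hWg _ _)) _
      (hadgStarg u hu _ (hWg _ _)) y hy, W_adgStar v hv _ (hWg _ _) y hy,
      W_adgStar u hu _ (hWg _ _) y hy, bracket_skew P (W _ _) v]
    abel
  let β : LinearMap.BilinForm ℝ Z.toSubmodule := B.domRestrict₁₂ Z.toSubmodule Z.toSubmodule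
  have hβ : β.Nondegenerate := by
    refine ⟨fun z hz => ?_, fun z hz => ?_⟩
    · exact Subtype.ext (hZnd z z.2 fun w hw => hz ⟨w, hw⟩)
    · exact Subtype.ext (hZnd z z.2 fun w hw => (hsymm _ _).trans (hz ⟨w, hw⟩))
  let b := Module.finBasis ℝ Z.toSubmodule
  let b' := β.dualBasis hβ b
  have D_eq : ∀ u ∈ g, D u = -∑ i, W (W u (b' i)) (b i) := by
    intro u hu
    refine ext_g _ (hDg u hu) _ (g.neg_mem (g.sum_mem fun i _ => hWg _ _)) fun v hv => ?_
    let q : H →ₗ[ℝ] Z.toSubmodule :=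
      (Q ∘ₗ (LieAlgebra.ad ℝ H v : Module.End ℝ H)).codRestrict Z.toSubmodule fun a => hQ _
    have hq : W u ∘ₗ (Q ∘ₗ (LieAlgebra.ad ℝ H v : Module.End ℝ H)) =
        (W u ∘ₗ Z.toSubmodule.subtype) ∘ₗ q := rfl
    rw [hDdef u hu v hv, hq, LinearMap.trace_comp_comm', trace_eq_sum_dualBasis β hβ b, map_neg,
      LinearMap.neg_apply, map_sum, LinearMap.sum_apply, ← Finset.sum_neg_distrib]
    refine Finset.sum_congr rfl fun i _ => ?_
    rw [← W_skew v hv _ (hWg _ _) _ (b i).2, hWdef v hv _ (b i).2 _ (hWg _ _)]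
    rfl
  intro u hu v hv
  rw [D_eq _ (hP _), D_eq u hu, D_eq v hv, neg_lie, lie_neg, map_neg, map_neg, ← neg_add,
    sum_lie, lie_sum, map_sum, map_sum, ← Finset.sum_add_distrib]
  exact congrArg _ (Finset.sum_congr rfl fun i _ =>
    W_W_derivation u hu v hv _ (b' i).2 _ (b i).2)
end
end

section
/- Let (h,[·,·],⟨·,·⟩) be a Lorentzian nilpotent Lie algebra with nondegenerate Euclidean center, with attributes (g,⟨·,·⟩_g,[·,·]_g), (Z(h),⟨·,·⟩_z) and ω. Then the Ricci curvature ric_h of h is given by: ric_h(u,v) = ric_g(u,v) − (1/2)tr(ω_u* ∘ ω_v) for all u,v ∈ g; ric_h(x,y) = −(1/4)tr(S_x ∘ S_y) for all x,y ∈ Z(h); and ric_h(u,x) = −(1/4)tr(J_u ∘ S_x) for all u ∈ g, x ∈ Z(h), where ric_g denotes the Ricci curvature of (g,[·,·]_g,⟨·,·⟩_g) and J_u is computed in g. -/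
open Module LinearMap

noncomputable section

/-- Two endomorphisms adjoint to each other for a nondegenerate bilinear form have the same
trace. -/
theorem trace_eq_of_isAdjointPair {K V : Type*} [Field K] [AddCommGroup V] [Module K V]
    [Module.Finite K V] {B : V →ₗ[K] V →ₗ[K] K} (hB : ∀ u, (∀ v, B u v = 0) → u = 0)
    {f f' : Module.End K V} (h : ∀ u v, B (f u) v = B u (f' v)) :
    LinearMap.trace K V f = LinearMap.trace K V f' := by
  have hinj : Function.Injective B :=
    (injective_iff_map_eq_zero B).2 fun u hu => hB u fun v => by simp [hu]
  let e : V ≃ₗ[K] Dual K V :=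
    LinearEquiv.ofInjectiveOfFinrankEq B hinj Subspace.dual_finrank_eq.symm
  have he : e.conj f = Dual.transpose (R := K) f' := by
    ext φ v
    obtain ⟨u, rfl⟩ := e.surjective φ
    rw [LinearEquiv.conj_apply_apply, LinearEquiv.symm_apply_apply]
    exact h u v
  rw [← LinearMap.trace_conj' f e, he, LinearMap.trace_transpose']

/-- Let `(h,[·,·],⟨·,·⟩)` be a Lorentzian nilpotent Lie algebra with
nondegenerate Euclidean center, with attributes `(g, ⟨·,·⟩_g, [·,·]_g)`, `(Z(h), ⟨·,·⟩_z)` and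
`ω` (here `g = Z(h)^⊥`, `[u,v]_g = P⁅u,v⁆`, `ω(u,v) = Q⁅u,v⁆`).  Then
`ric_h(u,v) = ric_g(u,v) − ½ tr(ω_u* ∘ ω_v)` for `u,v ∈ g`,
`ric_h(x,y) = −¼ tr(S_x ∘ S_y)` for `x,y ∈ Z(h)`, and
`ric_h(u,x) = −¼ tr(J_u ∘ S_x)` for `u ∈ g`, `x ∈ Z(h)` (with `J_u` computed in `g`). -/
theorem statement3
    {H : Type*} [LieRing H] [LieAlgebra ℝ H] [Module.Finite ℝ H]
    (B : H →ₗ[ℝ] H →ₗ[ℝ] ℝ)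
    (hsymm : ∀ u v : H, B u v = B v u)
    (hnd : ∀ u : H, (∀ v : H, B u v = 0) → u = 0)
    (hLor : IsLorentzianForm B)
    (hnilp : ∃ k, LieModule.lowerCentralSeries ℝ H H k = ⊥)
    (hZnd : ∀ z ∈ LieAlgebra.center ℝ H,
      (∀ w ∈ LieAlgebra.center ℝ H, B z w = 0) → z = 0)
    (hZeucl : ∀ z ∈ LieAlgebra.center ℝ H, z ≠ 0 → 0 < B z z)
    -- `g` is the orthogonal complement of the center
    (g : Submodule ℝ H)
    (hg : ∀ u : H, u ∈ g ↔ ∀ z ∈ LieAlgebra.center ℝ H, B u z = 0)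
    -- `P`, `Q` are the projections onto `g` and `Z(h)` in `h = g ⊕ Z(h)`
    (P Q : H →ₗ[ℝ] H)
    (hP : ∀ u : H, P u ∈ g)
    (hQ : ∀ u : H, Q u ∈ LieAlgebra.center ℝ H)
    (hPQ : ∀ u : H, P u + Q u = u)
    -- `adStar u` is the adjoint of `ad u` in `h` with respect to `B`
    (adStar : H → Module.End ℝ H)
    (hadStar : ∀ u v w : H, B (adStar u v) w = B v ⁅u, w⁆)
    -- `Jm u` is the skew-symmetric endomorphism `J_u(v) = ad_v*(u)` of `h`
    (Jm : H → Module.End ℝ H)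
    (hJm : ∀ u v w : H, B (Jm u v) w = B u ⁅v, w⁆)
    -- `adgStar u` is the adjoint of `ad_u^g` in `(g, [·,·]_g)`, extended by `0` on `Z(h)`
    (adgStar : H → Module.End ℝ H)
    (hadgStarg : ∀ u ∈ g, ∀ v ∈ g, adgStar u v ∈ g)
    (hadgStar0 : ∀ u ∈ g, ∀ z ∈ LieAlgebra.center ℝ H, adgStar u z = 0)
    (hadgStar : ∀ u ∈ g, ∀ v ∈ g, ∀ w ∈ g, B (adgStar u v) w = B v (P ⁅u, w⁆))
    -- `Jg u` (for `u ∈ g`) is the endomorphism `J_u` of `(g,[·,·]_g)`, extended by `0` on `Z(h)`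
    (Jg : H → Module.End ℝ H)
    (hJgg : ∀ u ∈ g, ∀ v ∈ g, Jg u v ∈ g)
    (hJg0 : ∀ u ∈ g, ∀ z ∈ LieAlgebra.center ℝ H, Jg u z = 0)
    (hJg : ∀ u ∈ g, ∀ v ∈ g, ∀ w ∈ g, B (Jg u v) w = B u (P ⁅v, w⁆))
    -- `W u` is the extension to `h` of `ω_u* : Z(h) → g` (vanishing on `g`)
    (W : H → Module.End ℝ H)
    (hWg : ∀ u x : H, W u x ∈ g)
    (hWz : ∀ u : H, ∀ v ∈ g, W u v = 0)
    (hWdef : ∀ u ∈ g, ∀ x ∈ LieAlgebra.center ℝ H, ∀ v ∈ g,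
      B (W u x) v = B (Q ⁅u, v⁆) x)
    -- `S x` (for `x ∈ Z(h)`) : `S_x(u) = ω_u*(x)`, extended by `0` on `Z(h)`
    (S : H → Module.End ℝ H)
    (hSg : ∀ x ∈ LieAlgebra.center ℝ H, ∀ u ∈ g, S x u ∈ g)
    (hS0 : ∀ x ∈ LieAlgebra.center ℝ H, ∀ z ∈ LieAlgebra.center ℝ H, S x z = 0)
    (hSdef : ∀ x ∈ LieAlgebra.center ℝ H, ∀ u ∈ g, ∀ v ∈ g,
      B (S x u) v = B (Q ⁅u, v⁆) x) :
    -- `ric_h(u,v) = ric_g(u,v) − ½ tr(ω_u* ∘ ω_v)` for `u, v ∈ g`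
    (∀ u ∈ g, ∀ v ∈ g,
      -(1/2) * LinearMap.trace ℝ H ((LieAlgebra.ad ℝ H u : Module.End ℝ H) ∘ₗ adStar v)
        - (1/4) * LinearMap.trace ℝ H (Jm u ∘ₗ Jm v)
      = (-(1/2) * LinearMap.trace ℝ H
            ((P ∘ₗ (LieAlgebra.ad ℝ H u : Module.End ℝ H)) ∘ₗ adgStar v)
          - (1/4) * LinearMap.trace ℝ H (Jg u ∘ₗ Jg v))
        - (1/2) * LinearMap.trace ℝ H
            (W u ∘ₗ (Q ∘ₗ (LieAlgebra.ad ℝ H v : Module.End ℝ H)))) ∧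
    -- `ric_h(x,y) = −¼ tr(S_x ∘ S_y)` for `x, y ∈ Z(h)`
    (∀ x ∈ LieAlgebra.center ℝ H, ∀ y ∈ LieAlgebra.center ℝ H,
      -(1/2) * LinearMap.trace ℝ H ((LieAlgebra.ad ℝ H x : Module.End ℝ H) ∘ₗ adStar y)
        - (1/4) * LinearMap.trace ℝ H (Jm x ∘ₗ Jm y)
      = -(1/4) * LinearMap.trace ℝ H (S x ∘ₗ S y)) ∧
    -- `ric_h(u,x) = −¼ tr(J_u ∘ S_x)` for `u ∈ g`, `x ∈ Z(h)`
    (∀ u ∈ g, ∀ x ∈ LieAlgebra.center ℝ H,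
      -(1/2) * LinearMap.trace ℝ H ((LieAlgebra.ad ℝ H u : Module.End ℝ H) ∘ₗ adStar x)
        - (1/4) * LinearMap.trace ℝ H (Jm u ∘ₗ Jm x)
      = -(1/4) * LinearMap.trace ℝ H (Jg u ∘ₗ S x)) := by
  have lie_center : ∀ z ∈ LieAlgebra.center ℝ H, ∀ v, ⁅v, z⁆ = 0 := fun z hz =>
    (LieModule.mem_maxTrivSubmodule ℝ H H z).1 hz
  have center_lie : ∀ z ∈ LieAlgebra.center ℝ H, ∀ v : H, ⁅z, v⁆ = 0 := fun z hz v => by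
    rw [← lie_skew, lie_center z hz, neg_zero]
  have orth : ∀ u ∈ g, ∀ z ∈ LieAlgebra.center ℝ H, B u z = 0 := fun u hu => (hg u).1 hu
  have orth' : ∀ u ∈ g, ∀ z ∈ LieAlgebra.center ℝ H, B z u = 0 := fun u hu z hz => by
    rw [hsymm, orth u hu z hz]
  have eq_of_form : ∀ a b : H, (∀ w ∈ g, B a w = B b w) →
      (∀ z ∈ LieAlgebra.center ℝ H, B a z = B b z) → a = b := by
    intro a b h₁ h₂
    refine sub_eq_zero.1 (hnd _ fun v => ?_)
    rw [← hPQ v, map_sub, LinearMap.sub_apply, map_add, map_add, h₁ _ (hP v), h₂ _ (hQ v),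
      sub_self]
  have end_ext : ∀ f f' : Module.End ℝ H, (∀ w ∈ g, f w = f' w) →
      (∀ z ∈ LieAlgebra.center ℝ H, f z = f' z) → f = f' := by
    intro f f' h₁ h₂
    ext v
    rw [← hPQ v, map_add, map_add, h₁ _ (hP v), h₂ _ (hQ v)]
  have form_P : ∀ u ∈ g, ∀ t, B u (P t) = B u t := fun u hu t => by
    conv_rhs => rw [← hPQ t, map_add, orth u hu _ (hQ t), add_zero]
  have form_Q : ∀ z ∈ LieAlgebra.center ℝ H, ∀ t, B z (Q t) = B z t := fun z hz t => by
    conv_rhs => rw [← hPQ t, map_add, orth' _ (hP t) z hz, zero_add]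
  have lie_P : ∀ u t : H, ⁅u, P t⁆ = ⁅u, t⁆ := fun u t => by
    conv_rhs => rw [← hPQ t, lie_add, lie_center _ (hQ t), add_zero]
  have W_Q : ∀ u t, W u (Q t) = W u t := fun u t => by
    conv_rhs => rw [← hPQ t, map_add, hWz u _ (hP t), zero_add]
  have Jm_eq_Jg : ∀ u ∈ g, Jm u = Jg u := fun u hu => by
    refine end_ext _ _ (fun v hv => eq_of_form _ _ (fun w hw => ?_) fun z hz => ?_)
      fun z hz => eq_of_form _ _ (fun w hw => ?_) fun z' hz' => ?_
    · rw [hJm, hJg u hu v hv w hw, form_P u hu]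
    · rw [hJm, lie_center z hz, map_zero, orth _ (hJgg u hu v hv) z hz]
    · simp [hJm, center_lie z hz, hJg0 u hu z hz]
    · simp [hJm, center_lie z hz, hJg0 u hu z hz]
  have Jm_eq_S : ∀ x ∈ LieAlgebra.center ℝ H, Jm x = S x := fun x hx => by
    refine end_ext _ _ (fun v hv => eq_of_form _ _ (fun w hw => ?_) fun z hz => ?_)
      fun z hz => eq_of_form _ _ (fun w hw => ?_) fun z' hz' => ?_
    · rw [hJm, hSdef x hx v hv w hw, hsymm _ x, form_Q x hx]
    · rw [hJm, lie_center z hz, map_zero, orth _ (hSg x hx v hv) z hz]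
    · simp [hJm, center_lie z hz, hS0 x hx z hz]
    · simp [hJm, center_lie z hz, hS0 x hx z hz]
  have adStar_center : ∀ x ∈ LieAlgebra.center ℝ H, adStar x = 0 := fun x hx => by
    ext v
    exact hnd _ fun w => by rw [hadStar, center_lie x hx, map_zero]
  have adStar_eq : ∀ v ∈ g, adStar v = adgStar v + W v := fun v hv => by
    refine end_ext _ _ (fun w hw => eq_of_form _ _ (fun t ht => ?_) fun z hz => ?_)
      fun z hz => eq_of_form _ _ (fun t ht => ?_) fun z' hz' => ?_
    · rw [LinearMap.add_apply, hWz v w hw, add_zero, hadStar, hadgStar v hv w hw t ht,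
        form_P w hw]
    · rw [LinearMap.add_apply, hWz v w hw, add_zero, hadStar, lie_center z hz, map_zero,
        orth _ (hadgStarg v hv w hw) z hz]
    · rw [LinearMap.add_apply, hadgStar0 v hv z hz, zero_add, hadStar, hWdef v hv z hz t ht,
        hsymm _ z, form_Q z hz]
    · rw [LinearMap.add_apply, hadgStar0 v hv z hz, zero_add, hadStar, lie_center z' hz',
        map_zero, orth _ (hWg v z) z' hz']
  have form_W : ∀ u ∈ g, ∀ s t, B (W u s) t = B s (Q ⁅u, t⁆) := fun u hu s t => by
    rw [← W_Q, ← form_P _ (hWg u _), hWdef u hu _ (hQ s) _ (hP t), lie_P,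
      form_Q _ (hQ _), hsymm]
  have trace_W : ∀ u ∈ g, ∀ v ∈ g,
      LinearMap.trace ℝ H ((LieAlgebra.ad ℝ H u : Module.End ℝ H) ∘ₗ W v) =
        LinearMap.trace ℝ H (W u ∘ₗ (Q ∘ₗ (LieAlgebra.ad ℝ H v : Module.End ℝ H))) := by
    intro u hu v hv
    have hW : W v = W v ∘ₗ Q := LinearMap.ext fun t => (W_Q v t).symm
    rw [LinearMap.trace_comp_comm', hW, LinearMap.comp_assoc]
    refine trace_eq_of_isAdjointPair hnd fun s t => ?_
    simp only [LinearMap.comp_apply, LieAlgebra.ad_apply]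
    rw [form_W v hv, hsymm, ← form_W u hu, hsymm]
  have trace_adgStar : ∀ u, ∀ v ∈ g,
      LinearMap.trace ℝ H ((LieAlgebra.ad ℝ H u : Module.End ℝ H) ∘ₗ adgStar v) =
        LinearMap.trace ℝ H ((P ∘ₗ (LieAlgebra.ad ℝ H u : Module.End ℝ H)) ∘ₗ adgStar v) := by
    intro u v hv
    rw [LinearMap.trace_comp_comm', LinearMap.trace_comp_comm' _ (P ∘ₗ _)]
    congr 1
    ext t
    simp only [LinearMap.comp_apply]
    conv_lhs => rw [← hPQ (LieAlgebra.ad ℝ H u t), map_add, hadgStar0 v hv _ (hQ _), add_zero]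
  refine ⟨fun u hu v hv => ?_, fun x hx y hy => ?_, fun u hu x hx => ?_⟩
  · rw [adStar_eq v hv, LinearMap.comp_add, map_add, trace_W u hu v hv, trace_adgStar u v hv,
      Jm_eq_Jg u hu, Jm_eq_Jg v hv]
    ring
  · rw [adStar_center y hy, Jm_eq_S x hx, Jm_eq_S y hy, LinearMap.comp_zero, map_zero]
    ring
  · rw [adStar_center x hx, Jm_eq_Jg u hu, Jm_eq_S x hx, LinearMap.comp_zero, map_zero]
    ring
end
end

section
/- Let (h,[·,·],⟨·,·⟩) be a Lorentzian nilpotent Lie algebra with nondegenerate Euclidean center, with attributes (g,⟨·,·⟩_g,[·,·]_g), (Z(h),⟨·,·⟩_z) and ω, and let λ ∈ ℝ. Then (h,[·,·],⟨·,·⟩) is λ-Einstein if and only if for all u,v ∈ g and all x,y ∈ Z(h): ric_g(u,v) = λ⟨u,v⟩_g + (1/2)tr(ω_u* ∘ ω_v), tr(J_u ∘ S_x) = 0, and tr(S_x ∘ S_y) = −4λ⟨x,y⟩_z, where ric_g is the Ricci curvature of (g,[·,·]_g,⟨·,·⟩_g) and J_u is computed in g. -/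
open Module LinearMap

noncomputable section

/-- Endomorphisms adjoint to each other for a nondegenerate bilinear form have equal traces. -/
theorem trace_eq_of_adjoint {H : Type*} [AddCommGroup H] [Module ℝ H] [Module.Finite ℝ H]
    (B : H →ₗ[ℝ] H →ₗ[ℝ] ℝ) (hnd : ∀ u : H, (∀ v : H, B u v = 0) → u = 0)
    (A A' : Module.End ℝ H) (h : ∀ u v : H, B (A u) v = B u (A' v)) :
    LinearMap.trace ℝ H A = LinearMap.trace ℝ H A' := by
  have hinj : Function.Injective B := by
    refine (injective_iff_map_eq_zero B).2 fun u hu => hnd u fun v => ?_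
    simp [hu]
  let e : H ≃ₗ[ℝ] Module.Dual ℝ H :=
    LinearEquiv.ofInjectiveOfFinrankEq B hinj Subspace.dual_finrank_eq.symm
  have he : e.conj A = Module.Dual.transpose (R := ℝ) A' := by
    ext f w
    obtain ⟨u, rfl⟩ := e.surjective f
    have hB : ∀ a : H, e a = B a := fun _ => rfl
    have hs : e.symm (B u) = u := e.symm_apply_apply u
    simpa [LinearEquiv.conj_apply, Module.Dual.transpose_apply, hB, hs] using h u w
  rw [← LinearMap.trace_transpose' (R := ℝ) A', ← he, LinearMap.trace_conj']

/-- With the attributes `(g, ⟨·,·⟩_g, [·,·]_g)`, `(Z(h), ⟨·,·⟩_z)`, `ω` of a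
Lorentzian nilpotent Lie algebra `h` with nondegenerate Euclidean center, and `λ ∈ ℝ`:
`h` is `λ`-Einstein iff for all `u,v ∈ g` and `x,y ∈ Z(h)`:
`ric_g(u,v) = λ⟨u,v⟩_g + ½ tr(ω_u* ∘ ω_v)`, `tr(J_u ∘ S_x) = 0` and
`tr(S_x ∘ S_y) = −4λ⟨x,y⟩_z`. -/
theorem statement4
    {H : Type*} [LieRing H] [LieAlgebra ℝ H] [Module.Finite ℝ H]
    (B : H →ₗ[ℝ] H →ₗ[ℝ] ℝ)
    (hsymm : ∀ u v : H, B u v = B v u)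
    (hnd : ∀ u : H, (∀ v : H, B u v = 0) → u = 0)
    (hLor : IsLorentzianForm B)
    (hnilp : ∃ k, LieModule.lowerCentralSeries ℝ H H k = ⊥)
    (hZnd : ∀ z ∈ LieAlgebra.center ℝ H,
      (∀ w ∈ LieAlgebra.center ℝ H, B z w = 0) → z = 0)
    (hZeucl : ∀ z ∈ LieAlgebra.center ℝ H, z ≠ 0 → 0 < B z z)
    -- `g` is the orthogonal complement of the center
    (g : Submodule ℝ H)
    (hg : ∀ u : H, u ∈ g ↔ ∀ z ∈ LieAlgebra.center ℝ H, B u z = 0)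
    -- `P`, `Q` are the projections onto `g` and `Z(h)` in `h = g ⊕ Z(h)`
    (P Q : H →ₗ[ℝ] H)
    (hP : ∀ u : H, P u ∈ g)
    (hQ : ∀ u : H, Q u ∈ LieAlgebra.center ℝ H)
    (hPQ : ∀ u : H, P u + Q u = u)
    -- `adStar u` is the adjoint of `ad u` in `h` with respect to `B`
    (adStar : H → Module.End ℝ H)
    (hadStar : ∀ u v w : H, B (adStar u v) w = B v ⁅u, w⁆)
    -- `Jm u` is the skew-symmetric endomorphism `J_u(v) = ad_v*(u)` of `h`
    (Jm : H → Module.End ℝ H)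
    (hJm : ∀ u v w : H, B (Jm u v) w = B u ⁅v, w⁆)
    -- `adgStar u` is the adjoint of `ad_u^g` in `(g, [·,·]_g)`, extended by `0` on `Z(h)`
    (adgStar : H → Module.End ℝ H)
    (hadgStarg : ∀ u ∈ g, ∀ v ∈ g, adgStar u v ∈ g)
    (hadgStar0 : ∀ u ∈ g, ∀ z ∈ LieAlgebra.center ℝ H, adgStar u z = 0)
    (hadgStar : ∀ u ∈ g, ∀ v ∈ g, ∀ w ∈ g, B (adgStar u v) w = B v (P ⁅u, w⁆))
    -- `Jg u` (for `u ∈ g`) is the endomorphism `J_u` of `(g,[·,·]_g)`, extended by `0` on `Z(h)`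
    (Jg : H → Module.End ℝ H)
    (hJgg : ∀ u ∈ g, ∀ v ∈ g, Jg u v ∈ g)
    (hJg0 : ∀ u ∈ g, ∀ z ∈ LieAlgebra.center ℝ H, Jg u z = 0)
    (hJg : ∀ u ∈ g, ∀ v ∈ g, ∀ w ∈ g, B (Jg u v) w = B u (P ⁅v, w⁆))
    -- `W u` is the extension to `h` of `ω_u* : Z(h) → g` (vanishing on `g`)
    (W : H → Module.End ℝ H)
    (hWg : ∀ u x : H, W u x ∈ g)
    (hWz : ∀ u : H, ∀ v ∈ g, W u v = 0)
    (hWdef : ∀ u ∈ g, ∀ x ∈ LieAlgebra.center ℝ H, ∀ v ∈ g,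
      B (W u x) v = B (Q ⁅u, v⁆) x)
    -- `S x` (for `x ∈ Z(h)`) : `S_x(u) = ω_u*(x)`, extended by `0` on `Z(h)`
    (S : H → Module.End ℝ H)
    (hSg : ∀ x ∈ LieAlgebra.center ℝ H, ∀ u ∈ g, S x u ∈ g)
    (hS0 : ∀ x ∈ LieAlgebra.center ℝ H, ∀ z ∈ LieAlgebra.center ℝ H, S x z = 0)
    (hSdef : ∀ x ∈ LieAlgebra.center ℝ H, ∀ u ∈ g, ∀ v ∈ g,
      B (S x u) v = B (Q ⁅u, v⁆) x)
    (lam : ℝ) :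
    -- `h` is `λ`-Einstein ...
    (∀ u v : H,
      -(1/2) * LinearMap.trace ℝ H ((LieAlgebra.ad ℝ H u : Module.End ℝ H) ∘ₗ adStar v)
        - (1/4) * LinearMap.trace ℝ H (Jm u ∘ₗ Jm v) = lam * B u v)
    ↔
    -- ... iff the three conditions hold
    ((∀ u ∈ g, ∀ v ∈ g,
        -(1/2) * LinearMap.trace ℝ H
            ((P ∘ₗ (LieAlgebra.ad ℝ H u : Module.End ℝ H)) ∘ₗ adgStar v)
          - (1/4) * LinearMap.trace ℝ H (Jg u ∘ₗ Jg v)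
        = lam * B u v + (1/2) * LinearMap.trace ℝ H
            (W u ∘ₗ (Q ∘ₗ (LieAlgebra.ad ℝ H v : Module.End ℝ H)))) ∧
      (∀ u ∈ g, ∀ x ∈ LieAlgebra.center ℝ H,
        LinearMap.trace ℝ H (Jg u ∘ₗ S x) = 0) ∧
      (∀ x ∈ LieAlgebra.center ℝ H, ∀ y ∈ LieAlgebra.center ℝ H,
        LinearMap.trace ℝ H (S x ∘ₗ S y) = -4 * lam * B x y)) := by
  have hcr : ∀ x ∈ LieAlgebra.center ℝ H, ∀ u : H, ⁅u, x⁆ = 0 := fun x hx u =>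
    (LieModule.mem_maxTrivSubmodule ℝ H H x).1 hx u
  have hcl : ∀ x ∈ LieAlgebra.center ℝ H, ∀ u : H, ⁅x, u⁆ = 0 := fun x hx u => by
    rw [← lie_skew, hcr x hx, neg_zero]
  have hgz : ∀ u ∈ g, ∀ z ∈ LieAlgebra.center ℝ H, B u z = 0 := fun u hu => (hg u).1 hu
  have hzg : ∀ u ∈ g, ∀ z ∈ LieAlgebra.center ℝ H, B z u = 0 := fun u hu z hz => by
    rw [hsymm, hgz u hu z hz]
  have hext : ∀ u v : H, (∀ w, B u w = B v w) → u = v := fun u v h =>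
    sub_eq_zero.1 (hnd _ fun w => by simp [h w])
  have hlP : ∀ u v : H, ⁅u, P v⁆ = ⁅u, v⁆ := fun u v => by
    conv_rhs => rw [← hPQ v, lie_add, hcr _ (hQ v), add_zero]
  have hPl : ∀ u v : H, ⁅P u, v⁆ = ⁅u, v⁆ := fun u v => by
    conv_rhs => rw [← hPQ u, add_lie, hcl _ (hQ u), add_zero]
  have hBPr : ∀ u ∈ g, ∀ v, B u (P v) = B u v := fun u hu v => by
    conv_rhs => rw [← hPQ v, map_add, hgz u hu _ (hQ v), add_zero]
  have hBQl : ∀ x ∈ LieAlgebra.center ℝ H, ∀ v, B (Q v) x = B v x := fun x hx v => by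
    conv_rhs => rw [← hPQ v, map_add, LinearMap.add_apply, hgz _ (hP v) x hx, zero_add]
  -- an element of `g` is determined by its pairing with `g`
  have hextg : ∀ u v : H, (∀ z ∈ LieAlgebra.center ℝ H, B u z = 0) → v ∈ g →
      (∀ w ∈ g, B u w = B v w) → u = v := fun u v hu hv h => by
    refine hext u v fun w => ?_
    rw [← hPQ w, map_add, map_add, h _ (hP w), hu _ (hQ w), hgz v hv _ (hQ w)]
  -- the adjoint operators of `h` in terms of those of `g` and `ω`
  have hadS : ∀ u ∈ g, adStar u = adgStar u + W u := fun u hu => by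
    ext v
    have hgp : adgStar u (P v) = adgStar u v := by
      conv_rhs => rw [← hPQ v, map_add, hadgStar0 u hu _ (hQ v), add_zero]
    have hWp : W u (Q v) = W u v := by
      conv_rhs => rw [← hPQ v, map_add, hWz u _ (hP v), zero_add]
    rw [LinearMap.add_apply, ← hgp]
    refine hextg _ _ (fun z hz => ?_) (g.add_mem (hadgStarg u hu _ (hP v)) (hWg u v)) fun w hw => ?_
    · rw [hadStar, hcr z hz, map_zero]
    · rw [hadStar, map_add, LinearMap.add_apply, hadgStar u hu _ (hP v) w hw, ← hWp,
        hWdef u hu _ (hQ v) w hw, hBPr _ (hP v), hBQl _ (hQ v), hsymm _ (Q v),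
        ← LinearMap.add_apply, ← map_add, hPQ]
  have hadS0 : ∀ x ∈ LieAlgebra.center ℝ H, adStar x = 0 := fun x hx => by
    ext v
    refine hnd _ fun w => ?_
    rw [hadStar, hcl x hx, map_zero]
  have hJmg : ∀ u ∈ g, Jm u = Jg u := fun u hu => by
    ext v
    have hgp : Jg u (P v) = Jg u v := by
      conv_rhs => rw [← hPQ v, map_add, hJg0 u hu _ (hQ v), add_zero]
    rw [← hgp]
    refine hextg _ _ (fun z hz => ?_) (hJgg u hu _ (hP v)) fun w hw => ?_
    · rw [hJm, hcr z hz, map_zero]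
    · rw [hJm, hJg u hu _ (hP v) w hw, hBPr u hu, hPl]
  have hJmz : ∀ x ∈ LieAlgebra.center ℝ H, Jm x = S x := fun x hx => by
    ext v
    have hgp : S x (P v) = S x v := by
      conv_rhs => rw [← hPQ v, map_add, hS0 x hx _ (hQ v), add_zero]
    rw [← hgp]
    refine hextg _ _ (fun z hz => ?_) (hSg x hx _ (hP v)) fun w hw => ?_
    · rw [hJm, hcr z hz, map_zero]
    · rw [hJm, hSdef x hx _ (hP v) w hw, hBQl x hx, hPl, hsymm]
  have hadS_add : ∀ u v, adStar (u + v) = adStar u + adStar v := fun u v => by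
    ext w
    refine hext _ _ fun t => ?_
    simp [hadStar]
  have hJm_add : ∀ u v, Jm (u + v) = Jm u + Jm v := fun u v => by
    ext w
    refine hext _ _ fun t => ?_
    simp [hJm]
  have hWadj : ∀ u ∈ g, ∀ a b : H, B (W u a) b = B a (Q ⁅u, b⁆) := fun u hu a b => by
    have hWp : W u (Q a) = W u a := by
      conv_rhs => rw [← hPQ a, map_add, hWz u _ (hP a), zero_add]
    rw [← hBPr _ (hWg u a), ← hWp, hWdef u hu _ (hQ a) _ (hP b), hlP, hsymm, hBQl _ (hQ _)]
  have hWsymm : ∀ u ∈ g, ∀ v ∈ g,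
      LinearMap.trace ℝ H (W u ∘ₗ (Q ∘ₗ (LieAlgebra.ad ℝ H v : Module.End ℝ H))) =
      LinearMap.trace ℝ H (W v ∘ₗ (Q ∘ₗ (LieAlgebra.ad ℝ H u : Module.End ℝ H))) :=
    fun u hu v hv => by
      refine trace_eq_of_adjoint B hnd _ _ fun a b => ?_
      simp only [LinearMap.comp_apply, LieAlgebra.ad_apply]
      rw [hWadj u hu, hsymm a, hWadj v hv, hsymm]
  have htr : ∀ u ∈ g, ∀ v ∈ g,
      LinearMap.trace ℝ H ((LieAlgebra.ad ℝ H u : Module.End ℝ H) ∘ₗ adStar v) =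
      LinearMap.trace ℝ H ((P ∘ₗ (LieAlgebra.ad ℝ H u : Module.End ℝ H)) ∘ₗ adgStar v) +
      LinearMap.trace ℝ H (W u ∘ₗ (Q ∘ₗ (LieAlgebra.ad ℝ H v : Module.End ℝ H))) :=
    fun u hu v hv => by
      have hdec : (LieAlgebra.ad ℝ H u : Module.End ℝ H) =
          P ∘ₗ (LieAlgebra.ad ℝ H u : Module.End ℝ H) +
          Q ∘ₗ (LieAlgebra.ad ℝ H u : Module.End ℝ H) := by
        ext w
        simp [hPQ]
      have h1 : LinearMap.trace ℝ H
          ((Q ∘ₗ (LieAlgebra.ad ℝ H u : Module.End ℝ H)) ∘ₗ adgStar v) = 0 := by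
        rw [LinearMap.trace_comp_comm']
        have : adgStar v ∘ₗ (Q ∘ₗ (LieAlgebra.ad ℝ H u : Module.End ℝ H)) = 0 := by
          ext w
          simp [hadgStar0 v hv _ (hQ _)]
        rw [this, map_zero]
      have h2 : LinearMap.trace ℝ H
          ((P ∘ₗ (LieAlgebra.ad ℝ H u : Module.End ℝ H)) ∘ₗ W v) = 0 := by
        rw [LinearMap.trace_comp_comm']
        have : W v ∘ₗ (P ∘ₗ (LieAlgebra.ad ℝ H u : Module.End ℝ H)) = 0 := by
          ext w
          simp [hWz v _ (hP _)]
        rw [this, map_zero]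
      conv_lhs => rw [hadS v hv, hdec]
      rw [LinearMap.comp_add, LinearMap.add_comp, LinearMap.add_comp, map_add, map_add, map_add,
        h1, h2, LinearMap.trace_comp_comm' (W v), hWsymm u hu v hv]
      ring
  constructor
  · intro h
    refine ⟨fun u hu v hv => ?_, fun u hu x hx => ?_, fun x hx y hy => ?_⟩
    · have := h u v
      rw [htr u hu v hv, hJmg u hu, hJmg v hv] at this
      linarith
    · have := h u x
      rw [hadS0 x hx, hJmg u hu, hJmz x hx, hgz u hu x hx, LinearMap.comp_zero, map_zero] at this
      linarith
    · have := h x y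
      rw [hadS0 y hy, hJmz x hx, hJmz y hy, LinearMap.comp_zero, map_zero] at this
      linarith
  · rintro ⟨h1, h2, h3⟩ u v
    have e1 := h1 _ (hP u) _ (hP v)
    have e2 := h2 _ (hP u) _ (hQ v)
    have e3 := h2 _ (hP v) _ (hQ u)
    have e4 := h3 _ (hQ u) _ (hQ v)
    have had : (LieAlgebra.ad ℝ H u : Module.End ℝ H) = LieAlgebra.ad ℝ H (P u) := by
      ext w
      simp [hPl]
    have hS : adStar v = adStar (P v) := by
      conv_lhs => rw [← hPQ v, hadS_add, hadS0 _ (hQ v), add_zero]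
    have hJ : ∀ w, Jm w = Jg (P w) + S (Q w) := fun w => by
      conv_lhs => rw [← hPQ w, hJm_add, hJmg _ (hP w), hJmz _ (hQ w)]
    have hB : B u v = B (P u) (P v) + B (Q u) (Q v) := by
      conv_lhs => rw [← hPQ u, ← hPQ v]
      simp [hgz _ (hP u) _ (hQ v), hzg _ (hP v) _ (hQ u)]
    rw [LinearMap.trace_comp_comm'] at e3
    rw [had, hS, htr _ (hP u) _ (hP v), hJ u, hJ v, hB, LinearMap.comp_add, LinearMap.add_comp,
      LinearMap.add_comp, map_add, map_add, map_add, e2, e3, e4]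
    linarith
end
end

section
/- Let (h,[·,·],⟨·,·⟩) be a λ-Einstein Lorentzian nilpotent Lie algebra with nondegenerate Euclidean center, with attributes (g,⟨·,·⟩_g,[·,·]_g), (Z(h),⟨·,·⟩_z) and ω. If λ ≠ 0, then the cohomology class of ω is nontrivial; that is, there is no linear map α : g → Z(h) such that ω(u,v) = −α([u,v]_g) for all u,v ∈ g. In particular, H²(g, Z(h)) ≠ {0}. -/
open Module LinearMap

noncomputable section

/-- In a nilpotent Lie algebra whose derived ideal meets the center trivially, all brackets
vanish. -/
theorem lie_eq_zero_of_nilpotent_of_derived_inf_center {R L : Type*} [CommRing R] [LieRing L]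
    [LieAlgebra R L] (hnilp : ∃ k, LieModule.lowerCentralSeries R L L k = ⊥)
    (h : ∀ x ∈ LieModule.lowerCentralSeries R L L 1, x ∈ LieAlgebra.center R L → x = 0)
    (u v : L) : ⁅u, v⁆ = 0 := by
  have key : ∀ k, LieModule.lowerCentralSeries R L L (k + 1) = ⊥ →
      LieModule.lowerCentralSeries R L L 1 = ⊥ := by
    intro k
    induction k with
    | zero => exact id
    | succ k ih =>
      intro hk
      refine ih ((LieSubmodule.eq_bot_iff _).2 fun x hx => ?_)
      refine h x (LieModule.antitone_lowerCentralSeries R L L (Nat.le_add_left 1 k) hx) ?_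
      rw [LieModule.mem_maxTrivSubmodule]
      intro y
      rw [← LieSubmodule.mem_bot (R := R) (L := L), ← hk, LieModule.lowerCentralSeries_succ]
      exact LieSubmodule.lie_mem_lie (LieSubmodule.mem_top y) hx
  obtain ⟨k, hk⟩ := hnilp
  have h1 := key k (le_bot_iff.1 (hk ▸
    LieModule.antitone_lowerCentralSeries R L L (Nat.le_succ k)))
  rw [← LieSubmodule.mem_bot (R := R) (L := L), ← h1, LieModule.lowerCentralSeries_succ]
  exact LieSubmodule.lie_mem_lie (LieSubmodule.mem_top u) (LieSubmodule.mem_top v)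

/-- Let `(h,[·,·],⟨·,·⟩)` be a `λ`-Einstein Lorentzian nilpotent Lie algebra
with nondegenerate Euclidean center, with attributes `(g, ⟨·,·⟩_g, [·,·]_g)`, `(Z(h), ⟨·,·⟩_z)`
and `ω`.  If `λ ≠ 0` then the cohomology class of `ω` is nontrivial: there is no linear map
`α : g → Z(h)` with `ω(u,v) = −α([u,v]_g)` for all `u,v ∈ g` (so `H²(g, Z(h)) ≠ 0`). -/
theorem statement6
    {H : Type*} [LieRing H] [LieAlgebra ℝ H] [Module.Finite ℝ H]
    (B : H →ₗ[ℝ] H →ₗ[ℝ] ℝ)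
    (hsymm : ∀ u v : H, B u v = B v u)
    (hnd : ∀ u : H, (∀ v : H, B u v = 0) → u = 0)
    (hLor : IsLorentzianForm B)
    (hnilp : ∃ k, LieModule.lowerCentralSeries ℝ H H k = ⊥)
    (hZnd : ∀ z ∈ LieAlgebra.center ℝ H,
      (∀ w ∈ LieAlgebra.center ℝ H, B z w = 0) → z = 0)
    (hZeucl : ∀ z ∈ LieAlgebra.center ℝ H, z ≠ 0 → 0 < B z z)
    -- `g` is the orthogonal complement of the center
    (g : Submodule ℝ H)
    (hg : ∀ u : H, u ∈ g ↔ ∀ z ∈ LieAlgebra.center ℝ H, B u z = 0)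
    -- `P`, `Q` are the projections onto `g` and `Z(h)` in `h = g ⊕ Z(h)`
    (P Q : H →ₗ[ℝ] H)
    (hP : ∀ u : H, P u ∈ g)
    (hQ : ∀ u : H, Q u ∈ LieAlgebra.center ℝ H)
    (hPQ : ∀ u : H, P u + Q u = u)
    -- `adStar u` is the adjoint of `ad u` in `h` with respect to `B`
    (adStar : H → Module.End ℝ H)
    (hadStar : ∀ u v w : H, B (adStar u v) w = B v ⁅u, w⁆)
    -- `Jm u` is the skew-symmetric endomorphism `J_u(v) = ad_v*(u)` of `h`
    (Jm : H → Module.End ℝ H)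
    (hJm : ∀ u v w : H, B (Jm u v) w = B u ⁅v, w⁆)
    (lam : ℝ)
    -- `h` is `λ`-Einstein
    (hEinstein : ∀ u v : H,
      -(1/2) * LinearMap.trace ℝ H ((LieAlgebra.ad ℝ H u : Module.End ℝ H) ∘ₗ adStar v)
        - (1/4) * LinearMap.trace ℝ H (Jm u ∘ₗ Jm v) = lam * B u v)
    (hlam : lam ≠ 0) :
    -- `ω` is not a coboundary: no linear `α : g → Z(h)` satisfies `ω(u,v) = −α([u,v]_g)`
    ¬ ∃ α : H →ₗ[ℝ] H, (∀ u : H, α u ∈ LieAlgebra.center ℝ H) ∧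
      ∀ u ∈ g, ∀ v ∈ g, Q ⁅u, v⁆ = - α (P ⁅u, v⁆) := by
  
  rintro ⟨α, -, hα⟩
  have central : ∀ z ∈ LieAlgebra.center ℝ H, ∀ x : H, ⁅x, z⁆ = 0 := fun z hz =>
    (LieModule.mem_maxTrivSubmodule ℝ H H z).1 hz
  have hbr : ∀ u v : H, ⁅u, v⁆ = ⁅P u, P v⁆ := by
    intro u v
    have hu : ⁅Q u, P v⁆ = 0 := by
      rw [← lie_skew, central _ (hQ u), neg_zero]
    conv_lhs => rw [← hPQ u, ← hPQ v]
    rw [lie_add, central _ (hQ v), add_lie, hu, add_zero, add_zero]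
  have hder : ∀ x ∈ LieModule.lowerCentralSeries ℝ H H 1, Q x = -α (P x) := by
    intro x hx
    rw [LieModule.lowerCentralSeries_succ, ← LieSubmodule.mem_toSubmodule,
      LieSubmodule.lieIdeal_oper_eq_linear_span'] at hx
    have hle : x ∈ LinearMap.ker (Q + α ∘ₗ P) := by
      refine Submodule.span_le.2 ?_ hx
      rintro _ ⟨u, -, v, -, rfl⟩
      simp [hbr u v, hα _ (hP u) _ (hP v)]
    exact eq_neg_of_add_eq_zero_left (by simpa using hle)
  have habel : ∀ u v : H, ⁅u, v⁆ = 0 := by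
    refine lie_eq_zero_of_nilpotent_of_derived_inf_center hnilp fun x hx hxZ => ?_
    have hPx : P x = 0 := by
      refine hZnd _ ?_ ((hg _).1 (hP x))
      rw [eq_sub_of_add_eq (hPQ x)]
      exact sub_mem hxZ (hQ x)
    rw [← hPQ x, hder x hx, hPx]
    simp
  obtain ⟨n, b, -, hb, -⟩ := hLor
  have hpos := hZeucl (b 0) ((LieModule.mem_maxTrivSubmodule ℝ H H _).2 fun x => habel x _)
    (b.ne_zero 0)
  linarith
end
end

section
/- Let (h,[·,·],⟨·,·⟩) be a λ-Einstein Lorentzian nilpotent Lie algebra with nondegenerate Euclidean center, with attributes (g,⟨·,·⟩_g,[·,·]_g), (Z(h),⟨·,·⟩_z) and ω. Then the derived ideal [g,g]_g is a nondegenerate Lorentzian subspace of g: the restriction of ⟨·,·⟩_g to [g,g]_g is nondegenerate of signature (1, dim [g,g]_g − 1). -/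
open Module LinearMap

noncomputable section

/-- The derived ideal `[g,g]_g` of `(g, [·,·]_g)`, where `[u,v]_g = P⁅u,v⁆`. -/
def derivedG {H : Type*} [LieRing H] [LieAlgebra ℝ H]
    (g : Submodule ℝ H) (P : H →ₗ[ℝ] H) : Submodule ℝ H :=
  Submodule.span ℝ {x : H | ∃ u ∈ g, ∃ v ∈ g, x = P ⁅u, v⁆}

theorem trace_eq_sum_of_expansion {H ι : Type*} [AddCommGroup H] [Module ℝ H] [Module.Finite ℝ H]
    [Fintype ι] {B : H →ₗ[ℝ] H →ₗ[ℝ] ℝ} {f f' : ι → H}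
    (hf : ∀ x, ∑ i, B x (f' i) • f i = x) (T : Module.End ℝ H) :
    LinearMap.trace ℝ H T = ∑ i, B (T (f i)) (f' i) := by
  have hT : T = ∑ i, (B.flip (f' i)).smulRight (T (f i)) := by
    ext x
    conv_lhs => rw [← hf x]
    simp
  conv_lhs => rw [hT]
  simp

theorem IsLorentzianForm.exists_coord {H : Type*} [AddCommGroup H] [Module ℝ H]
    {B : H →ₗ[ℝ] H →ₗ[ℝ] ℝ} (hB : IsLorentzianForm B) :
    ∃ φ : H →ₗ[ℝ] ℝ, ∀ y, φ y = 0 → B y y ≤ 0 → y = 0 := by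
  obtain ⟨n, b, hb, -, h1⟩ := hB
  refine ⟨b.coord 0, fun y hy0 hy => ?_⟩
  have key : B y y = ∑ i, b.repr y i * b.repr y i * B (b i) (b i) := by
    conv_lhs => rw [← b.sum_repr y]
    simp only [map_sum, LinearMap.sum_apply, map_smul, LinearMap.smul_apply, smul_eq_mul]
    refine Finset.sum_congr rfl fun i _ => ?_
    rw [Finset.sum_eq_single i]
    · ring
    · intro j _ hj
      rw [hb j i hj]; simp
    · simp
  have hnn : ∀ i ∈ Finset.univ, 0 ≤ b.repr y i * b.repr y i * B (b i) (b i) := by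
    intro i _
    by_cases hi : i = 0
    · subst hi
      have : b.repr y 0 = 0 := hy0
      simp [this]
    · rw [h1 i hi]; nlinarith [mul_self_nonneg (b.repr y i)]
  have h0 := (Finset.sum_eq_zero_iff_of_nonneg hnn).1
    (le_antisymm (key ▸ hy) (Finset.sum_nonneg hnn))
  refine b.ext_elem fun i => ?_
  by_cases hi : i = 0
  · subst hi; simpa using hy0
  · simpa [h1 i hi] using h0 i (Finset.mem_univ i)

/-- In a Lorentzian space, orthogonal causal vectors are proportional. -/
theorem IsLorentzianForm.exists_eq_smul {H : Type*} [AddCommGroup H] [Module ℝ H]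
    {B : H →ₗ[ℝ] H →ₗ[ℝ] ℝ} (hB : IsLorentzianForm B) (hsymm : ∀ u v, B u v = B v u)
    {u x : H} (hu : u ≠ 0) (huu : B u u ≤ 0) (hxu : B x u = 0) (hxx : B x x ≤ 0) :
    ∃ c : ℝ, x = c • u := by
  obtain ⟨φ, hφ⟩ := hB.exists_coord
  have hφu : φ u ≠ 0 := fun h => hu (hφ u h huu)
  refine ⟨φ x / φ u, sub_eq_zero.1 (hφ _ (by simp [hφu]) ?_)⟩
  simp only [map_sub, map_smul, LinearMap.sub_apply, LinearMap.smul_apply, smul_eq_mul,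
    hsymm u x, hxu]
  nlinarith [mul_self_nonneg (φ x / φ u)]

theorem IsLorentzianForm.pos_of_orthogonal {H : Type*} [AddCommGroup H] [Module ℝ H]
    {B : H →ₗ[ℝ] H →ₗ[ℝ] ℝ} (hB : IsLorentzianForm B) (hsymm : ∀ u v, B u v = B v u)
    {u x : H} (huu : B u u < 0) (hxu : B x u = 0) (hx : x ≠ 0) : 0 < B x x := by
  by_contra! h
  have hu : u ≠ 0 := by rintro rfl; simp at huu
  obtain ⟨c, rfl⟩ := hB.exists_eq_smul hsymm hu huu.le hxu h
  simp only [map_smul, LinearMap.smul_apply, smul_eq_mul, mul_eq_zero, huu.ne, or_false] at hxu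
  simp [hxu] at hx

theorem IsLorentzianForm.nonneg_of_orthogonal {H : Type*} [AddCommGroup H] [Module ℝ H]
    {B : H →ₗ[ℝ] H →ₗ[ℝ] ℝ} (hB : IsLorentzianForm B) (hsymm : ∀ u v, B u v = B v u)
    {u x : H} (hu : u ≠ 0) (huu : B u u ≤ 0) (hxu : B x u = 0) : 0 ≤ B x x := by
  by_contra! h
  obtain ⟨c, rfl⟩ := hB.exists_eq_smul hsymm hu huu hxu h.le
  simp only [map_smul, LinearMap.smul_apply, smul_eq_mul, mul_eq_zero] at hxu h
  rcases hxu with h0 | h0 <;> simp [h0] at h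

theorem exists_orthonormal_of_posDef {H : Type*} [AddCommGroup H] [Module ℝ H]
    [Module.Finite ℝ H] {B : H →ₗ[ℝ] H →ₗ[ℝ] ℝ} (hsymm : ∀ u v, B u v = B v u)
    (W : Submodule ℝ H) (hW : ∀ x ∈ W, x ≠ 0 → 0 < B x x) :
    ∃ (m : ℕ) (w : Fin m → H), (∀ i, w i ∈ W) ∧
      (∀ i j, B (w i) (w j) = if i = j then 1 else 0) ∧
      ∀ x ∈ W, ∑ i, B x (w i) • w i = x := by
  let BW : LinearMap.BilinForm ℝ W := LinearMap.BilinForm.restrict B W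
  have hBW : LinearMap.IsSymm BW := ⟨fun x y => hsymm (x : H) y⟩
  obtain ⟨v, hv⟩ := LinearMap.BilinForm.exists_orthogonal_basis hBW
  have hpos : ∀ i, 0 < B (v i : H) (v i) := fun i =>
    hW _ (v i).2 (by simpa using v.ne_zero i)
  have hort : ∀ i j, i ≠ j → B (v i : H) (v j) = 0 := fun i j hij => hv hij
  have hs : ∀ i, (√(B (v i : H) (v i)))⁻¹ * (√(B (v i : H) (v i)))⁻¹ * B (v i : H) (v i) = 1 := by
    intro i
    have := Real.mul_self_sqrt (hpos i).le
    have h0 := (Real.sqrt_pos.2 (hpos i)).ne'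
    field_simp
    nlinarith
  refine ⟨_, fun i => (√(B (v i : H) (v i)))⁻¹ • (v i : H),
    fun i => W.smul_mem _ (v i).2, fun i j => ?_, fun x hx => ?_⟩
  · split_ifs with hij
    · subst hij
      simpa [mul_assoc] using hs i
    · simp [hort i j hij]
  · have hx' : (∑ j, v.repr ⟨x, hx⟩ j • (v j : H)) = x := by
      have := congrArg W.subtype (v.sum_repr ⟨x, hx⟩)
      rwa [map_sum] at this
    conv_rhs => rw [← hx']
    refine Finset.sum_congr rfl fun i _ => ?_
    have : B x (v i) = v.repr ⟨x, hx⟩ i * B (v i : H) (v i) := by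
      conv_lhs => rw [← hx']
      simp only [map_sum, LinearMap.sum_apply, map_smul, LinearMap.smul_apply, smul_eq_mul]
      rw [Finset.sum_eq_single i]
      · intro j _ hj
        rw [hort j i hj]; simp
      · simp
    simp only [map_smul, smul_eq_mul, this, smul_smul]
    congr 1
    linear_combination v.repr ⟨x, hx⟩ i * hs i

theorem eq_top_of_orthogonal_eq_zero {H : Type*} [AddCommGroup H] [Module ℝ H]
    [Module.Finite ℝ H] {B : H →ₗ[ℝ] H →ₗ[ℝ] ℝ} (hnd : ∀ u, (∀ v, B u v = 0) → u = 0)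
    (K : Submodule ℝ H) (hK : ∀ x, (∀ y ∈ K, B x y = 0) → x = 0) : K = ⊤ := by
  by_contra h
  obtain ⟨φ, hφ, hle⟩ := K.exists_le_ker_of_lt_top (lt_top_iff_ne_top.2 h)
  have hinj : Function.Injective B := by
    rw [injective_iff_map_eq_zero]
    intro u hu
    exact hnd u fun v => by simp [hu]
  obtain ⟨x, rfl⟩ := (LinearMap.injective_iff_surjective_of_finrank_eq_finrank
    (Subspace.dual_finrank_eq (K := ℝ) (V := H)).symm).1 hinj φ
  exact hφ (by rw [hK x fun y hy => hle hy, map_zero])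

theorem eq_zero_of_lie_eq_smul {H : Type*} [LieRing H] [LieAlgebra ℝ H]
    (hnilp : ∃ k, LieModule.lowerCentralSeries ℝ H H k = ⊥) {x y : H} {c : ℝ}
    (h : ⁅y, x⁆ = c • x) : ⁅y, x⁆ = 0 := by
  by_cases hc : c = 0
  · simp [h, hc]
  have key : ∀ k, x ∈ LieModule.lowerCentralSeries ℝ H H k := by
    intro k
    induction k with
    | zero => simp
    | succ k ih =>
      have h1 : ⁅y, x⁆ ∈ LieModule.lowerCentralSeries ℝ H H (k + 1) := by
        rw [LieModule.lowerCentralSeries_succ]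
        exact LieSubmodule.lie_mem_lie (LieSubmodule.mem_top y) ih
      have : x = c⁻¹ • ⁅y, x⁆ := by rw [h, smul_smul, inv_mul_cancel₀ hc, one_smul]
      rw [this]
      exact (LieModule.lowerCentralSeries ℝ H H (k + 1)).smul_mem _ h1
  obtain ⟨k, hk⟩ := hnilp
  have := key k
  rw [hk, LieSubmodule.mem_bot] at this
  simp [this]

/-- The span of all brackets `⁅a, b⁆`. -/
def bracketSpan (H : Type*) [LieRing H] [LieAlgebra ℝ H] : Submodule ℝ H :=
  Submodule.span ℝ {x | ∃ a b : H, x = ⁅a, b⁆}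

theorem lie_mem_bracketSpan {H : Type*} [LieRing H] [LieAlgebra ℝ H] (a b : H) :
    ⁅a, b⁆ ∈ bracketSpan H :=
  Submodule.subset_span ⟨a, b, rfl⟩

/-- A nilpotent Lie algebra with one generator modulo brackets is abelian. -/
theorem lie_eq_zero_of_span_sup_eq_top {H : Type*} [LieRing H] [LieAlgebra ℝ H]
    (hnilp : ∃ k, LieModule.lowerCentralSeries ℝ H H k = ⊥) (e : H)
    (he : Submodule.span ℝ {e} ⊔ bracketSpan H = ⊤) (a b : H) : ⁅a, b⁆ = 0 := by
  have key : ∀ k, bracketSpan H ≤ (LieModule.lowerCentralSeries ℝ H H k).toSubmodule := by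
    intro k
    induction k with
    | zero => simp
    | succ k ih =>
      have hC : ∀ x ∈ bracketSpan H, ∀ y : H,
          ⁅y, x⁆ ∈ LieModule.lowerCentralSeries ℝ H H (k + 1) := by
        intro x hx y
        rw [LieModule.lowerCentralSeries_succ]
        exact LieSubmodule.lie_mem_lie (LieSubmodule.mem_top y) (ih hx)
      refine Submodule.span_le.2 ?_
      rintro _ ⟨a, b, rfl⟩
      obtain ⟨_, hs, x, hx, rfl⟩ := Submodule.mem_sup.1 (he ▸ Submodule.mem_top (x := a))
      obtain ⟨_, ht, y, hy, rfl⟩ := Submodule.mem_sup.1 (he ▸ Submodule.mem_top (x := b))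
      obtain ⟨s, rfl⟩ := Submodule.mem_span_singleton.1 hs
      obtain ⟨t, rfl⟩ := Submodule.mem_span_singleton.1 ht
      have : ⁅s • e + x, t • e + y⁆ = ⁅s • e + x, y⁆ - ⁅t • e, x⁆ := by
        rw [lie_add, add_lie _ _ (t • e), ← lie_skew x]
        simp; abel
      rw [this]
      exact sub_mem (hC y hy _) (hC x hx _)
  obtain ⟨k, hk⟩ := hnilp
  have := key k (lie_mem_bracketSpan a b)
  rw [hk] at this
  simpa using this

/-- If a nilpotent Lie algebra is spanned modulo brackets by elements that commute with all
brackets, then all brackets are central. -/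
theorem lie_bracketSpan_eq_zero {H : Type*} [LieRing H] [LieAlgebra ℝ H]
    (hnilp : ∃ k, LieModule.lowerCentralSeries ℝ H H k = ⊥) (V : Submodule ℝ H)
    (hV : V ⊔ bracketSpan H = ⊤) (hcomm : ∀ v ∈ V, ∀ x ∈ bracketSpan H, ⁅v, x⁆ = 0)
    (y x : H) (hx : x ∈ bracketSpan H) : ⁅y, x⁆ = 0 := by
  have key : ∀ k, ∀ x ∈ bracketSpan H, ∀ y : H,
      ⁅y, x⁆ ∈ LieModule.lowerCentralSeries ℝ H H k := by
    intro k
    induction k with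
    | zero => simp
    | succ k ih =>
      intro x hx y
      obtain ⟨v, hv, y, hy, rfl⟩ := Submodule.mem_sup.1 (hV ▸ Submodule.mem_top (x := y))
      rw [add_lie, hcomm v hv x hx, zero_add]
      have hC : ∀ a b : H, ⁅a, ⁅b, x⁆⁆ ∈ LieModule.lowerCentralSeries ℝ H H (k + 1) := by
        intro a b
        rw [LieModule.lowerCentralSeries_succ]
        exact LieSubmodule.lie_mem_lie (LieSubmodule.mem_top a) (ih x hx b)
      induction hy using Submodule.span_induction with
      | mem y hy =>
        obtain ⟨a, b, rfl⟩ := hy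
        rw [lie_lie]
        exact sub_mem (hC a b) (hC b a)
      | zero => simp
      | add y z _ _ h1 h2 => rw [add_lie]; exact add_mem h1 h2
      | smul c y _ h => rw [smul_lie]; exact (LieModule.lowerCentralSeries ℝ H H (k + 1)).smul_mem c h
  obtain ⟨k, hk⟩ := hnilp
  have := key k x hx y
  rwa [hk, LieSubmodule.mem_bot] at this

/-- A frame `e` with dual frame `e'`, whose orthogonal complement is positive definite, extends
by an orthonormal family to a frame of the whole space. -/
theorem exists_frame {H ι : Type*} [AddCommGroup H] [Module ℝ H] [Module.Finite ℝ H]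
    [Fintype ι] [DecidableEq ι] {B : H →ₗ[ℝ] H →ₗ[ℝ] ℝ} (hsymm : ∀ u v, B u v = B v u)
    (e e' : ι → H) (hdual : ∀ i j, B (e i) (e' j) = if i = j then 1 else 0)
    (hperp : ∀ x, (∀ j, B x (e' j) = 0) → ∀ j, B x (e j) = 0)
    (hpos : ∀ x, (∀ j, B x (e' j) = 0) → x ≠ 0 → 0 < B x x) :
    ∃ (m : ℕ) (w : Fin m → H), (∀ i j, B (w i) (e' j) = 0) ∧
      ∀ x, ∑ i, B x (Sum.elim e' w i) • Sum.elim e w i = x := by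
  obtain ⟨m, w, hwW, -, hw⟩ := exists_orthonormal_of_posDef hsymm
    (⨅ j, LinearMap.ker (B.flip (e' j)))
    (fun x hx => hpos x (by simpa using hx))
  have hw' : ∀ i j, B (w i) (e' j) = 0 := fun i j => by
    have := hwW i
    simp only [Submodule.mem_iInf, LinearMap.mem_ker, LinearMap.flip_apply] at this
    exact this j
  refine ⟨m, w, hw', fun x => ?_⟩
  have h1 := hw (x - ∑ i, B x (e' i) • e i) (by
    simp [Submodule.mem_iInf, hdual])
  have h2 : ∀ i, B (x - ∑ j, B x (e' j) • e j) (w i) = B x (w i) := fun i => by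
    simp [hsymm (e _) (w i), hperp (w i) (hw' i)]
  simp only [h2] at h1
  simp [h1]

/-- `B` is a `lam`-Einstein Lorentzian metric with Euclidean center on the nilpotent Lie algebra
`H`, where `adStar` is the adjoint of `ad` and `Jm u v = adStar v u`. -/
structure IsEinsteinLorentzian {H : Type*} [LieRing H] [LieAlgebra ℝ H]
    (B : H →ₗ[ℝ] H →ₗ[ℝ] ℝ) (adStar Jm : H → Module.End ℝ H) (lam : ℝ) : Prop where
  symm : ∀ u v, B u v = B v u
  nondeg : ∀ u, (∀ v, B u v = 0) → u = 0
  lorentzian : IsLorentzianForm B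
  nilpotent : ∃ k, LieModule.lowerCentralSeries ℝ H H k = ⊥
  center_pos : ∀ z ∈ LieAlgebra.center ℝ H, z ≠ 0 → 0 < B z z
  adStar_apply : ∀ u v w, B (adStar u v) w = B v ⁅u, w⁆
  J_apply : ∀ u v w, B (Jm u v) w = B u ⁅v, w⁆
  einstein : ∀ u v,
    -(1/2) * LinearMap.trace ℝ H ((LieAlgebra.ad ℝ H u : Module.End ℝ H) ∘ₗ adStar v)
      - (1/4) * LinearMap.trace ℝ H (Jm u ∘ₗ Jm v) = lam * B u v

namespace IsEinsteinLorentzian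

variable {H : Type*} [LieRing H] [LieAlgebra ℝ H]
  {B : H →ₗ[ℝ] H →ₗ[ℝ] ℝ} {adStar Jm : H → Module.End ℝ H} {lam : ℝ}

theorem eq_of_apply_eq (h : IsEinsteinLorentzian B adStar Jm lam) {x y : H}
    (hxy : ∀ v, B x v = B y v) : x = y :=
  sub_eq_zero.1 (h.nondeg _ fun v => by simp [hxy])

theorem trace_J_comp_J (h : IsEinsteinLorentzian B adStar Jm lam) {z : H}
    (hz : ∀ y : H, ⁅z, y⁆ = 0) :
    LinearMap.trace ℝ H (Jm z ∘ₗ Jm z) = -4 * lam * B z z := by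
  have hE := h.einstein z z
  have had : (LieAlgebra.ad ℝ H z : Module.End ℝ H) = 0 := LinearMap.ext fun v => by simp [hz]
  rw [had, LinearMap.zero_comp, map_zero] at hE
  linarith

theorem apply_eq_zero_of_mem_bracketSpan {u : H} (hu : ∀ a b : H, B u ⁅a, b⁆ = 0) {x : H}
    (hx : x ∈ bracketSpan H) : B u x = 0 := by
  have : bracketSpan H ≤ LinearMap.ker (B u) :=
    Submodule.span_le.2 (by rintro _ ⟨a, b, rfl⟩; exact hu a b)
  exact this hx

theorem exists_lie_ne_zero (h : IsEinsteinLorentzian B adStar Jm lam) {u : H} (hu : u ≠ 0)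
    (huu : B u u ≤ 0) : ∃ y : H, ⁅u, y⁆ ≠ 0 := by
  by_contra! hc
  refine huu.not_gt (h.center_pos u ?_ hu)
  rw [LieModule.mem_maxTrivSubmodule]
  intro x
  rw [← lie_skew, hc, neg_zero]

variable [Module.Finite ℝ H]

theorem sum_lie_lie (h : IsEinsteinLorentzian B adStar Jm lam) {ι : Type*} [Fintype ι]
    {f f' : ι → H} (hf : ∀ x, ∑ i, B x (f' i) • f i = x) {u : H}
    (hu : ∀ a b : H, B u ⁅a, b⁆ = 0) (y : H) :
    ∑ i, B ⁅u, f i⁆ ⁅y, f' i⁆ = -2 * lam * B u y := by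
  have hJ : Jm u = 0 := LinearMap.ext fun v =>
    h.nondeg _ fun w => by rw [h.J_apply, hu]
  have hE := h.einstein u y
  have htr := LinearMap.trace_mul_comm ℝ (LieAlgebra.ad ℝ H u : Module.End ℝ H) (adStar y)
  rw [Module.End.mul_eq_comp, Module.End.mul_eq_comp,
    trace_eq_sum_of_expansion hf (adStar y ∘ₗ _)] at htr
  simp only [LinearMap.comp_apply, LieAlgebra.ad_apply, h.adStar_apply] at htr
  rw [hJ, LinearMap.zero_comp, map_zero, htr] at hE
  linarith

theorem sup_eq_top (h : IsEinsteinLorentzian B adStar Jm lam)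
    (V : Submodule ℝ H)
    (hV : ∀ x, (∀ y ∈ V, B x y = 0) → (∀ a b : H, B x ⁅a, b⁆ = 0) → x = 0) :
    V ⊔ bracketSpan H = ⊤ :=
  eq_top_of_orthogonal_eq_zero h.nondeg _ fun x hx =>
    hV x (fun y hy => hx y (Submodule.mem_sup_left hy))
      fun a b => hx _ (Submodule.mem_sup_right (lie_mem_bracketSpan a b))

theorem timelike_pair (h : IsEinsteinLorentzian B adStar Jm lam) {u v : H}
    (huu : B u u = -1) (hvv : B v v = 1) (huv : B u v = 0)
    (hu : ∀ a b : H, B u ⁅a, b⁆ = 0) (hv : ∀ a b : H, B v ⁅a, b⁆ = 0) :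
    B ⁅u, v⁆ ⁅u, v⁆ = 2 * lam ∧
      (∀ x, B x u = 0 → B x v = 0 → ⁅u, x⁆ = 0 ∧ ⁅v, x⁆ = 0) ∧
      ∃ (m : ℕ) (w : Fin m → H), (∀ i, B (w i) u = 0 ∧ B (w i) v = 0) ∧
        ∀ x, ∑ i, B x (Sum.elim ![-u, v] w i) • Sum.elim ![u, v] w i = x := by
  have hvu : B v u = 0 := by rw [h.symm, huv]
  have hneg : B u u < 0 := by rw [huu]; norm_num
  obtain ⟨m, w, hw, hf⟩ := exists_frame h.symm ![u, v] ![-u, v]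
    (by simp [Fin.forall_fin_two, huu, hvv, huv, hvu])
    (by simp [Fin.forall_fin_two])
    (fun x hx => h.lorentzian.pos_of_orthogonal h.symm hneg
      (by simpa using hx 0))
  have hw' : ∀ i, B (w i) u = 0 ∧ B (w i) v = 0 := fun i =>
    ⟨by simpa using hw i 0, by simpa using hw i 1⟩
  have h1 := h.sum_lie_lie hf hu u
  have h2 := h.sum_lie_lie hf hv v
  have hsk : B ⁅v, u⁆ ⁅u, v⁆ = -B ⁅u, v⁆ ⁅u, v⁆ := by
    rw [← lie_skew v u, map_neg, LinearMap.neg_apply]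
  simp [Fintype.sum_sum_type, Fin.sum_univ_two, huu, hvv, hsk] at h1 h2
  have horth : ∀ a b : H, B ⁅a, b⁆ u = 0 := fun a b => by rw [h.symm, hu]
  have hu0 : u ≠ 0 := by rintro rfl; simp at huu
  have hnn : ∀ a b : H, 0 ≤ B ⁅a, b⁆ ⁅a, b⁆ := fun a b =>
    h.lorentzian.nonneg_of_orthogonal h.symm hu0 hneg.le (horth a b)
  have hz : ∀ a b : H, B ⁅a, b⁆ ⁅a, b⁆ ≤ 0 → ⁅a, b⁆ = 0 := fun a b hab => by
    by_contra hne
    exact hab.not_gt (h.lorentzian.pos_of_orthogonal h.symm hneg (horth a b) hne)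
  have s1 : 0 ≤ ∑ i, B ⁅u, w i⁆ ⁅u, w i⁆ := Finset.sum_nonneg fun i _ => hnn _ _
  have s2 : 0 ≤ ∑ i, B ⁅v, w i⁆ ⁅v, w i⁆ := Finset.sum_nonneg fun i _ => hnn _ _
  have t1 := (Finset.sum_eq_zero_iff_of_nonneg fun i _ => hnn u (w i)).1
    (show ∑ i, B ⁅u, w i⁆ ⁅u, w i⁆ = 0 by linarith)
  have t2 := (Finset.sum_eq_zero_iff_of_nonneg fun i _ => hnn v (w i)).1
    (show ∑ i, B ⁅v, w i⁆ ⁅v, w i⁆ = 0 by linarith)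
  have r1 : ∀ i, ⁅u, w i⁆ = 0 := fun i => hz _ _ (t1 i (Finset.mem_univ i)).le
  have r2 : ∀ i, ⁅v, w i⁆ = 0 := fun i => hz _ _ (t2 i (Finset.mem_univ i)).le
  refine ⟨by linarith, fun x hxu hxv => ?_, m, w, hw', hf⟩
  rw [← hf x]
  simp [Fintype.sum_sum_type, Fin.sum_univ_two, hxu, hxv, lie_sum, r1, r2]

theorem not_timelike (h : IsEinsteinLorentzian B adStar Jm lam) {u : H}
    (hu : ∀ a b : H, B u ⁅a, b⁆ = 0) (huu : B u u = -1) : False := by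
  have hu0 : u ≠ 0 := by rintro rfl; simp at huu
  have hneg : B u u < 0 := by rw [huu]; norm_num
  obtain ⟨y, hy⟩ := h.exists_lie_ne_zero hu0 hneg.le
  have normalize : ∀ x : H, x ≠ 0 → B x u = 0 → (∀ a b : H, B x ⁅a, b⁆ = 0) →
      ∃ c : ℝ, B (c • x) (c • x) = 1 ∧ B u (c • x) = 0 ∧ ∀ a b : H, B (c • x) ⁅a, b⁆ = 0 := by
    intro x hx hxu hxl
    have hpos := h.lorentzian.pos_of_orthogonal h.symm hneg hxu hx
    refine ⟨(√(B x x))⁻¹, ?_, by simp [h.symm u x, hxu], by simp [hxl]⟩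
    have h1 := Real.mul_self_sqrt hpos.le
    have h2 := (Real.sqrt_pos.2 hpos).ne'
    simp only [map_smul, LinearMap.smul_apply, smul_eq_mul]
    field_simp
    nlinarith
  obtain ⟨v, hvv, huv, hv⟩ : ∃ v, B v v = 1 ∧ B u v = 0 ∧ ∀ a b : H, B v ⁅a, b⁆ = 0 := by
    by_contra! hc
    refine hy (lie_eq_zero_of_span_sup_eq_top h.nilpotent u (h.sup_eq_top _ fun x hx hxl => ?_) _ _)
    by_contra hx0
    obtain ⟨c, h1, h2, h3⟩ := normalize x hx0 (hx u (Submodule.mem_span_singleton_self u)) hxl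
    obtain ⟨a, b, hab⟩ := hc _ h1 h2
    exact hab (h3 a b)
  have hvu : B v u = 0 := by rw [h.symm, huv]
  obtain ⟨hzz, hcomm, m, w, hw, hf⟩ := h.timelike_pair huu hvv huv hu hv
  have expand : ∀ y, ⁅u, y⁆ = B y v • ⁅u, v⁆ ∧ ⁅v, y⁆ = B y u • ⁅u, v⁆ := by
    intro y
    obtain ⟨h1, h2⟩ := hcomm (y + B y u • u - B y v • v)
      (by simp [huu, hvu]) (by simp [huv, hvv])
    simp only [lie_sub, lie_add, lie_smul, lie_self, smul_zero, add_zero, sub_zero] at h1 h2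
    rw [← lie_skew v u, smul_neg, ← sub_eq_add_neg] at h2
    exact ⟨sub_eq_zero.1 h1, sub_eq_zero.1 h2⟩
  have hz0 : ⁅u, v⁆ ≠ 0 := fun h0 => hy (by rw [(expand y).1, h0, smul_zero])
  have hlam : 0 < lam := by
    have := h.lorentzian.pos_of_orthogonal h.symm hneg (by rw [h.symm, hu]) hz0
    linarith
  have htop : Submodule.span ℝ {u, v} ⊔ bracketSpan H = ⊤ := by
    refine h.sup_eq_top _ fun x hx hxl => ?_
    have hxu := hx u (Submodule.subset_span (by simp))
    have hxv := hx v (Submodule.subset_span (by simp))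
    by_contra hx0
    obtain ⟨c, h1, h2, h3⟩ := normalize x hx0 hxu hxl
    have := (h.timelike_pair huu h1 h2 hu h3).1
    rw [lie_smul, (hcomm x hxu hxv).1] at this
    simp at this
    exact hlam.ne' this
  have hcommV : ∀ a ∈ Submodule.span ℝ {u, v}, ∀ x ∈ bracketSpan H, ⁅a, x⁆ = 0 := by
    intro a ha x hx
    obtain ⟨s, t, rfl⟩ := Submodule.mem_span_pair.1 ha
    obtain ⟨h1, h2⟩ := hcomm x
      (by rw [h.symm, apply_eq_zero_of_mem_bracketSpan hu hx])
      (by rw [h.symm, apply_eq_zero_of_mem_bracketSpan hv hx])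
    simp [h1, h2]
  have hcent : ∀ x ∈ bracketSpan H, ∀ y : H, ⁅x, y⁆ = 0 := fun x hx y => by
    rw [← lie_skew, lie_bracketSpan_eq_zero h.nilpotent _ htop hcommV y x hx, neg_zero]
  have htr := h.trace_J_comp_J (hcent _ (lie_mem_bracketSpan u v))
  have hJu : Jm ⁅u, v⁆ u = (2 * lam) • v := h.eq_of_apply_eq fun y => by
    rw [h.J_apply, (expand y).1]; simp [hzz, h.symm v y]; ring
  have hJv : Jm ⁅u, v⁆ v = (2 * lam) • u := h.eq_of_apply_eq fun y => by
    rw [h.J_apply, (expand y).2]; simp [hzz, h.symm u y]; ring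
  have hJw : ∀ i, Jm ⁅u, v⁆ (w i) = 0 := fun i => by
    obtain ⟨a, ha, x, hx, hax⟩ := Submodule.mem_sup.1 (htop ▸ Submodule.mem_top (x := w i))
    obtain ⟨s, t, rfl⟩ := Submodule.mem_span_pair.1 ha
    obtain ⟨h1, h2⟩ := hw i
    have hxu : B x u = 0 := by rw [h.symm, apply_eq_zero_of_mem_bracketSpan hu hx]
    have hxv : B x v = 0 := by rw [h.symm, apply_eq_zero_of_mem_bracketSpan hv hx]
    rw [← hax] at h1 h2 ⊢
    simp [huu, hvu, hxu] at h1
    simp [huv, hvv, hxv] at h2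
    refine h.nondeg _ fun y => ?_
    rw [h.J_apply]
    simp [h1, h2, hcent x hx]
  rw [trace_eq_sum_of_expansion hf] at htr
  simp [Fintype.sum_sum_type, Fin.sum_univ_two, hJu, hJv, hJw, huu, hvv, hzz] at htr
  nlinarith

theorem not_null (h : IsEinsteinLorentzian B adStar Jm lam) {u : H} (hu0 : u ≠ 0)
    (hu : ∀ a b : H, B u ⁅a, b⁆ = 0) (huu : B u u = 0)
    (hV : ∀ x, (∀ a b : H, B x ⁅a, b⁆ = 0) → 0 ≤ B x x) : False := by
  obtain ⟨y, hy⟩ := h.exists_lie_ne_zero hu0 huu.le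
  obtain ⟨e, hue, hee⟩ : ∃ e, B u e = 1 ∧ B e e = 0 := by
    obtain ⟨a, ha⟩ : ∃ a, B u a ≠ 0 := by
      by_contra! hc
      exact hu0 (h.nondeg u hc)
    have ha' : B a u ≠ 0 := by rwa [h.symm]
    refine ⟨(B u a)⁻¹ • (a - (B a a / (2 * B u a)) • u), by simp [huu, ha], ?_⟩
    simp [huu, h.symm a u]
    right
    field_simp
    ring
  have heu : B e u = 1 := by rw [h.symm, hue]
  have hpos : ∀ x, B x e = 0 → B x u = 0 → x ≠ 0 → 0 < B x x := by
    intro x hxe hxu hx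
    by_contra! hxx
    obtain ⟨c, rfl⟩ := h.lorentzian.exists_eq_smul h.symm hu0 huu.le hxu hxx
    simp [hue] at hxe
    simp [hxe] at hx
  obtain ⟨m, w, hw, hf⟩ := exists_frame h.symm ![u, e] ![e, u]
    (by simp [Fin.forall_fin_two, huu, hee, hue, heu])
    (by simp [Fin.forall_fin_two]; tauto)
    (fun x hx => hpos x (by simpa using hx 0) (by simpa using hx 1))
  have hw' : ∀ i, B (w i) e = 0 ∧ B (w i) u = 0 := fun i =>
    ⟨by simpa using hw i 0, by simpa using hw i 1⟩
  have horth : ∀ a b : H, B ⁅a, b⁆ u = 0 := fun a b => by rw [h.symm, hu]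
  have hnn : ∀ a b : H, 0 ≤ B ⁅a, b⁆ ⁅a, b⁆ := fun a b =>
    h.lorentzian.nonneg_of_orthogonal h.symm hu0 huu.le (horth a b)
  have hzero : ∀ a, B ⁅u, a⁆ ⁅u, a⁆ ≤ 0 → ⁅u, a⁆ = 0 := fun a ha => by
    obtain ⟨c, hc⟩ := h.lorentzian.exists_eq_smul h.symm hu0 huu.le (horth u a) ha
    have : ⁅a, u⁆ = (-c) • u := by rw [← lie_skew, hc, neg_smul]
    rw [← lie_skew, eq_zero_of_lie_eq_smul h.nilpotent this, neg_zero]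
  have h1 := h.sum_lie_lie hf hu u
  simp [Fintype.sum_sum_type, Fin.sum_univ_two, huu] at h1
  have t1 := (Finset.sum_eq_zero_iff_of_nonneg fun i _ => hnn u (w i)).1 h1
  have r1 : ∀ i, ⁅u, w i⁆ = 0 := fun i => hzero _ (t1 i (Finset.mem_univ i)).le
  have expand : ∀ y, ⁅u, y⁆ = B y u • ⁅u, e⁆ := fun y => by
    conv_lhs => rw [← hf y]
    simp [Fintype.sum_sum_type, Fin.sum_univ_two, lie_sum, r1]
  have h2 := h.sum_lie_lie hf hu e
  have hsk : B ⁅u, e⁆ ⁅e, u⁆ = -B ⁅u, e⁆ ⁅u, e⁆ := by rw [← lie_skew e u, map_neg]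
  simp [Fintype.sum_sum_type, Fin.sum_univ_two, hue, r1, hsk] at h2
  have hlam : 0 < lam := by
    by_contra! hl
    exact hy (by rw [expand, hzero e (by linarith), smul_zero])
  have hVu : ∀ x, (∀ a b : H, B x ⁅a, b⁆ = 0) → ∃ c : ℝ, x = c • u := by
    intro x hx
    have hxu : B x u = 0 := by
      by_contra hne
      have := hV (x - ((B x x + 1) / (2 * B x u)) • u) (by simp [hx, hu])
      simp [huu, h.symm u x] at this
      field_simp at this
      linarith
    have hxl : ⁅x, u⁆ = 0 := by rw [← lie_skew, expand, hxu]; simp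
    have h3 := h.sum_lie_lie hf hx x
    simp [Fintype.sum_sum_type, Fin.sum_univ_two, hxl] at h3
    have : 0 ≤ ∑ i, B ⁅x, w i⁆ ⁅x, w i⁆ := Finset.sum_nonneg fun i _ => hnn _ _
    refine h.lorentzian.exists_eq_smul h.symm hu0 huu.le hxu ?_
    by_contra! hxx
    nlinarith [mul_pos hlam hxx]
  refine hy (lie_eq_zero_of_span_sup_eq_top h.nilpotent e (h.sup_eq_top _ fun x hx hxl => ?_) _ _)
  obtain ⟨c, rfl⟩ := hVu x hxl
  have := hx e (Submodule.mem_span_singleton_self e)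
  simp [hue] at this
  simp [this]

/-- The orthogonal complement of the derived ideal is positive definite. -/
theorem pos_of_orthogonal_derived (h : IsEinsteinLorentzian B adStar Jm lam) {u : H} (hu0 : u ≠ 0)
    (hu : ∀ a b : H, B u ⁅a, b⁆ = 0) : 0 < B u u := by
  have hV : ∀ x, (∀ a b : H, B x ⁅a, b⁆ = 0) → 0 ≤ B x x := by
    intro x hx
    by_contra! hxx
    have h1 := Real.mul_self_sqrt (neg_pos.2 hxx).le
    have h2 := (Real.sqrt_pos.2 (neg_pos.2 hxx)).ne'
    refine h.not_timelike (u := (√(-B x x))⁻¹ • x) (by simp [hx]) ?_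
    simp only [map_smul, LinearMap.smul_apply, smul_eq_mul]
    field_simp
    nlinarith
  exact (hV u hu).lt_of_ne fun h0 => h.not_null hu0 hu h0.symm hV

end IsEinsteinLorentzian

theorem exists_mem_apply_eq {H : Type*} [AddCommGroup H] [Module ℝ H] [Module.Finite ℝ H]
    {B : H →ₗ[ℝ] H →ₗ[ℝ] ℝ} (D : Submodule ℝ H)
    (hD : ∀ x ∈ D, (∀ y ∈ D, B x y = 0) → x = 0) (φ : H →ₗ[ℝ] ℝ) :
    ∃ d ∈ D, ∀ y ∈ D, B d y = φ y := by
  have hinj : Function.Injective (B.domRestrict₁₂ D D) := by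
    rw [injective_iff_map_eq_zero]
    intro x hx
    exact Subtype.ext (hD x x.2 fun y hy => LinearMap.congr_fun hx ⟨y, hy⟩)
  obtain ⟨d, hd⟩ := (LinearMap.injective_iff_surjective_of_finrank_eq_finrank
    (Subspace.dual_finrank_eq (K := ℝ) (V := D)).symm).1 hinj (φ.domRestrict D)
  exact ⟨d, d.2, fun y hy => LinearMap.congr_fun hd ⟨y, hy⟩⟩

/-- A subspace of a Lorentzian space that contains a timelike vector is Lorentzian. -/
theorem exists_lorentzian_basis {H : Type*} [AddCommGroup H] [Module ℝ H] [Module.Finite ℝ H]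
    {B : H →ₗ[ℝ] H →ₗ[ℝ] ℝ} (hsymm : ∀ u v, B u v = B v u) (hB : IsLorentzianForm B)
    (D : Submodule ℝ H) (hD : ∃ d ∈ D, B d d < 0) :
    ∃ (m : ℕ) (b : Basis (Fin (m + 1)) ℝ D),
      (∀ i j, i ≠ j → B (b i : H) (b j : H) = 0) ∧
      B (b 0 : H) (b 0 : H) = -1 ∧ ∀ i, i ≠ 0 → B (b i : H) (b i : H) = 1 := by
  obtain ⟨d, hd, hdd⟩ : ∃ d ∈ D, B d d = -1 := by
    obtain ⟨d, hd, hneg⟩ := hD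
    refine ⟨(√(-B d d))⁻¹ • d, D.smul_mem _ hd, ?_⟩
    have h1 := Real.mul_self_sqrt (neg_pos.2 hneg).le
    have h2 := (Real.sqrt_pos.2 (neg_pos.2 hneg)).ne'
    simp only [map_smul, LinearMap.smul_apply, smul_eq_mul]
    field_simp
    nlinarith
  have hneg : B d d < 0 := by rw [hdd]; norm_num
  obtain ⟨m, w, hwW, hww, hw⟩ := exists_orthonormal_of_posDef hsymm (D ⊓ LinearMap.ker (B d))
    (fun x hx => hB.pos_of_orthogonal hsymm hneg (by rw [hsymm]; exact hx.2))
  have hdw : ∀ i, B d (w i) = 0 := fun i => (hwW i).2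
  let f : Fin (m + 1) → D := Fin.cons ⟨d, hd⟩ fun i => ⟨w i, (hwW i).1⟩
  have hf : ∀ i j, i ≠ j → B (f i : H) (f j : H) = 0 := by
    intro i j hij
    cases i using Fin.cases <;> cases j using Fin.cases
    · exact absurd rfl hij
    · exact hdw _
    · exact (hsymm _ _).trans (hdw _)
    · simpa [f, hww] using hij
  have hf1 : ∀ i, i ≠ 0 → B (f i : H) (f i : H) = 1 := by
    intro i hi
    cases i using Fin.cases
    · exact absurd rfl hi
    · simp [f, hww]
  have hli : LinearIndependent ℝ f := by
    refine LinearMap.linearIndependent_of_isOrthoᵢ (B := B.domRestrict₁₂ D D)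
      (fun i j hij => hf i j hij) fun i => ?_
    change B (f i : H) (f i : H) ≠ 0
    by_cases hi : i = 0
    · subst hi; exact hneg.ne
    · rw [hf1 i hi]; exact one_ne_zero
  have hsp : ⊤ ≤ Submodule.span ℝ (Set.range f) := by
    rintro ⟨x, hx⟩ -
    have h1 := hw (x + B x d • d)
      ⟨D.add_mem hx (D.smul_mem _ hd), by simp [hdd, hsymm d x]⟩
    have h2 : (⟨x, hx⟩ : D) = ∑ i, B (x + B x d • d) (w i) • f i.succ - B x d • f 0 := by
      apply Subtype.ext
      have : ((∑ i, B (x + B x d • d) (w i) • f i.succ - B x d • f 0 : D) : H)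
          = ∑ i, B (x + B x d • d) (w i) • w i - B x d • d := by
        simp [f]
      rw [this, h1, add_sub_cancel_right]
    rw [h2]
    exact sub_mem (sum_mem fun i _ => Submodule.smul_mem _ _ (Submodule.subset_span ⟨_, rfl⟩))
      (Submodule.smul_mem _ _ (Submodule.subset_span ⟨_, rfl⟩))
  refine ⟨m, Basis.mk hli hsp, ?_⟩
  simp only [Basis.coe_mk]
  exact ⟨hf, hdd, hf1⟩

/-- Let `(h,[·,·],⟨·,·⟩)` be a `λ`-Einstein Lorentzian nilpotent Lie algebra
with nondegenerate Euclidean center, with attributes `(g, ⟨·,·⟩_g, [·,·]_g)`, `(Z(h), ⟨·,·⟩_z)`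
and `ω`.  Then the derived ideal `[g,g]_g` is a nondegenerate Lorentzian subspace of `g`:
the restriction of `⟨·,·⟩_g` to it is nondegenerate of signature `(1, dim[g,g]_g − 1)`. -/
theorem statement7
    {H : Type*} [LieRing H] [LieAlgebra ℝ H] [Module.Finite ℝ H]
    (B : H →ₗ[ℝ] H →ₗ[ℝ] ℝ)
    (hsymm : ∀ u v : H, B u v = B v u)
    (hnd : ∀ u : H, (∀ v : H, B u v = 0) → u = 0)
    (hLor : IsLorentzianForm B)
    (hnilp : ∃ k, LieModule.lowerCentralSeries ℝ H H k = ⊥)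
    (hZnd : ∀ z ∈ LieAlgebra.center ℝ H,
      (∀ w ∈ LieAlgebra.center ℝ H, B z w = 0) → z = 0)
    (hZeucl : ∀ z ∈ LieAlgebra.center ℝ H, z ≠ 0 → 0 < B z z)
    -- `g` is the orthogonal complement of the center
    (g : Submodule ℝ H)
    (hg : ∀ u : H, u ∈ g ↔ ∀ z ∈ LieAlgebra.center ℝ H, B u z = 0)
    -- `P`, `Q` are the projections onto `g` and `Z(h)` in `h = g ⊕ Z(h)`
    (P Q : H →ₗ[ℝ] H)
    (hP : ∀ u : H, P u ∈ g)
    (hQ : ∀ u : H, Q u ∈ LieAlgebra.center ℝ H)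
    (hPQ : ∀ u : H, P u + Q u = u)
    -- `adStar u` is the adjoint of `ad u` in `h` with respect to `B`
    (adStar : H → Module.End ℝ H)
    (hadStar : ∀ u v w : H, B (adStar u v) w = B v ⁅u, w⁆)
    -- `Jm u` is the skew-symmetric endomorphism `J_u(v) = ad_v*(u)` of `h`
    (Jm : H → Module.End ℝ H)
    (hJm : ∀ u v w : H, B (Jm u v) w = B u ⁅v, w⁆)
    (lam : ℝ)
    -- `h` is `λ`-Einstein
    (hEinstein : ∀ u v : H,
      -(1/2) * LinearMap.trace ℝ H ((LieAlgebra.ad ℝ H u : Module.End ℝ H) ∘ₗ adStar v)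
        - (1/4) * LinearMap.trace ℝ H (Jm u ∘ₗ Jm v) = lam * B u v) :
    -- `[g,g]_g` is nondegenerate ...
    (∀ x ∈ derivedG g P, (∀ y ∈ derivedG g P, B x y = 0) → x = 0) ∧
    -- ... and Lorentzian of signature `(1, dim[g,g]_g − 1)`
    (∃ (m : ℕ) (b : Basis (Fin (m + 1)) ℝ (derivedG g P)),
      (∀ i j, i ≠ j → B (b i : H) (b j : H) = 0) ∧
      B (b 0 : H) (b 0 : H) = -1 ∧ ∀ i, i ≠ 0 → B (b i : H) (b i : H) = 1) := by
  have h : IsEinsteinLorentzian B adStar Jm lam :=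
    ⟨hsymm, hnd, hLor, hnilp, hZeucl, hadStar, hJm, hEinstein⟩
  have hDg : derivedG g P ≤ g :=
    Submodule.span_le.2 (by rintro _ ⟨u, -, v, -, rfl⟩; exact hP _)
  have hlieP : ∀ a b : H, P ⁅a, b⁆ ∈ derivedG g P := by
    intro a b
    have hl : ∀ z ∈ LieAlgebra.center ℝ H, ∀ x : H, ⁅x, z⁆ = 0 := fun z hz x =>
      (LieModule.mem_maxTrivSubmodule ..).1 hz x
    have hab : ⁅a, b⁆ = ⁅P a, P b⁆ := by
      conv_lhs => rw [← hPQ a, ← hPQ b]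
      rw [lie_add, hl _ (hQ b), add_zero, add_lie, ← lie_skew (Q a), hl _ (hQ a), neg_zero,
        add_zero]
    rw [hab]
    exact Submodule.subset_span ⟨P a, hP a, P b, hP b, rfl⟩
  have hpos : ∀ x ∈ g, (∀ y ∈ derivedG g P, B x y = 0) → x ≠ 0 → 0 < B x x := by
    intro x hx hxD hx0
    refine h.pos_of_orthogonal_derived hx0 fun a b => ?_
    rw [← hPQ ⁅a, b⁆, map_add, hxD _ (hlieP a b), (hg x).1 hx _ (hQ _), add_zero]
  have hDnd : ∀ x ∈ derivedG g P, (∀ y ∈ derivedG g P, B x y = 0) → x = 0 := by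
    intro x hx hxD
    by_contra hx0
    exact (hpos x (hDg hx) hxD hx0).ne' (hxD x hx)
  refine ⟨hDnd, exists_lorentzian_basis hsymm hLor _ ?_⟩
  obtain ⟨n, b, -, hb0, -⟩ := hLor
  obtain ⟨d, hd, hdb⟩ := exists_mem_apply_eq _ hDnd (B (b 0))
  refine ⟨d, hd, ?_⟩
  have hy : ∀ y ∈ derivedG g P, B (b 0 - d) y = 0 := fun y hy => by simp [hdb y hy]
  have hPD : ∀ y ∈ derivedG g P, B (P (b 0 - d)) y = 0 := fun y hyD => by
    have h1 := hy y hyD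
    rw [← hPQ (b 0 - d), map_add, LinearMap.add_apply, hsymm (Q _),
      (hg y).1 (hDg hyD) _ (hQ _), add_zero] at h1
    exact h1
  have h1 : 0 ≤ B (P (b 0 - d)) (P (b 0 - d)) := by
    by_cases h0 : P (b 0 - d) = 0
    · simp [h0]
    · exact (hpos _ (hP _) hPD h0).le
  have h2 : 0 ≤ B (Q (b 0 - d)) (Q (b 0 - d)) := by
    by_cases h0 : Q (b 0 - d) = 0
    · simp [h0]
    · exact (hZeucl _ (hQ _) h0).le
  have h3 : B (b 0 - d) (b 0 - d)
      = B (P (b 0 - d)) (P (b 0 - d)) + B (Q (b 0 - d)) (Q (b 0 - d)) := by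
    have hPQ0 := (hg _).1 (hP (b 0 - d)) _ (hQ (b 0 - d))
    have hQP0 := hsymm (Q (b 0 - d)) (P (b 0 - d))
    conv_lhs => rw [← hPQ (b 0 - d)]
    simp only [map_add, LinearMap.add_apply]
    linarith
  have h4 := hdb d hd
  have h5 := hsymm d (b 0)
  simp only [map_sub (B _), map_sub B, LinearMap.sub_apply, hb0] at h3
  linarith
end
end

section
/- Let (h,[·,·],⟨·,·⟩) be a λ-Einstein Lorentzian nilpotent Lie algebra with nondegenerate Euclidean center, with attributes (g,⟨·,·⟩_g,[·,·]_g), (Z(h),⟨·,·⟩_z) and ω. If h is 3-step nilpotent and λ ≥ 0, then the center of (g,[·,·]_g) equals its derived ideal: Z(g) = [g,g]_g. -/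
open Module LinearMap

noncomputable section

section Lorentzian

variable {H : Type*} [AddCommGroup H] [Module ℝ H] {B : H →ₗ[ℝ] H →ₗ[ℝ] ℝ}

/-- A Lorentzian form is positive definite on the orthogonal complement of some vector. -/
lemma IsLorentzianForm.exists_pos (hL : IsLorentzianForm B) :
    ∃ t : H, B t t = -1 ∧ ∀ x, B x t = 0 → x ≠ 0 → 0 < B x x := by
  obtain ⟨n, b, hb, h0, h1⟩ := hL
  have coord : ∀ x i, B x (b i) = b.repr x i * B (b i) (b i) := by
    intro x i
    conv_lhs => rw [← b.sum_repr x]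
    simp only [map_sum, LinearMap.sum_apply, map_smul, LinearMap.smul_apply, smul_eq_mul]
    refine Finset.sum_eq_single i (fun j _ hj => ?_) (by simp)
    rw [hb j i hj, mul_zero]
  refine ⟨b 0, h0, fun x hx hx0 => ?_⟩
  have hr : b.repr x 0 = 0 := by
    have := coord x 0
    rw [hx, h0] at this
    linarith
  have hxx : B x x = ∑ i, b.repr x i ^ 2 := by
    conv_lhs => enter [2]; rw [← b.sum_repr x]
    simp only [map_sum, map_smul, smul_eq_mul]
    refine Finset.sum_congr rfl fun i _ => ?_
    rw [coord]
    by_cases hi : i = 0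
    · simp [hi, hr]
    · rw [h1 i hi]; ring
  rw [hxx]
  refine lt_of_le_of_ne (Finset.sum_nonneg fun i _ => sq_nonneg _) fun h => hx0 ?_
  rw [eq_comm, Finset.sum_eq_zero_iff_of_nonneg fun i _ => sq_nonneg _] at h
  refine b.ext_elem fun i => ?_
  simpa using h i (Finset.mem_univ i)

/-- A Lorentzian form is positive definite on the orthogonal complement of a timelike vector. -/
lemma IsLorentzianForm.pos_of_orthogonal_s8 (hL : IsLorentzianForm B)
    (hsymm : ∀ u v : H, B u v = B v u) {e x : H} (he : B e e < 0) (hxe : B x e = 0)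
    (hx : x ≠ 0) : 0 < B x x := by
  obtain ⟨t, -, ht⟩ := hL.exists_pos
  by_contra! hneg
  set y := B x t • e - B e t • x with hy
  have hyt : B y t = 0 := by simp [hy]; ring
  have hyy : B y y = B x t ^ 2 * B e e + B e t ^ 2 * B x x := by
    simp [hy, hxe, hsymm e x]; ring
  have hy0 : y = 0 := by
    by_contra h
    have := ht y hyt h
    nlinarith [sq_nonneg (B x t), sq_nonneg (B e t)]
  have hxt : B x t = 0 := by
    have : B y e = B x t * B e e := by simp [hy, hxe]
    rw [hy0] at this
    simp at this
    rcases this with h | h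
    · exact h
    · exact absurd h he.ne
  exact absurd (ht x hxt hx) (not_lt.mpr hneg)

/-- A basis is `ε`-orthonormal if its Gram matrix is `diagonal ε`, with entries `±1`. -/
structure IsSignedBasis {ι : Type*} [DecidableEq ι] (B : H →ₗ[ℝ] H →ₗ[ℝ] ℝ) (b : Basis ι ℝ H)
    (ε : ι → ℝ) : Prop where
  gram : ∀ i j, B (b i) (b j) = if i = j then ε i else 0
  sign : ∀ i, ε i * ε i = 1

/-- The signs of a basis whose only timelike vector has index `i₀`. -/
def timeSign {ι : Type*} [DecidableEq ι] (i₀ : ι) : ι → ℝ := fun i => if i = i₀ then -1 else 1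

lemma sum_timeSign {ι : Type*} [Fintype ι] [DecidableEq ι] (i₀ : ι) (f : ι → ℝ) :
    ∑ i, timeSign i₀ i * f i = ∑ i, f i - 2 * f i₀ := by
  have : ∀ i, timeSign i₀ i * f i = f i - if i = i₀ then 2 * f i else 0 := by
    intro i
    unfold timeSign
    split_ifs <;> ring
  simp [this, Finset.sum_sub_distrib]

/-- Orthonormal families containing a timelike vector extend to orthonormal bases. -/
lemma IsLorentzianForm.exists_signedBasis.{u} {H : Type u} [AddCommGroup H] [Module ℝ H]
    [Module.Finite ℝ H] {B : H →ₗ[ℝ] H →ₗ[ℝ] ℝ} (hL : IsLorentzianForm B)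
    (hsymm : ∀ u v : H, B u v = B v u) {e : H} {S : Set H} (he : B e e = -1)
    (heS : e ∈ S) (hS : ∀ x ∈ S, x ≠ e → B x x = 1) (hS' : ∀ x ∈ S, ∀ y ∈ S, x ≠ y → B x y = 0) :
    ∃ (ι : Type u) (_ : Fintype ι) (_ : DecidableEq ι) (b : Basis ι ℝ H) (i₀ : ι), b i₀ = e ∧
      IsSignedBasis B b (timeSign i₀) ∧ ∀ x ∈ S, ∃ j, b j = x := by
  classical
  have key : ∀ x, 0 ≤ B x x + 2 * B x e * B x e ∧ (B x x + 2 * B x e * B x e = 0 → x = 0) := by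
    intro x
    set y := x + B x e • e with hy
    have hye : B y e = 0 := by simp [hy, he]
    have hyy : B y y = B x x + B x e * B x e := by
      simp [hy, he, hsymm e x]
    have hy0 : y = 0 ∨ 0 < B y y := by
      by_cases h : y = 0
      · exact Or.inl h
      · exact Or.inr (hL.pos_of_orthogonal_s8 hsymm (by rw [he]; norm_num) hye h)
    have h0 : 0 ≤ B y y := by
      rcases hy0 with h | h
      · simp [h]
      · exact h.le
    constructor
    · nlinarith [mul_self_nonneg (B x e)]
    · intro h
      have h1 : B x e * B x e = 0 := by nlinarith [mul_self_nonneg (B x e)]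
      have h2 : B x e = 0 := mul_self_eq_zero.mp h1
      rcases hy0 with h3 | h3
      · simpa [hy, h2] using h3
      · nlinarith
  let core : InnerProductSpace.Core ℝ H :=
    { inner := fun x y => B x y + 2 * B x e * B y e
      conj_inner_symm := fun x y => by simp [hsymm y x]; ring
      re_inner_nonneg := fun x => by simpa using (key x).1
      add_left := fun x y z => by simp; ring
      smul_left := fun x y r => by simp; ring
      definite := fun x h => (key x).2 h }
  let : NormedAddCommGroup H := core.toNormedAddCommGroup
  let : InnerProductSpace ℝ H := InnerProductSpace.ofCore core.toCore
  have inner_def : ∀ x y : H, inner ℝ x y = B x y + 2 * B x e * B y e := fun _ _ => rfl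
  have horth : Orthonormal ℝ (Subtype.val : S → H) := by
    rw [orthonormal_iff_ite]
    rintro ⟨x, hx⟩ ⟨y, hy⟩
    rw [inner_def]
    simp only [Subtype.mk.injEq]
    have hne : ∀ z ∈ S, z ≠ e → B z e = 0 := fun z hz h => hS' z hz e heS h
    by_cases hxy : x = y
    · subst hxy
      by_cases hxe : x = e
      · subst hxe; simp [he]; norm_num
      · simp [hS x hx hxe, hne x hx hxe]
    · rw [hS' x hx y hy hxy, if_neg hxy]
      by_cases hxe : x = e
      · have : y ≠ e := fun h => hxy (hxe.trans h.symm)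
        simp [hne y hy this]
      · simp [hne x hx hxe]
  obtain ⟨s, b, hs, hb⟩ := horth.exists_orthonormalBasis_extension
  have hbv : ∀ i : s, b i = (i : H) := fun i => by rw [hb]
  refine ⟨s, inferInstance, inferInstance, b.toBasis, ⟨e, hs heS⟩, by simp [hbv], ⟨?_, ?_⟩,
    fun x hx => ⟨⟨x, hs hx⟩, by simp [hbv]⟩⟩
  · have hE : ∀ i : s, B (b i) e = if i = ⟨e, hs heS⟩ then -1 else 0 := by
      intro i
      have h1 := orthonormal_iff_ite.mp b.orthonormal i ⟨e, hs heS⟩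
      rw [inner_def, hbv ⟨e, hs heS⟩, he] at h1
      split_ifs at h1 ⊢ <;> linarith
    intro i j
    have h := orthonormal_iff_ite.mp b.orthonormal i j
    rw [inner_def, hE, hE] at h
    simp only [OrthonormalBasis.coe_toBasis, timeSign]
    by_cases hij : i = j
    · subst hij
      simp only [if_true] at h ⊢
      split_ifs at h ⊢ <;> linarith
    · simp only [hij, if_false] at h ⊢
      by_cases hi : i = ⟨e, hs heS⟩
      · have hj : j ≠ ⟨e, hs heS⟩ := fun hj => hij (hi.trans hj.symm)
        simpa [hj] using h
      · simpa [hi] using h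
  · intro i
    unfold timeSign
    split_ifs <;> norm_num

namespace IsSignedBasis

variable {ι : Type*} [DecidableEq ι] [Fintype ι] {b : Basis ι ℝ H} {ε : ι → ℝ}

lemma repr_eq (hb : IsSignedBasis B b ε) (x : H) (i : ι) : b.repr x i = ε i * B x (b i) := by
  have : B x (b i) = b.repr x i * ε i := by
    conv_lhs => rw [← b.sum_repr x]
    simp only [map_sum, LinearMap.sum_apply, map_smul, LinearMap.smul_apply, smul_eq_mul, hb.gram]
    simp
  rw [this]
  linear_combination (-b.repr x i) * hb.sign i

lemma trace_eq (hb : IsSignedBasis B b ε) (T : Module.End ℝ H) :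
    LinearMap.trace ℝ H T = ∑ i, ε i * B (T (b i)) (b i) := by
  rw [LinearMap.trace_eq_matrix_trace ℝ b, Matrix.trace]
  simp [LinearMap.toMatrix_apply, hb.repr_eq]

lemma apply_self (hb : IsSignedBasis B b ε) (x : H) :
    B x x = ∑ i, ε i * (B x (b i)) ^ 2 := by
  conv_lhs => enter [2]; rw [← b.sum_repr x]
  simp only [map_sum, map_smul, smul_eq_mul, hb.repr_eq]
  exact Finset.sum_congr rfl fun i _ => by ring

end IsSignedBasis

lemma mem_sup_orthogonal [Module.Finite ℝ H] (hsymm : ∀ u v : H, B u v = B v u)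
    (hnd : ∀ u : H, (∀ v : H, B u v = 0) → u = 0) (M : Submodule ℝ H) {x : H}
    (hx : ∀ w ∈ M, (∀ m ∈ M, B w m = 0) → B x w = 0) :
    ∃ y ∈ M, ∃ u, (∀ m ∈ M, B u m = 0) ∧ x = y + u := by
  have hN : LinearMap.BilinForm.Nondegenerate B :=
    ⟨hnd, fun u hu => hnd u fun v => (hsymm u v).trans (hu v)⟩
  have hR : LinearMap.BilinForm.IsRefl B := fun u v h => (hsymm v u).trans h
  let O := LinearMap.BilinForm.orthogonal (B : LinearMap.BilinForm ℝ H)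
  have hmem : x ∈ M ⊔ O M := by
    have h1 : O (O (M ⊔ O M)) = M ⊔ O M := LinearMap.BilinForm.orthogonal_orthogonal hN hR _
    rw [← h1]
    refine LinearMap.BilinForm.mem_orthogonal_iff.mpr fun w hw => ?_
    have hw := LinearMap.BilinForm.mem_orthogonal_iff.mp hw
    have hwM : w ∈ M := by
      have h2 : O (O M) = M := LinearMap.BilinForm.orthogonal_orthogonal hN hR _
      rw [← h2]
      exact LinearMap.BilinForm.mem_orthogonal_iff.mpr fun n hn =>
        hw n (Submodule.mem_sup_right hn)
    rw [hsymm]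
    exact hx w hwM fun m hm => (hsymm w m).trans (hw m (Submodule.mem_sup_left hm))
  obtain ⟨y, hy, u, hu, rfl⟩ := Submodule.mem_sup.mp hmem
  exact ⟨y, hy, u, fun m hm => (hsymm u m).trans
    (LinearMap.BilinForm.mem_orthogonal_iff.mp hu m hm), rfl⟩

end Lorentzian

section Einstein

variable {H : Type*} [LieRing H] [LieAlgebra ℝ H]

/-- The data of a `lam`-Einstein Lorentzian Lie algebra of nilpotency class three with Euclidean
center; `adStar u` is the adjoint of `ad u`, and `J u v = adStar v u`. -/
structure IsEinsteinThreeStep (B : H →ₗ[ℝ] H →ₗ[ℝ] ℝ) (adStar J : H → Module.End ℝ H)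
    (lam : ℝ) : Prop where
  symm : ∀ u v : H, B u v = B v u
  nondegenerate : ∀ u : H, (∀ v : H, B u v = 0) → u = 0
  lorentzian : IsLorentzianForm B
  center_pos : ∀ z ∈ LieAlgebra.center ℝ H, z ≠ 0 → 0 < B z z
  adStar_apply : ∀ u v w : H, B (adStar u v) w = B v ⁅u, w⁆
  J_apply : ∀ u v w : H, B (J u v) w = B u ⁅v, w⁆
  einstein : ∀ u v : H,
    -(1/2) * LinearMap.trace ℝ H ((LieAlgebra.ad ℝ H u : Module.End ℝ H) ∘ₗ adStar v)
      - (1/4) * LinearMap.trace ℝ H (J u ∘ₗ J v) = lam * B u v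
  nonneg : 0 ≤ lam
  lie_lie_mem : ∀ x y z : H, ⁅⁅x, y⁆, z⁆ ∈ LieAlgebra.center ℝ H
  exists_lie_notMem : ∃ x y : H, ⁅x, y⁆ ∉ LieAlgebra.center ℝ H

/-- The subspace `[h,h] + Z(h)`. -/
def derivedPlusCenter (H : Type*) [LieRing H] [LieAlgebra ℝ H] : Submodule ℝ H :=
  Submodule.span ℝ ({m : H | ∃ x y : H, m = ⁅x, y⁆} ∪ {m | m ∈ LieAlgebra.center ℝ H})

lemma lie_mem_derivedPlusCenter (x y : H) : ⁅x, y⁆ ∈ derivedPlusCenter H :=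
  Submodule.subset_span (Or.inl ⟨x, y, rfl⟩)

lemma mem_derivedPlusCenter_of_center {z : H} (hz : z ∈ LieAlgebra.center ℝ H) :
    z ∈ derivedPlusCenter H :=
  Submodule.subset_span (Or.inr hz)

lemma mem_center_iff {z : H} : z ∈ LieAlgebra.center ℝ H ↔ ∀ x : H, ⁅z, x⁆ = 0 := by
  rw [LieModule.mem_maxTrivSubmodule]
  refine forall_congr' fun x => ?_
  rw [← lie_skew, neg_eq_zero]

/-- The second center centralizes `[h,h] + Z(h)`. -/
lemma lie_eq_zero_of_mem_derivedPlusCenter {x m : H}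
    (hx : ∀ y : H, ⁅x, y⁆ ∈ LieAlgebra.center ℝ H) (hm : m ∈ derivedPlusCenter H) :
    ⁅x, m⁆ = 0 := by
  induction hm using Submodule.span_induction with
  | mem m hm =>
    rcases hm with ⟨y, z, rfl⟩ | hm
    · rw [leibniz_lie, mem_center_iff.mp (hx y) z, ← lie_skew, mem_center_iff.mp (hx z) y]
      simp
    · rw [← lie_skew, mem_center_iff.mp hm x, neg_zero]
  | zero => simp
  | add a b _ _ ha hb => rw [lie_add, ha, hb, add_zero]
  | smul r a _ ha => rw [lie_smul, ha, smul_zero]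

lemma lie_mem_center_of_basis {ι : Type*} [Fintype ι] (b : Basis ι ℝ H) {x : H}
    (hx : ∀ i, ⁅x, b i⁆ ∈ LieAlgebra.center ℝ H) (y : H) : ⁅x, y⁆ ∈ LieAlgebra.center ℝ H := by
  rw [← b.sum_repr y, lie_sum]
  refine sum_mem fun i _ => ?_
  rw [lie_smul]
  exact (LieAlgebra.center ℝ H).smul_mem _ (hx i)

lemma mem_center_of_basis {ι : Type*} [Fintype ι] (b : Basis ι ℝ H) {x : H}
    (hx : ∀ i, ⁅x, b i⁆ = 0) : x ∈ LieAlgebra.center ℝ H := by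
  refine mem_center_iff.mpr fun y => ?_
  rw [← b.sum_repr y, lie_sum]
  exact Finset.sum_eq_zero fun i _ => by rw [lie_smul, hx, smul_zero]

lemma apply_lie_lie_swap (B : H →ₗ[ℝ] H →ₗ[ℝ] ℝ) (x y : H) :
    B ⁅x, y⁆ ⁅x, y⁆ = B ⁅y, x⁆ ⁅y, x⁆ := by
  rw [← lie_skew x y]
  simp only [map_neg, LinearMap.neg_apply, neg_neg]

namespace IsEinsteinThreeStep

variable {B : H →ₗ[ℝ] H →ₗ[ℝ] ℝ} {adStar J : H → Module.End ℝ H} {lam : ℝ}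
  {ι : Type*} [DecidableEq ι] [Fintype ι] {b : Basis ι ℝ H} {ε : ι → ℝ}

lemma lie_mem_center_of_mem (h : IsEinsteinThreeStep B adStar J lam) {m : H}
    (hm : m ∈ derivedPlusCenter H) (y : H) : ⁅m, y⁆ ∈ LieAlgebra.center ℝ H := by
  induction hm using Submodule.span_induction with
  | mem m hm =>
    rcases hm with ⟨x, z, rfl⟩ | hm
    · exact h.lie_lie_mem x z y
    · rw [mem_center_iff.mp hm y]
      exact zero_mem _
  | zero => simp
  | add a b _ _ ha hb => rw [add_lie]; exact add_mem ha hb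
  | smul r a _ ha => rw [smul_lie]; exact (LieAlgebra.center ℝ H).smul_mem r ha

lemma center_nonneg (h : IsEinsteinThreeStep B adStar J lam) {z : H}
    (hz : z ∈ LieAlgebra.center ℝ H) : 0 ≤ B z z := by
  by_cases h0 : z = 0
  · simp [h0]
  · exact (h.center_pos z hz h0).le

lemma eq_zero_of_center (h : IsEinsteinThreeStep B adStar J lam) {z : H}
    (hz : z ∈ LieAlgebra.center ℝ H) (h0 : B z z = 0) : z = 0 := by
  by_contra hne
  exact (h.center_pos z hz hne).ne' h0

lemma trace_ad_adStar (h : IsEinsteinThreeStep B adStar J lam) (hb : IsSignedBasis B b ε)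
    (u v : H) :
    LinearMap.trace ℝ H ((LieAlgebra.ad ℝ H u : Module.End ℝ H) ∘ₗ adStar v)
      = ∑ i, ε i * B ⁅u, b i⁆ ⁅v, b i⁆ := by
  have : Module.Finite ℝ H := Module.Finite.of_basis b
  rw [LinearMap.trace_comp_comm', hb.trace_eq]
  simp [h.adStar_apply]

lemma trace_J_J (h : IsEinsteinThreeStep B adStar J lam) (hb : IsSignedBasis B b ε) (v : H) :
    LinearMap.trace ℝ H (J v ∘ₗ J v) = -∑ i, ∑ k, ε i * ε k * B v ⁅b i, b k⁆ ^ 2 := by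
  rw [hb.trace_eq, ← Finset.sum_neg_distrib]
  refine Finset.sum_congr rfl fun i _ => ?_
  have h1 : B ((J v ∘ₗ J v) (b i)) (b i) = -B (J v (b i)) (J v (b i)) := by
    rw [LinearMap.comp_apply, h.J_apply, h.J_apply, ← lie_skew, map_neg]
  rw [h1, hb.apply_self, mul_neg, Finset.mul_sum]
  refine congrArg _ (Finset.sum_congr rfl fun k _ => ?_)
  rw [h.J_apply]
  ring

/-- The Einstein equation on the orthogonal complement of `[h,h]`, where `J` vanishes. -/
lemma sum_lie_lie (h : IsEinsteinThreeStep B adStar J lam) (hb : IsSignedBasis B b ε) {u : H}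
    (hu : ∀ x y : H, B u ⁅x, y⁆ = 0) (v : H) :
    ∑ i, ε i * B ⁅u, b i⁆ ⁅v, b i⁆ = -2 * lam * B u v := by
  have hJ : J u = 0 := LinearMap.ext fun x => h.nondegenerate _ fun y => by rw [h.J_apply, hu]
  have := h.einstein u v
  rw [h.trace_ad_adStar hb, hJ, LinearMap.zero_comp, map_zero] at this
  linarith

/-- The trace of the Einstein equation. -/
lemma sum_sum_lie_lie (h : IsEinsteinThreeStep B adStar J lam) (hb : IsSignedBasis B b ε) :
    ∑ l, ε l * ∑ i, ε i * B ⁅b l, b i⁆ ⁅b l, b i⁆ = -4 * lam * Fintype.card ι := by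
  have h1 : ∑ l, ε l * (-(1/2) * ∑ i, ε i * B ⁅b l, b i⁆ ⁅b l, b i⁆
      + (1/4) * ∑ i, ∑ k, ε i * ε k * B (b l) ⁅b i, b k⁆ ^ 2) = lam * Fintype.card ι := by
    have : ∀ l, ε l * (-(1/2) * ∑ i, ε i * B ⁅b l, b i⁆ ⁅b l, b i⁆
      + (1/4) * ∑ i, ∑ k, ε i * ε k * B (b l) ⁅b i, b k⁆ ^ 2) = lam := by
      intro l
      have := h.einstein (b l) (b l)
      rw [h.trace_ad_adStar hb, h.trace_J_J hb, hb.gram, if_pos rfl] at this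
      linear_combination ε l * this + lam * hb.sign l
    rw [Finset.sum_congr rfl fun l _ => this l]
    simp [mul_comm]
  have h2 : ∑ l, ε l * ∑ i, ∑ k, ε i * ε k * B (b l) ⁅b i, b k⁆ ^ 2
      = ∑ l, ε l * ∑ i, ε i * B ⁅b l, b i⁆ ⁅b l, b i⁆ := by
    simp only [Finset.mul_sum]
    rw [Finset.sum_comm]
    refine Finset.sum_congr rfl fun i _ => ?_
    rw [Finset.sum_comm]
    refine Finset.sum_congr rfl fun k _ => ?_
    rw [hb.apply_self, Finset.mul_sum, Finset.mul_sum]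
    refine Finset.sum_congr rfl fun l _ => ?_
    rw [h.symm]
    ring
  have h3 : ∑ l, ε l * (-(1/2) * ∑ i, ε i * B ⁅b l, b i⁆ ⁅b l, b i⁆
      + (1/4) * ∑ i, ∑ k, ε i * ε k * B (b l) ⁅b i, b k⁆ ^ 2)
      = -(1/2) * ∑ l, ε l * ∑ i, ε i * B ⁅b l, b i⁆ ⁅b l, b i⁆
        + (1/4) * ∑ l, ε l * ∑ i, ∑ k, ε i * ε k * B (b l) ⁅b i, b k⁆ ^ 2 := by
    rw [Finset.mul_sum, Finset.mul_sum, ← Finset.sum_add_distrib]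
    exact Finset.sum_congr rfl fun l _ => by ring
  rw [h3, h2] at h1
  linarith

lemma sum_lie_lie_of_timeSign (h : IsEinsteinThreeStep B adStar J lam) {i₀ : ι}
    (hb : IsSignedBasis B b (timeSign i₀)) {u : H} (hu : ∀ x y : H, B u ⁅x, y⁆ = 0) (v : H) :
    ∑ i, B ⁅u, b i⁆ ⁅v, b i⁆ = -2 * lam * B u v + 2 * B ⁅u, b i₀⁆ ⁅v, b i₀⁆ := by
  have := h.sum_lie_lie hb hu v
  rw [sum_timeSign] at this
  linarith

lemma lie_nonneg (h : IsEinsteinThreeStep B adStar J lam) {e : H} (he : B e e < 0)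
    (heo : ∀ x y : H, B e ⁅x, y⁆ = 0) (x y : H) : 0 ≤ B ⁅x, y⁆ ⁅x, y⁆ := by
  by_cases h0 : ⁅x, y⁆ = 0
  · simp [h0]
  · exact (h.lorentzian.pos_of_orthogonal_s8 h.symm he ((h.symm _ _).trans (heo x y)) h0).le

lemma lie_eq_zero (h : IsEinsteinThreeStep B adStar J lam) {e : H} (he : B e e < 0)
    (heo : ∀ x y : H, B e ⁅x, y⁆ = 0) {x y : H} (h0 : B ⁅x, y⁆ ⁅x, y⁆ = 0) : ⁅x, y⁆ = 0 := by
  by_contra hne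
  exact (h.lorentzian.pos_of_orthogonal_s8 h.symm he ((h.symm _ _).trans (heo x y)) hne).ne' h0

/-- If `[h,h] + Z(h)` contains a timelike vector, its orthogonal complement meets the second center
inside the center. -/
lemma mem_center_of_timelike_mem [Module.Finite ℝ H] (h : IsEinsteinThreeStep B adStar J lam)
    {m u : H} (hm : m ∈ derivedPlusCenter H) (hmm : B m m = -1)
    (hu : ∀ y, ⁅u, y⁆ ∈ LieAlgebra.center ℝ H) (huo : ∀ m ∈ derivedPlusCenter H, B u m = 0) :
    u ∈ LieAlgebra.center ℝ H := by
  obtain ⟨ι, _, _, b, i₀, hbe, hb, -⟩ := h.lorentzian.exists_signedBasis h.symm (S := {m}) hmm rfl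
    (fun x hx hne => absurd hx hne) (fun x hx y hy hne => absurd (hx.trans hy.symm) hne)
  have hsum := h.sum_lie_lie_of_timeSign hb (fun x y => huo _ (lie_mem_derivedPlusCenter x y)) u
  have hum : ⁅u, b i₀⁆ = 0 := by rw [hbe]; exact lie_eq_zero_of_mem_derivedPlusCenter hu hm
  have huu : 0 ≤ B u u := by
    by_cases h0 : u = 0
    · simp [h0]
    · exact (h.lorentzian.pos_of_orthogonal_s8 h.symm (by rw [hmm]; norm_num) (huo m hm) h0).le
  have hnn : ∀ i ∈ Finset.univ, 0 ≤ B ⁅u, b i⁆ ⁅u, b i⁆ := fun i _ => h.center_nonneg (hu _)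
  have hzero : ∑ i, B ⁅u, b i⁆ ⁅u, b i⁆ = 0 := by
    refine le_antisymm ?_ (Finset.sum_nonneg hnn)
    rw [hsum, hum]
    simp only [map_zero, mul_zero, add_zero]
    nlinarith [mul_nonneg h.nonneg huu]
  rw [Finset.sum_eq_zero_iff_of_nonneg hnn] at hzero
  exact mem_center_of_basis b fun i => h.eq_zero_of_center (hu _) (hzero i (Finset.mem_univ i))

/-- No timelike vector orthogonal to `[h,h]` lies in the second center. -/
lemma false_of_timelike [Module.Finite ℝ H] (h : IsEinsteinThreeStep B adStar J lam) {e : H}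
    (he : B e e = -1) (heo : ∀ x y : H, B e ⁅x, y⁆ = 0)
    (hec : ∀ y, ⁅e, y⁆ ∈ LieAlgebra.center ℝ H) : False := by
  have he' : B e e < 0 := by rw [he]; norm_num
  obtain ⟨ι, _, _, b, i₀, hbe, hb, -⟩ := h.lorentzian.exists_signedBasis h.symm (S := {e}) he rfl
    (fun x hx hne => absurd hx hne) (fun x hx y hy hne => absurd (hx.trans hy.symm) hne)
  have hee := h.sum_lie_lie_of_timeSign hb heo e
  rw [hbe, lie_self, map_zero, he] at hee
  have hscal := h.sum_sum_lie_lie hb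
  simp only [sum_timeSign] at hscal
  rw [hbe, hee, lie_self, map_zero, Finset.sum_sub_distrib, ← Finset.mul_sum] at hscal
  have hflip : ∑ l, B ⁅b l, e⁆ ⁅b l, e⁆ = ∑ l, B ⁅e, b l⁆ ⁅e, b l⁆ :=
    Finset.sum_congr rfl fun l _ => apply_lie_lie_swap B _ _
  rw [hflip, hee] at hscal
  simp only [mul_zero, sub_zero] at hscal
  have hpos := h.lie_nonneg he' heo
  have hsplit := Finset.add_sum_erase Finset.univ
    (fun l => ∑ i, B ⁅b l, b i⁆ ⁅b l, b i⁆) (Finset.mem_univ i₀)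
  have hsplit' : ∀ l, B ⁅b l, e⁆ ⁅b l, e⁆ + ∑ i ∈ Finset.univ.erase i₀, B ⁅b l, b i⁆ ⁅b l, b i⁆
      = ∑ i, B ⁅b l, b i⁆ ⁅b l, b i⁆ := fun l => by
    rw [← hbe]
    exact Finset.add_sum_erase Finset.univ
      (fun i => B ⁅b l, b i⁆ ⁅b l, b i⁆) (Finset.mem_univ i₀)
  have hflip' := Finset.add_sum_erase Finset.univ
    (fun l => B ⁅b l, e⁆ ⁅b l, e⁆) (Finset.mem_univ i₀)
  have hdist : ∑ l ∈ Finset.univ.erase i₀, ∑ i, B ⁅b l, b i⁆ ⁅b l, b i⁆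
      = ∑ l ∈ Finset.univ.erase i₀, B ⁅b l, e⁆ ⁅b l, e⁆
        + ∑ l ∈ Finset.univ.erase i₀, ∑ i ∈ Finset.univ.erase i₀, B ⁅b l, b i⁆ ⁅b l, b i⁆ := by
    rw [← Finset.sum_add_distrib]
    exact Finset.sum_congr rfl fun l _ => (hsplit' l).symm
  simp only [hbe, lie_self, map_zero, zero_add, hflip, hee] at hsplit hflip'
  have hcard : (1 : ℝ) ≤ Fintype.card ι := by
    exact_mod_cast Fintype.card_pos_iff.mpr ⟨i₀⟩
  have hnn : ∀ l ∈ Finset.univ.erase i₀,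
      0 ≤ ∑ i ∈ Finset.univ.erase i₀, B ⁅b l, b i⁆ ⁅b l, b i⁆ :=
    fun l _ => Finset.sum_nonneg fun i _ => hpos _ _
  have hzero : ∑ l ∈ Finset.univ.erase i₀, ∑ i ∈ Finset.univ.erase i₀,
      B ⁅b l, b i⁆ ⁅b l, b i⁆ = 0 := by
    refine le_antisymm ?_ (Finset.sum_nonneg hnn)
    nlinarith [mul_nonneg h.nonneg (sub_nonneg.mpr hcard)]
  rw [Finset.sum_eq_zero_iff_of_nonneg hnn] at hzero
  have hbb : ∀ l i, ⁅b l, b i⁆ ∈ LieAlgebra.center ℝ H := by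
    intro l i
    by_cases hl : l = i₀
    · rw [hl, hbe]; exact hec _
    by_cases hi : i = i₀
    · rw [hi, hbe, ← lie_skew]; exact neg_mem (hec _)
    have h1 := hzero l (Finset.mem_erase.mpr ⟨hl, Finset.mem_univ l⟩)
    rw [Finset.sum_eq_zero_iff_of_nonneg fun i _ => hpos _ _] at h1
    rw [h.lie_eq_zero he' heo (h1 i (Finset.mem_erase.mpr ⟨hi, Finset.mem_univ i⟩))]
    exact zero_mem _
  obtain ⟨x, y, hxy⟩ := h.exists_lie_notMem
  refine hxy (lie_mem_center_of_basis b (fun i => ?_) y)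
  rw [← lie_skew]
  exact neg_mem (lie_mem_center_of_basis b (hbb i) x)

/-- If the orthogonal complement of `[h,h] + Z(h)` contains a timelike vector, it meets the second
center trivially. -/
lemma eq_zero_of_timelike_orthogonal [Module.Finite ℝ H]
    (h : IsEinsteinThreeStep B adStar J lam) {e u : H} (he : B e e = -1)
    (heo : ∀ x y : H, B e ⁅x, y⁆ = 0) (huo : ∀ x y : H, B u ⁅x, y⁆ = 0)
    (hu : ∀ y, ⁅u, y⁆ ∈ LieAlgebra.center ℝ H) : u = 0 := by
  by_contra hu0
  have he' : B e e < 0 := by rw [he]; norm_num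
  refine h.false_of_timelike he heo ?_
  set w := u + B u e • e with hw
  have hwe : B w e = 0 := by simp [hw, he]
  by_cases hw0 : w = 0
  · have hue : u = -(B u e) • e := by rw [neg_smul]; exact eq_neg_of_add_eq_zero_left hw0
    have ha : B u e ≠ 0 := fun ha => hu0 (by rw [hue, ha]; simp)
    intro y
    have hey : ⁅e, y⁆ = (-(B u e))⁻¹ • ⁅u, y⁆ := by
      rw [← smul_lie, ← (eq_inv_smul_iff₀ (neg_ne_zero.mpr ha)).mpr hue.symm]
    rw [hey]
    exact (LieAlgebra.center ℝ H).smul_mem _ (hu y)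
  have hww := h.lorentzian.pos_of_orthogonal_s8 h.symm he' hwe hw0
  set c := Real.sqrt (B w w) with hc
  have hc0 : c ≠ 0 := (Real.sqrt_pos.mpr hww).ne'
  have hcc : c * c = B w w := Real.mul_self_sqrt hww.le
  set f := c⁻¹ • w with hf
  have hff : B f f = 1 := by
    simp only [hf, map_smul, LinearMap.smul_apply, smul_eq_mul, ← hcc]
    field_simp
  have hfe : B f e = 0 := by simp [hf, hwe]
  have hfo : ∀ x y : H, B f ⁅x, y⁆ = 0 := fun x y => by simp [hf, hw, heo, huo]
  obtain ⟨ι, _, _, b, i₀, hbe, hb, hS⟩ := h.lorentzian.exists_signedBasis h.symm (S := {e, f}) he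
    (by simp) (by
      rintro x (rfl | rfl) hne
      · exact absurd rfl hne
      · exact hff) (by
      rintro x (rfl | rfl) y (rfl | rfl) hne
      · exact absurd rfl hne
      · rw [h.symm]; exact hfe
      · exact hfe
      · exact absurd rfl hne)
  obtain ⟨j, hj⟩ := hS f (by simp)
  have hee := h.sum_lie_lie_of_timeSign hb heo e
  have hffs := h.sum_lie_lie_of_timeSign hb hfo f
  rw [hbe] at hee hffs
  have hfe_lie := apply_lie_lie_swap B f e
  rw [lie_self, map_zero, he] at hee
  rw [hff, hfe_lie] at hffs
  have hpos := h.lie_nonneg he' heo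
  have hsplit := Finset.add_sum_erase Finset.univ
    (fun i => B ⁅e, b i⁆ ⁅e, b i⁆) (Finset.mem_univ j)
  have hsplit' := Finset.add_sum_erase Finset.univ
    (fun i => B ⁅f, b i⁆ ⁅f, b i⁆) (Finset.mem_univ i₀)
  simp only [hj, hbe, hee, hffs, hfe_lie] at hsplit hsplit'
  have hnn : ∀ i ∈ Finset.univ.erase j, 0 ≤ B ⁅e, b i⁆ ⁅e, b i⁆ := fun i _ => hpos _ _
  have hzero : ∑ i ∈ Finset.univ.erase j, B ⁅e, b i⁆ ⁅e, b i⁆ = 0 := by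
    refine le_antisymm ?_ (Finset.sum_nonneg hnn)
    have : 0 ≤ ∑ i ∈ Finset.univ.erase i₀, B ⁅f, b i⁆ ⁅f, b i⁆ :=
      Finset.sum_nonneg fun i _ => hpos _ _
    linarith
  rw [Finset.sum_eq_zero_iff_of_nonneg hnn] at hzero
  refine lie_mem_center_of_basis b fun i => ?_
  by_cases hi : i = j
  · have hefu : ⁅e, f⁆ = -(c⁻¹ • ⁅u, e⁆) := by
      rw [← lie_skew, hf, smul_lie, hw, add_lie, smul_lie, lie_self, smul_zero, add_zero]
    rw [hi, hj, hefu]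
    exact neg_mem ((LieAlgebra.center ℝ H).smul_mem _ (hu e))
  · rw [h.lie_eq_zero he' heo (hzero i (Finset.mem_erase.mpr ⟨hi, Finset.mem_univ i⟩))]
    exact zero_mem _

/-- The case where `[h,h] + Z(h)` is degenerate. -/
lemma of_degenerate [Module.Finite ℝ H] (h : IsEinsteinThreeStep B adStar J lam) {w : H}
    (hw : w ∈ derivedPlusCenter H) (hwo : ∀ m ∈ derivedPlusCenter H, B w m = 0) (hw0 : w ≠ 0)
    {x : H} (hx : ∀ y, ⁅x, y⁆ ∈ LieAlgebra.center ℝ H) :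
    B x w = 0 ∧ ((∀ m ∈ derivedPlusCenter H, B x m = 0) → x ∈ derivedPlusCenter H) := by
  obtain ⟨e, he, -⟩ := h.lorentzian.exists_pos
  have he' : B e e < 0 := by rw [he]; norm_num
  have hww : B w w = 0 := hwo w hw
  have hwe : B w e ≠ 0 := fun h0 => (h.lorentzian.pos_of_orthogonal_s8 h.symm he' h0 hw0).ne' hww
  set u := (-(B w e))⁻¹ • w with hu
  set f := u - e with hf
  have huM : u ∈ derivedPlusCenter H := Submodule.smul_mem _ _ hw
  have huo : ∀ m ∈ derivedPlusCenter H, B u m = 0 := fun m hm => by simp [hu, hwo m hm]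
  have huu : B u u = 0 := huo u huM
  have hue : B u e = -1 := by
    simp only [hu, map_smul, LinearMap.smul_apply, smul_eq_mul]
    field_simp
  have hu0 : u ≠ 0 := fun h0 => by rw [h0] at hue; simp at hue
  have hfe : B f e = 0 := by simp [hf, hue, he]
  have hff : B f f = 1 := by simp [hf, huu, hue, he, h.symm e u]
  obtain ⟨ι, _, _, b, i₀, hbe, hb, hS⟩ := h.lorentzian.exists_signedBasis h.symm (S := {e, f}) he
    (by simp) (by
      rintro x (rfl | rfl) hne
      · exact absurd rfl hne
      · exact hff) (by
      rintro x (rfl | rfl) y (rfl | rfl) hne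
      · exact absurd rfl hne
      · rw [h.symm]; exact hfe
      · exact hfe
      · exact absurd rfl hne)
  obtain ⟨j, hj⟩ := hS f (by simp)
  have hij : i₀ ≠ j := by
    rintro rfl
    rw [hbe] at hj
    rw [← hj, he] at hff
    norm_num at hff
  have hsplit : ∀ g : ι → ℝ, ∑ i, g i = g i₀ + (g j + ∑ i ∈ (Finset.univ.erase i₀).erase j, g i) :=
    fun g => by
      rw [Finset.add_sum_erase _ _ (Finset.mem_erase.mpr ⟨hij.symm, Finset.mem_univ j⟩),
        Finset.add_sum_erase _ _ (Finset.mem_univ i₀)]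
  have huf : u = e + f := by rw [hf]; abel
  -- vectors of the second center orthogonal to `[h,h]` commute with the other basis vectors
  have hcomm : ∀ z : H, (∀ y, ⁅z, y⁆ ∈ LieAlgebra.center ℝ H) →
      (∀ m ∈ derivedPlusCenter H, B z m = 0) →
      (∀ i, i ≠ i₀ → i ≠ j → ⁅z, b i⁆ = 0) ∧ lam * B z z = 0 := by
    intro z hz hzo
    have hs := h.sum_lie_lie_of_timeSign hb
      (fun x y => hzo _ (lie_mem_derivedPlusCenter x y)) z
    have hzu : ⁅z, u⁆ = 0 := lie_eq_zero_of_mem_derivedPlusCenter hz huM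
    have hzf : ⁅z, f⁆ = -⁅z, e⁆ := by
      rw [huf, lie_add] at hzu
      exact eq_neg_of_add_eq_zero_right hzu
    rw [hsplit, hbe, hj, hzf] at hs
    simp only [map_neg, LinearMap.neg_apply, neg_neg] at hs
    have hzz : 0 ≤ B z z := by
      set y := z + B z e • u with hy
      have hye : B y e = 0 := by simp [hy, hue]
      have hyy : B y y = B z z := by simp [hy, huu, hzo u huM, h.symm u z]
      rw [← hyy]
      by_cases hy0 : y = 0
      · simp [hy0]
      · exact (h.lorentzian.pos_of_orthogonal_s8 h.symm he' hye hy0).le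
    have hnn : ∀ i ∈ (Finset.univ.erase i₀).erase j, 0 ≤ B ⁅z, b i⁆ ⁅z, b i⁆ :=
      fun i _ => h.center_nonneg (hz _)
    have hlz := mul_nonneg h.nonneg hzz
    have hzero : ∑ i ∈ (Finset.univ.erase i₀).erase j, B ⁅z, b i⁆ ⁅z, b i⁆ = 0 :=
      le_antisymm (by linarith) (Finset.sum_nonneg hnn)
    refine ⟨fun i hi hi' => ?_, by linarith⟩
    rw [Finset.sum_eq_zero_iff_of_nonneg hnn] at hzero
    exact h.eq_zero_of_center (hz _)
      (hzero i (Finset.mem_erase.mpr ⟨hi', Finset.mem_erase.mpr ⟨hi, Finset.mem_univ i⟩⟩))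
  have huc : ∀ y, ⁅u, y⁆ ∈ LieAlgebra.center ℝ H := h.lie_mem_center_of_mem huM
  obtain ⟨hub, -⟩ := hcomm u huc huo
  have hue_lie : ⁅u, e⁆ = -⁅e, f⁆ := by rw [huf, add_lie, lie_self, zero_add, lie_skew]
  have huf_lie : ⁅u, f⁆ = ⁅e, f⁆ := by rw [huf, add_lie, lie_self, add_zero]
  have hef : ⁅e, f⁆ ≠ 0 := by
    intro h0
    have huz : u ∈ LieAlgebra.center ℝ H := by
      refine mem_center_of_basis b fun i => ?_
      by_cases hi : i = i₀
      · rw [hi, hbe, hue_lie, h0, neg_zero]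
      by_cases hi' : i = j
      · rw [hi', hj, huf_lie, h0]
      · exact hub i hi hi'
    exact hu0 (h.eq_zero_of_center huz huu)
  have hlam : lam ≠ 0 := by
    intro h0
    have hs := h.sum_lie_lie_of_timeSign hb
      (fun x y => huo _ (lie_mem_derivedPlusCenter x y)) e
    rw [hsplit, Finset.sum_eq_zero (fun i hi => by
      simp only [Finset.mem_erase] at hi
      rw [hub i hi.2.1 hi.1]
      simp), hbe, hj, lie_self, huf_lie, h0] at hs
    have hc : ⁅e, f⁆ ∈ LieAlgebra.center ℝ H := huf_lie ▸ huc f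
    exact hef (h.eq_zero_of_center hc (by simpa using hs))
  constructor
  · have hxu : ⁅u, x⁆ = 0 := by
      rw [← lie_skew, lie_eq_zero_of_mem_derivedPlusCenter hx huM, neg_zero]
    have hux : ⁅u, x⁆ = B x u • ⁅e, f⁆ := by
      have hexp : ⁅u, x⁆ = ∑ i, b.repr x i • ⁅u, b i⁆ := by
        conv_lhs => rw [← b.sum_repr x, lie_sum]
        exact Finset.sum_congr rfl fun i _ => lie_smul _ _ _
      rw [hexp, Finset.sum_eq_add i₀ j hij (fun i _ hi => by rw [hub i hi.1 hi.2, smul_zero])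
        (by simp) (by simp), hb.repr_eq, hb.repr_eq, hbe, hj, hue_lie, huf_lie]
      simp only [timeSign, if_true, if_neg hij.symm]
      rw [huf, map_add, add_smul]
      simp only [neg_one_mul, one_mul, neg_smul, smul_neg, neg_neg]
    have h0 : B x u = 0 := by
      rw [hxu] at hux
      exact (smul_eq_zero.mp hux.symm).resolve_right hef
    simpa [hu, hwe] using h0
  · intro hxo
    have hxx : B x x = 0 := (mul_eq_zero.mp (hcomm x hx hxo).2).resolve_left hlam
    set y := x + B x e • u with hy
    have hye : B y e = 0 := by simp [hy, hue]
    have hyy : B y y = 0 := by simp [hy, huu, hxo u huM, h.symm u x, hxx]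
    have hy0 : y = 0 := by
      by_contra hy0
      exact (h.lorentzian.pos_of_orthogonal_s8 h.symm he' hye hy0).ne' hyy
    rw [eq_neg_of_add_eq_zero_left hy0]
    exact neg_mem (Submodule.smul_mem _ _ huM)

/-- The second center is contained in `[h,h] + Z(h)`. -/
theorem mem_derivedPlusCenter [Module.Finite ℝ H] (h : IsEinsteinThreeStep B adStar J lam)
    {x : H} (hx : ∀ y, ⁅x, y⁆ ∈ LieAlgebra.center ℝ H) : x ∈ derivedPlusCenter H := by
  have normalize : ∀ m : H, B m m < 0 → ∃ c : ℝ, B (c • m) (c • m) = -1 := by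
    intro m hm
    have h1 : 0 < -B m m := by linarith
    refine ⟨(Real.sqrt (-B m m))⁻¹, ?_⟩
    have h2 := Real.mul_self_sqrt h1.le
    have h3 : Real.sqrt (-B m m) ≠ 0 := (Real.sqrt_pos.mpr h1).ne'
    simp only [map_smul, LinearMap.smul_apply, smul_eq_mul]
    field_simp
    linarith
  by_cases hdeg : ∃ w ∈ derivedPlusCenter H, (∀ m ∈ derivedPlusCenter H, B w m = 0) ∧ w ≠ 0
  · obtain ⟨y, hy, u, huo, rfl⟩ := mem_sup_orthogonal h.symm h.nondegenerate (derivedPlusCenter H)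
      (x := x) fun w hw hwo => by
        by_cases hw0 : w = 0
        · simp [hw0]
        · exact (h.of_degenerate hw hwo hw0 hx).1
    obtain ⟨w, hw, hwo, hw0⟩ := hdeg
    refine add_mem hy ((h.of_degenerate hw hwo hw0 fun z => ?_).2 huo)
    have := sub_mem (hx z) (h.lie_mem_center_of_mem hy z)
    simpa [add_lie] using this
  push Not at hdeg
  have hdec : ∀ x : H, ∃ y ∈ derivedPlusCenter H, ∃ u,
      (∀ m ∈ derivedPlusCenter H, B u m = 0) ∧ x = y + u := fun x =>
    mem_sup_orthogonal h.symm h.nondegenerate _ fun w hw hwo => by simp [hdeg w hw hwo]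
  obtain ⟨y, hy, u, huo, rfl⟩ := hdec x
  have hu : ∀ z, ⁅u, z⁆ ∈ LieAlgebra.center ℝ H := fun z => by
    simpa [add_lie] using sub_mem (hx z) (h.lie_mem_center_of_mem hy z)
  refine add_mem hy ?_
  obtain ⟨t, ht, -⟩ := h.lorentzian.exists_pos
  obtain ⟨m, hm, n, hno, rfl⟩ := hdec t
  have hmn : B m m + B n n = -1 := by
    rw [← ht]
    simp [hno m hm, h.symm m n]
  by_cases hmm : B m m < 0
  · obtain ⟨c, hc⟩ := normalize m hmm
    exact mem_derivedPlusCenter_of_center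
      (h.mem_center_of_timelike_mem (Submodule.smul_mem _ c hm) hc hu huo)
  · obtain ⟨c, hc⟩ := normalize n (by linarith)
    rw [h.eq_zero_of_timelike_orthogonal hc
      (fun x y => by simp [hno _ (lie_mem_derivedPlusCenter x y)])
      (fun x y => huo _ (lie_mem_derivedPlusCenter x y)) hu]
    exact zero_mem _

end IsEinsteinThreeStep

end Einstein

/-- Let `(h,[·,·],⟨·,·⟩)` be a `λ`-Einstein Lorentzian nilpotent Lie algebra
with nondegenerate Euclidean center, with attributes `(g, ⟨·,·⟩_g, [·,·]_g)`, `(Z(h), ⟨·,·⟩_z)`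
and `ω`.  If `h` is 3-step nilpotent and `λ ≥ 0`, then the center of `(g,[·,·]_g)` equals its
derived ideal: `Z(g) = [g,g]_g`. -/
theorem statement8
    {H : Type*} [LieRing H] [LieAlgebra ℝ H] [Module.Finite ℝ H]
    (B : H →ₗ[ℝ] H →ₗ[ℝ] ℝ)
    (hsymm : ∀ u v : H, B u v = B v u)
    (hnd : ∀ u : H, (∀ v : H, B u v = 0) → u = 0)
    (hLor : IsLorentzianForm B)
    (hnilp : ∃ k, LieModule.lowerCentralSeries ℝ H H k = ⊥)
    (hZnd : ∀ z ∈ LieAlgebra.center ℝ H,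
      (∀ w ∈ LieAlgebra.center ℝ H, B z w = 0) → z = 0)
    (hZeucl : ∀ z ∈ LieAlgebra.center ℝ H, z ≠ 0 → 0 < B z z)
    -- `g` is the orthogonal complement of the center
    (g : Submodule ℝ H)
    (hg : ∀ u : H, u ∈ g ↔ ∀ z ∈ LieAlgebra.center ℝ H, B u z = 0)
    -- `P`, `Q` are the projections onto `g` and `Z(h)` in `h = g ⊕ Z(h)`
    (P Q : H →ₗ[ℝ] H)
    (hP : ∀ u : H, P u ∈ g)
    (hQ : ∀ u : H, Q u ∈ LieAlgebra.center ℝ H)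
    (hPQ : ∀ u : H, P u + Q u = u)
    -- `adStar u` is the adjoint of `ad u` in `h` with respect to `B`
    (adStar : H → Module.End ℝ H)
    (hadStar : ∀ u v w : H, B (adStar u v) w = B v ⁅u, w⁆)
    -- `Jm u` is the skew-symmetric endomorphism `J_u(v) = ad_v*(u)` of `h`
    (Jm : H → Module.End ℝ H)
    (hJm : ∀ u v w : H, B (Jm u v) w = B u ⁅v, w⁆)
    (lam : ℝ)
    -- `h` is `λ`-Einstein
    (hEinstein : ∀ u v : H,
      -(1/2) * LinearMap.trace ℝ H ((LieAlgebra.ad ℝ H u : Module.End ℝ H) ∘ₗ adStar v)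
        - (1/4) * LinearMap.trace ℝ H (Jm u ∘ₗ Jm v) = lam * B u v)
    -- `h` is 3-step nilpotent: `C⁴(h) = 0` and `C³(h) ≠ 0`
    (h3step : LieModule.lowerCentralSeries ℝ H H 3 = ⊥ ∧
      LieModule.lowerCentralSeries ℝ H H 2 ≠ ⊥)
    (hlam : 0 ≤ lam) :
    -- conclusion: `Z(g) = [g,g]_g`
    ∀ u : H, (u ∈ g ∧ ∀ v ∈ g, P ⁅u, v⁆ = 0) ↔ u ∈ derivedG g P := by
  have hlie : ∀ w x y z : H, ⁅w, ⁅x, ⁅y, z⁆⁆⁆ = 0 := by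
    intro w x y z
    have hmem : ⁅w, ⁅x, ⁅y, z⁆⁆⁆ ∈ LieModule.lowerCentralSeries ℝ H H 3 := by
      simp only [LieModule.lowerCentralSeries_succ, LieModule.lowerCentralSeries_zero]
      exact LieSubmodule.lie_mem_lie (LieSubmodule.mem_top w)
        (LieSubmodule.lie_mem_lie (LieSubmodule.mem_top x)
          (LieSubmodule.lie_mem_lie (LieSubmodule.mem_top y) (LieSubmodule.mem_top z)))
    rw [h3step.1] at hmem
    exact (LieSubmodule.mem_bot _).mp hmem
  have hlie_lie_mem : ∀ x y z : H, ⁅⁅x, y⁆, z⁆ ∈ LieAlgebra.center ℝ H := fun x y z => by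
    rw [LieModule.mem_maxTrivSubmodule]
    intro w
    rw [← lie_skew ⁅x, y⁆ z, lie_neg, hlie, neg_zero]
  have hexists : ∃ x y : H, ⁅x, y⁆ ∉ LieAlgebra.center ℝ H := by
    by_contra! hcon
    refine h3step.2 (le_bot_iff.mp ?_)
    have h1 : LieModule.lowerCentralSeries ℝ H H 1 ≤ LieAlgebra.center ℝ H := by
      simp only [LieModule.lowerCentralSeries_succ, LieModule.lowerCentralSeries_zero]
      exact (LieSubmodule.lie_le_iff _ _ _).mpr fun x _ y _ => hcon x y
    rw [LieModule.lowerCentralSeries_succ, LieSubmodule.lie_le_iff]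
    intro x _ m hm
    exact (LieSubmodule.mem_bot _).mpr ((LieModule.mem_maxTrivSubmodule ℝ H H m).mp (h1 hm) x)
  have h : IsEinsteinThreeStep B adStar Jm lam :=
    ⟨hsymm, hnd, hLor, hZeucl, hadStar, hJm, hEinstein, hlam, hlie_lie_mem, hexists⟩
  have hP_center : ∀ z ∈ LieAlgebra.center ℝ H, P z = 0 := by
    intro z hz
    have hPz : P z ∈ LieAlgebra.center ℝ H := by
      rw [eq_sub_of_add_eq (hPQ z)]
      exact sub_mem hz (hQ z)
    exact hZnd _ hPz ((hg _).mp (hP z))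
  have hP_eq : ∀ u ∈ g, P u = u := by
    intro u hu
    have hQg : Q u ∈ g := by
      rw [eq_sub_of_add_eq' (hPQ u)]
      exact sub_mem hu (hP u)
    have hQ0 : Q u = 0 := hZnd _ (hQ u) ((hg _).mp hQg)
    simpa [hQ0] using hPQ u
  have hlieP : ∀ x y : H, ⁅P x, P y⁆ = ⁅x, y⁆ := by
    intro x y
    have hQl := mem_center_iff.mp (hQ x)
    have hQr : ⁅P x, Q y⁆ = 0 := by rw [← lie_skew, mem_center_iff.mp (hQ y), neg_zero]
    conv_rhs => rw [← hPQ x, ← hPQ y]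
    rw [add_lie, hQl, lie_add, hQr, add_zero, add_zero]
  have hP_mem : ∀ x : H, P x = 0 → x ∈ LieAlgebra.center ℝ H := fun x hx => by
    rw [← hPQ x, hx, zero_add]
    exact hQ x
  intro u
  constructor
  · rintro ⟨hu, huv⟩
    have hmem := h.mem_derivedPlusCenter (x := u) fun y => by
      rw [← hlieP, hP_eq u hu]
      exact hP_mem _ (huv _ (hP y))
    have hPmem : ∀ m ∈ derivedPlusCenter H, P m ∈ derivedG g P := by
      intro m hm
      induction hm using Submodule.span_induction with
      | mem m hm =>
        rcases hm with ⟨x, y, rfl⟩ | hm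
        · exact Submodule.subset_span ⟨P x, hP x, P y, hP y, by rw [hlieP]⟩
        · rw [hP_center m hm]
          exact zero_mem _
      | zero => simp
      | add a b _ _ ha hb => rw [map_add]; exact add_mem ha hb
      | smul r a _ ha => rw [map_smul]; exact Submodule.smul_mem _ r ha
    rw [← hP_eq u hu]
    exact hPmem u hmem
  · intro hu
    induction hu using Submodule.span_induction with
    | mem x hx =>
      obtain ⟨y, hy, z, hz, rfl⟩ := hx
      refine ⟨hP _, fun v hv => hP_center _ ?_⟩
      rw [← hP_eq v hv, hlieP]
      exact hlie_lie_mem y z v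
    | zero => simp
    | add a b _ _ ha hb =>
      exact ⟨add_mem ha.1 hb.1, fun v hv => by
        rw [add_lie, map_add, ha.2 v hv, hb.2 v hv, add_zero]⟩
    | smul r a _ ha =>
      exact ⟨Submodule.smul_mem _ r ha.1, fun v hv => by
        rw [smul_lie, map_smul, ha.2 v hv, smul_zero]⟩
end
end

section
/- Let (h,[·,·],⟨·,·⟩) be a λ-Einstein Lorentzian 3-step nilpotent Lie algebra whose center Z(h) is nondegenerate (hence Euclidean). Then λ ≥ 0; equivalently, the scalar curvature of any Einstein Lorentzian 3-step nilpotent Lie algebra with nondegenerate center is nonnegative. -/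
open Module LinearMap

noncomputable section

/-- `v` is an orthogonal-type frame of the subspace `V` for the form `B`: its members are
non-isotropic vectors of `V`, and every `x ∈ V` has the expansion
`x = ∑ ⟨x, vₖ⟩ / ⟨vₖ, vₖ⟩ • vₖ`. -/
def IsOrthoFrame {H : Type*} [AddCommGroup H] [Module ℝ H] {ι : Type*} [Fintype ι]
    (B : H →ₗ[ℝ] H →ₗ[ℝ] ℝ) (V : Submodule ℝ H) (v : ι → H) : Prop :=
  (∀ k, v k ∈ V) ∧ (∀ k, B (v k) (v k) ≠ 0) ∧
    ∀ x ∈ V, x = ∑ k, (B x (v k) / B (v k) (v k)) • v k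

section Frames

variable {H : Type*} [AddCommGroup H] [Module ℝ H] {B : H →ₗ[ℝ] H →ₗ[ℝ] ℝ}

theorem isRefl_of_symm (hsymm : ∀ u v : H, B u v = B v u) : LinearMap.IsRefl B :=
  fun x y h => by rw [hsymm, h]

/-- A subspace on which the form is nondegenerate has an orthogonal frame. -/
theorem exists_isOrthoFrame [Module.Finite ℝ H] (hsymm : ∀ u v : H, B u v = B v u)
    (V : Submodule ℝ H) (hV : ∀ x ∈ V, (∀ y ∈ V, B x y = 0) → x = 0) :
    ∃ (n : ℕ) (v : Fin n → H), IsOrthoFrame B V v := by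
  have hS : LinearMap.IsSymm (LinearMap.BilinForm.restrict B V) := ⟨fun x y => hsymm x y⟩
  obtain ⟨b, hb⟩ : ∃ b : Basis (Fin (finrank ℝ V)) ℝ V,
      LinearMap.IsOrthoᵢ (LinearMap.BilinForm.restrict B V) b :=
    LinearMap.BilinForm.exists_orthogonal_basis hS
  have horth : ∀ i j, i ≠ j → B (b i) (b j) = 0 := fun i j hij => hb hij
  have hrep : ∀ x : V, (x : H) = ∑ j, b.repr x j • (b j : H) := by
    intro x
    have h := congrArg V.subtype (b.sum_repr x)
    simp only [map_sum, map_smul, Submodule.subtype_apply] at h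
    exact h.symm
  have hexp : ∀ (x : V) (k), B x (b k) = b.repr x k * B (b k) (b k) := by
    intro x k
    conv_lhs => rw [hrep x]
    simp only [map_sum, map_smul, LinearMap.sum_apply, LinearMap.smul_apply, smul_eq_mul]
    refine Finset.sum_eq_single k (fun j _ hj => ?_) (by simp)
    rw [horth j k hj, mul_zero]
  have hne : ∀ k, B (b k) (b k) ≠ 0 := by
    intro k hk
    have h0 : (b k : H) = 0 := by
      refine hV _ (b k).2 fun y hy => ?_
      rw [hsymm]
      have := hexp ⟨y, hy⟩ k
      rwa [hk, mul_zero] at this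
    exact b.ne_zero k (Subtype.ext h0)
  refine ⟨_, fun k => (b k : H), fun k => (b k).2, hne, fun x hx => ?_⟩
  refine (hrep ⟨x, hx⟩).trans ?_
  refine Finset.sum_congr rfl fun k _ => ?_
  have h2 : B x (b k) = _ := hexp ⟨x, hx⟩ k
  rw [h2, mul_div_cancel_right₀ _ (hne k)]

/-- A frame of a subspace together with a frame of an orthogonal complement is a frame of the
sum. -/
theorem IsOrthoFrame.sum {ι κ : Type*} [Fintype ι] [Fintype κ] {U V W : Submodule ℝ H}
    {u : ι → H} {v : κ → H} (hu : IsOrthoFrame B U u) (hv : IsOrthoFrame B V v)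
    (hUW : U ≤ W) (hVW : V ≤ W)
    (hsymm : ∀ x y : H, B x y = B y x) (hUV : ∀ x ∈ U, ∀ y ∈ V, B x y = 0)
    (hsum : ∀ x ∈ W, ∃ y ∈ U, ∃ z ∈ V, x = y + z) :
    IsOrthoFrame B W (Sum.elim u v) := by
  refine ⟨?_, ?_, ?_⟩
  · rintro (k | k)
    · exact hUW (hu.1 k)
    · exact hVW (hv.1 k)
  · rintro (k | k)
    · exact hu.2.1 k
    · exact hv.2.1 k
  · intro x hx
    obtain ⟨y, hy, z, hz, rfl⟩ := hsum x hx
    rw [Fintype.sum_sum_type]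
    simp only [Sum.elim_inl, Sum.elim_inr]
    conv_lhs => rw [hu.2.2 y hy, hv.2.2 z hz]
    congr 1
    · refine Finset.sum_congr rfl fun k _ => ?_
      rw [map_add, LinearMap.add_apply, hsymm z, hUV _ (hu.1 k) z hz, add_zero]
    · refine Finset.sum_congr rfl fun k _ => ?_
      rw [map_add, LinearMap.add_apply, hUV y hy _ (hv.1 k), zero_add]

theorem IsOrthoFrame.inner_eq {ι : Type*} [Fintype ι] {v : ι → H}
    (hv : IsOrthoFrame B ⊤ v) (hsymm : ∀ x y : H, B x y = B y x) (x y : H) :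
    B x y = ∑ k, B x (v k) * B y (v k) / B (v k) (v k) := by
  conv_lhs => rw [hv.2.2 x trivial]
  simp only [map_sum, map_smul, LinearMap.sum_apply, LinearMap.smul_apply, smul_eq_mul]
  refine Finset.sum_congr rfl fun k _ => ?_
  rw [hsymm (v k) y]
  ring

theorem IsOrthoFrame.trace_eq [Module.Finite ℝ H] {ι : Type*} [Fintype ι] {v : ι → H}
    (hv : IsOrthoFrame B ⊤ v) (f : Module.End ℝ H) :
    LinearMap.trace ℝ H f = ∑ k, B (f (v k)) (v k) / B (v k) (v k) := by
  have h : f = ∑ k, (B.flip (v k)).smulRight ((B (v k) (v k))⁻¹ • f (v k)) := by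
    ext x
    conv_lhs => rw [hv.2.2 x trivial]
    simp [map_sum, smul_smul, div_eq_mul_inv]
  conv_lhs => rw [h]
  rw [map_sum]
  refine Finset.sum_congr rfl fun k _ => ?_
  rw [LinearMap.trace_smulRight]
  simp only [LinearMap.flip_apply, map_smul, smul_eq_mul]
  ring

/-- The space splits as a nondegenerate subspace plus its orthogonal complement. -/
theorem exists_add_orthogonal [Module.Finite ℝ H] (hsymm : ∀ u v : H, B u v = B v u)
    (V : Submodule ℝ H) (hV : ∀ x ∈ V, (∀ y ∈ V, B x y = 0) → x = 0) (x : H) :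
    ∃ y ∈ V, ∃ z, (∀ w ∈ V, B w z = 0) ∧ x = y + z := by
  have hd : Disjoint V (LinearMap.BilinForm.orthogonal B V) := by
    rw [Submodule.disjoint_def]
    intro y hy hy'
    refine hV y hy fun w hw => ?_
    rw [hsymm]
    exact hy' w hw
  have hc := (LinearMap.BilinForm.isCompl_orthogonal_iff_disjoint (isRefl_of_symm hsymm)).2 hd
  have hx : x ∈ V ⊔ LinearMap.BilinForm.orthogonal B V := by
    rw [hc.sup_eq_top]; trivial
  obtain ⟨y, hy, z, hz, h⟩ := Submodule.mem_sup.1 hx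
  exact ⟨y, hy, z, fun w hw => hz w hw, h.symm⟩

/-- The orthogonal complement of a nondegenerate subspace is nondegenerate. -/
theorem eq_zero_of_orthogonal_orthogonal [Module.Finite ℝ H]
    (hsymm : ∀ u v : H, B u v = B v u) (hnd : ∀ u : H, (∀ v : H, B u v = 0) → u = 0)
    (V : Submodule ℝ H) (hV : ∀ x ∈ V, (∀ y ∈ V, B x y = 0) → x = 0) (x : H)
    (hx : x ∈ LinearMap.BilinForm.orthogonal B V)
    (hx' : ∀ y ∈ LinearMap.BilinForm.orthogonal B V, B x y = 0) : x = 0 := by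
  refine hnd x fun w => ?_
  obtain ⟨y, hy, z, hz, rfl⟩ := exists_add_orthogonal hsymm V hV w
  rw [map_add, hx' z fun w hw => hz w hw, hsymm, hx y hy, add_zero]

/-- A nondegenerate subspace has a frame that extends by a frame of its orthogonal
complement to a frame of the whole space. -/
theorem exists_isOrthoFrame_sum [Module.Finite ℝ H]
    (hsymm : ∀ u v : H, B u v = B v u) (hnd : ∀ u : H, (∀ v : H, B u v = 0) → u = 0)
    (V : Submodule ℝ H) (hV : ∀ x ∈ V, (∀ y ∈ V, B x y = 0) → x = 0) :
    ∃ (m n : ℕ) (u : Fin m → H) (v : Fin n → H), IsOrthoFrame B V u ∧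
      IsOrthoFrame B (LinearMap.BilinForm.orthogonal B V) v ∧
      IsOrthoFrame B ⊤ (Sum.elim u v) := by
  obtain ⟨m, u, hu⟩ := exists_isOrthoFrame hsymm V hV
  obtain ⟨n, v, hv⟩ := exists_isOrthoFrame hsymm (LinearMap.BilinForm.orthogonal B V)
    (eq_zero_of_orthogonal_orthogonal hsymm hnd V hV)
  refine ⟨m, n, u, v, hu, hv, hu.sum hv le_top le_top hsymm (fun x hx y hy => hy x hx) ?_⟩
  intro x _
  obtain ⟨y, hy, z, hz, h⟩ := exists_add_orthogonal hsymm V hV x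
  exact ⟨y, hy, z, fun w hw => hz w hw, h⟩

/-- A Lorentzian form is positive definite on the kernel of some linear functional. -/
theorem IsLorentzianForm.exists_functional (hLor : IsLorentzianForm B) :
    ∃ τ : H →ₗ[ℝ] ℝ, ∀ y, τ y = 0 → y ≠ 0 → 0 < B y y := by
  obtain ⟨n, b, horth, -, h1⟩ := hLor
  refine ⟨b.coord 0, fun y hy hne => ?_⟩
  have hB : B y y = ∑ i, (b.repr y i) ^ 2 * B (b i) (b i) := by
    conv_lhs => rw [← b.sum_repr y]
    simp only [map_sum, map_smul, LinearMap.sum_apply, LinearMap.smul_apply, smul_eq_mul]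
    refine Finset.sum_congr rfl fun i _ => ?_
    rw [Finset.sum_eq_single i]
    · ring
    · intro j _ hj
      rw [horth _ _ hj]
      simp
    · simp
  have hy0 : b.repr y 0 = 0 := hy
  have hnn : ∀ i ∈ Finset.univ, 0 ≤ (b.repr y i) ^ 2 * B (b i) (b i) := by
    intro i _
    by_cases hi : i = 0
    · subst hi; simp [hy0]
    · rw [h1 i hi]; positivity
  rw [hB]
  refine lt_of_le_of_ne (Finset.sum_nonneg hnn) fun h => hne ?_
  rw [eq_comm, Finset.sum_eq_zero_iff_of_nonneg hnn] at h
  apply b.ext_elem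
  intro i
  by_cases hi : i = 0
  · subst hi; simp [hy0]
  · have := h i (Finset.mem_univ i)
    rw [h1 i hi] at this
    simpa using this

/-- A vector orthogonal to a non-spacelike vector `e` is a multiple of `e` up to a spacelike
vector. -/
theorem exists_smul_of_orthogonal {τ : H →ₗ[ℝ] ℝ}
    (hτ : ∀ y, τ y = 0 → y ≠ 0 → 0 < B y y) (hsymm : ∀ u v : H, B u v = B v u)
    {e x : H} (he : e ≠ 0) (hee : B e e ≤ 0) (hxe : B x e = 0) :
    0 ≤ B x x ∧ (B x x = 0 → B e e = 0 → ∃ c : ℝ, x = c • e) := by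
  have hτe : τ e ≠ 0 := fun h => absurd (hτ e h he) (not_lt.2 hee)
  set t := τ x / τ e with ht
  have h0 : τ (x - t • e) = 0 := by
    simp [ht, div_mul_cancel₀ _ hτe]
  have hyy : B (x - t • e) (x - t • e) = B x x + t ^ 2 * B e e := by
    simp only [map_sub, map_smul, LinearMap.sub_apply, LinearMap.smul_apply, smul_eq_mul, hxe,
      hsymm e x]
    ring
  by_cases hy : x - t • e = 0
  · have hx : x = t • e := sub_eq_zero.1 hy
    have hxx : B x x = 0 := by
      have h := congrArg (B x) hx
      rwa [map_smul, hxe, smul_zero] at h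
    exact ⟨hxx.ge, fun _ _ => ⟨t, hx⟩⟩
  · have hpos := hτ _ h0 hy
    refine ⟨by nlinarith [sq_nonneg t], fun h1 h2 => ?_⟩
    rw [hyy, h1, h2] at hpos
    simp at hpos

end Frames

/-- Summing the three diagonal Ricci equations of a 3-step nilpotent algebra over a frame
adapted to `Z ⊕ D ⊕ W`. -/
theorem sum_structure_constants {P D M : Type*} [Fintype P] [Fintype D] [Fintype M]
    (T : P ⊕ (D ⊕ M) → P ⊕ (D ⊕ M) → P ⊕ (D ⊕ M) → ℝ) (lam : ℝ)
    (hsw : ∀ j k l, T j k l = T j l k)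
    (hP : ∀ j i l, T j (.inl i) l = 0)
    (hM : ∀ m k l, T (.inr (.inr m)) k l = 0)
    (hDD : ∀ j a b, T j (.inr (.inl a)) (.inr (.inl b)) = 0)
    (hDDM : ∀ a b m, T (.inr (.inl a)) (.inr (.inl b)) (.inr (.inr m)) = 0)
    (hric : ∀ j, lam = -(1/2) * ∑ k, ∑ l, T k j l + (1/4) * ∑ k, ∑ l, T j k l) :
    4 * lam * (3 * Fintype.card P + 2 * Fintype.card D + Fintype.card M) =
      ∑ i, ∑ m, ∑ m', T (.inl i) (.inr (.inr m)) (.inr (.inr m')) := by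
  have hP' : ∀ j i l, T j l (.inl i) = 0 := fun j i l => by rw [hsw, hP]
  have hDMD : ∀ a b m, T (.inr (.inl a)) (.inr (.inr m)) (.inr (.inl b)) = 0 :=
    fun a b m => by rw [hsw, hDDM]
  have h1 : ∑ i : P, lam = _ := Finset.sum_congr rfl fun i _ => hric (.inl i)
  have h2 : ∑ i : D, lam = _ := Finset.sum_congr rfl fun i _ => hric (.inr (.inl i))
  have h3 : ∑ i : M, lam = _ := Finset.sum_congr rfl fun i _ => hric (.inr (.inr i))
  simp only [Fintype.sum_sum_type, hP, hP', hM, hDD, hDDM, hDMD, Finset.sum_const_zero,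
    add_zero, zero_add, mul_zero, Finset.sum_add_distrib, ← Finset.mul_sum, mul_add,
    Finset.sum_const, Finset.card_univ, nsmul_eq_mul] at h1 h2 h3
  have e1 : ∑ i : P, ∑ m : M, ∑ a : D, T (.inl i) (.inr (.inr m)) (.inr (.inl a)) =
      ∑ i : P, ∑ a : D, ∑ m : M, T (.inl i) (.inr (.inl a)) (.inr (.inr m)) := by
    refine Finset.sum_congr rfl fun i _ => ?_
    rw [Finset.sum_comm]
    exact Finset.sum_congr rfl fun a _ => Finset.sum_congr rfl fun m _ => hsw _ _ _
  have e2 : ∑ a : D, ∑ i : P, ∑ m : M, T (.inl i) (.inr (.inl a)) (.inr (.inr m)) =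
      ∑ i : P, ∑ a : D, ∑ m : M, T (.inl i) (.inr (.inl a)) (.inr (.inr m)) :=
    Finset.sum_comm
  have e3 : ∑ m : M, ∑ i : P, ∑ a : D, T (.inl i) (.inr (.inr m)) (.inr (.inl a)) =
      ∑ i : P, ∑ m : M, ∑ a : D, T (.inl i) (.inr (.inr m)) (.inr (.inl a)) :=
    Finset.sum_comm
  have e4 : ∑ m : M, ∑ i : P, ∑ m' : M, T (.inl i) (.inr (.inr m)) (.inr (.inr m')) =
      ∑ i : P, ∑ m : M, ∑ m' : M, T (.inl i) (.inr (.inr m)) (.inr (.inr m')) :=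
    Finset.sum_comm
  have e5 : ∑ m : M, ∑ a : D, ∑ m' : M, T (.inr (.inl a)) (.inr (.inr m)) (.inr (.inr m')) =
      ∑ a : D, ∑ m : M, ∑ m' : M, T (.inr (.inl a)) (.inr (.inr m)) (.inr (.inr m')) :=
    Finset.sum_comm
  rw [e1] at h1
  rw [e2] at h2
  rw [e3, e4, e5, e1] at h3
  linarith

/-- A `lam`-Einstein pseudo-Euclidean nilpotent Lie algebra, given through the adjoints
`adStar u` of `ad u` and the skew-symmetric maps `Jm u : v ↦ adStar v u`. -/
structure IsNilEinstein {H : Type*} [LieRing H] [LieAlgebra ℝ H]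
    (B : H →ₗ[ℝ] H →ₗ[ℝ] ℝ) (adStar Jm : H → Module.End ℝ H) (lam : ℝ) : Prop where
  symm : ∀ u v : H, B u v = B v u
  nondeg : ∀ u : H, (∀ v : H, B u v = 0) → u = 0
  adStar_apply : ∀ u v w : H, B (adStar u v) w = B v ⁅u, w⁆
  Jm_apply : ∀ u v w : H, B (Jm u v) w = B u ⁅v, w⁆
  einstein : ∀ u v : H,
    -(1/2) * LinearMap.trace ℝ H ((LieAlgebra.ad ℝ H u : Module.End ℝ H) ∘ₗ adStar v)
      - (1/4) * LinearMap.trace ℝ H (Jm u ∘ₗ Jm v) = lam * B u v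

section Einstein

variable {H : Type*} [LieRing H] [LieAlgebra ℝ H]
  {B : H →ₗ[ℝ] H →ₗ[ℝ] ℝ} {adStar Jm : H → Module.End ℝ H} {lam : ℝ}

theorem IsNilEinstein.Jm_eq_zero (hE : IsNilEinstein B adStar Jm lam) {e : H}
    (heJ : ∀ a b : H, B e ⁅a, b⁆ = 0) (x : H) : Jm e x = 0 :=
  hE.nondeg _ fun y => by rw [hE.Jm_apply, heJ]

theorem IsNilEinstein.inner_adStar_self (hE : IsNilEinstein B adStar Jm lam) (e x : H) :
    B (adStar e x) e = 0 := by
  rw [hE.adStar_apply, lie_self, map_zero]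

variable [Module.Finite ℝ H]

/-- The Einstein equation expanded in an orthogonal frame. -/
theorem IsNilEinstein.frame_eq (hE : IsNilEinstein B adStar Jm lam) {ι : Type*} [Fintype ι]
    {v : ι → H} (hv : IsOrthoFrame B ⊤ v) (x y : H) :
    lam * B x y =
      -(1/2) * ∑ k, B (adStar y (v k)) (adStar x (v k)) / B (v k) (v k)
        + (1/4) * ∑ k, B (Jm y (v k)) (Jm x (v k)) / B (v k) (v k) := by
  rw [← hE.einstein, hv.trace_eq, hv.trace_eq]
  have h1 : ∀ k, B (((LieAlgebra.ad ℝ H x : Module.End ℝ H) ∘ₗ adStar y) (v k)) (v k) =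
      B (adStar y (v k)) (adStar x (v k)) := by
    intro k
    rw [hE.symm (adStar y (v k)), hE.adStar_apply, LinearMap.comp_apply, LieAlgebra.ad_apply,
      hE.symm]
  have h2 : ∀ k, B ((Jm x ∘ₗ Jm y) (v k)) (v k) = -B (Jm y (v k)) (Jm x (v k)) := by
    intro k
    rw [hE.symm (Jm y (v k)), hE.Jm_apply, LinearMap.comp_apply, hE.Jm_apply, ← lie_skew,
      map_neg]
  simp only [h1, h2, neg_div, Finset.sum_neg_distrib]
  ring

/-- A timelike vector orthogonal to the derived algebra forces `0 ≤ lam`. -/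
theorem IsNilEinstein.nonneg_of_timelike (hE : IsNilEinstein B adStar Jm lam)
    {τ : H →ₗ[ℝ] ℝ} (hτ : ∀ y, τ y = 0 → y ≠ 0 → 0 < B y y) {e : H} (hee : B e e < 0)
    (heJ : ∀ a b : H, B e ⁅a, b⁆ = 0) : 0 ≤ lam := by
  have he : e ≠ 0 := by rintro rfl; simp at hee
  have hspace : ∀ x, B x e = 0 → 0 ≤ B x x := fun x hx =>
    (exists_smul_of_orthogonal hτ hE.symm he hee.le hx).1
  have hV : ∀ x ∈ Submodule.span ℝ {e}, (∀ y ∈ Submodule.span ℝ {e}, B x y = 0) → x = 0 := by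
    intro x hx h
    obtain ⟨c, rfl⟩ := Submodule.mem_span_singleton.1 hx
    have := h e (Submodule.mem_span_singleton_self e)
    simp only [map_smul, LinearMap.smul_apply, smul_eq_mul, mul_eq_zero] at this
    rcases this with h | h
    · rw [h, zero_smul]
    · exact absurd h hee.ne
  obtain ⟨m, n, u, v, hu, hv, huv⟩ := exists_isOrthoFrame_sum hE.symm hE.nondeg _ hV
  have h := hE.frame_eq huv e e
  simp only [hE.Jm_eq_zero heJ, map_zero, zero_div, Finset.sum_const_zero, mul_zero,
    add_zero, Fintype.sum_sum_type, Sum.elim_inl, Sum.elim_inr] at h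
  have h1 : ∀ i, adStar e (u i) = 0 := by
    intro i
    obtain ⟨c, hc⟩ := Submodule.mem_span_singleton.1 (hu.1 i)
    refine hE.nondeg _ fun y => ?_
    rw [hE.adStar_apply, ← hc, map_smul, LinearMap.smul_apply, heJ, smul_zero]
  have h2 : 0 ≤ ∑ i, B (adStar e (v i)) (adStar e (v i)) / B (v i) (v i) := by
    refine Finset.sum_nonneg fun i _ => div_nonneg (hspace _ (hE.inner_adStar_self e _)) ?_
    refine hspace _ ?_
    rw [hE.symm]
    exact hv.1 i e (Submodule.mem_span_singleton_self e)
  simp only [h1, map_zero, zero_div, Finset.sum_const_zero, zero_add] at h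
  by_contra hl
  nlinarith [mul_pos_of_neg_of_neg (not_le.1 hl) hee]

/-- A null vector orthogonal to the derived algebra and central modulo the center forces
`0 ≤ lam` when the center is Euclidean. -/
theorem IsNilEinstein.nonneg_of_null (hE : IsNilEinstein B adStar Jm lam)
    {τ : H →ₗ[ℝ] ℝ} (hτ : ∀ y, τ y = 0 → y ≠ 0 → 0 < B y y)
    (hZ : ∀ z ∈ LieAlgebra.center ℝ H, z ≠ 0 → 0 < B z z) {e : H} (he : e ≠ 0)
    (hee : B e e = 0) (heJ : ∀ a b : H, B e ⁅a, b⁆ = 0)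
    (heZ : ∀ x : H, ⁅e, x⁆ ∈ LieAlgebra.center ℝ H) : 0 ≤ lam := by
  have hV : ∀ x ∈ (LieAlgebra.center ℝ H).toSubmodule,
      (∀ y ∈ (LieAlgebra.center ℝ H).toSubmodule, B x y = 0) → x = 0 := by
    intro x hx h
    by_contra hne
    exact (hZ x hx hne).ne' (h x hx)
  obtain ⟨m, n, u, v, hu, hv, huv⟩ := exists_isOrthoFrame_sum hE.symm hE.nondeg _ hV
  have hv0 : ∀ i, adStar e (v i) = 0 := by
    intro i
    refine hE.nondeg _ fun y => ?_
    rw [hE.adStar_apply, hE.symm]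
    exact hv.1 i _ (heZ y)
  have hupos : ∀ i, 0 < B (u i) (u i) := fun i =>
    hZ _ (hu.1 i) fun h => hu.2.1 i (by rw [h, map_zero])
  have key : ∀ y, lam * B e y =
      -(1/2) * ∑ i, B (adStar y (u i)) (adStar e (u i)) / B (u i) (u i) := by
    intro y
    have h := hE.frame_eq huv e y
    simpa only [hE.Jm_eq_zero heJ, map_zero, zero_div, Finset.sum_const_zero, mul_zero,
      add_zero, Fintype.sum_sum_type, Sum.elim_inl, Sum.elim_inr, hv0] using h
  have hnn : ∀ i ∈ Finset.univ,
      0 ≤ B (adStar e (u i)) (adStar e (u i)) / B (u i) (u i) := fun i _ =>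
    div_nonneg (exists_smul_of_orthogonal hτ hE.symm he hee.le (hE.inner_adStar_self e _)).1
      (hupos i).le
  have hzero : ∑ i, B (adStar e (u i)) (adStar e (u i)) / B (u i) (u i) = 0 := by
    have := key e
    rw [hee] at this
    linarith
  have hc : ∀ i, ∃ c : ℝ, adStar e (u i) = c • e := by
    intro i
    have h := (Finset.sum_eq_zero_iff_of_nonneg hnn).1 hzero i (Finset.mem_univ i)
    exact (exists_smul_of_orthogonal hτ hE.symm he hee.le (hE.inner_adStar_self e _)).2
      ((div_eq_zero_iff.1 h).resolve_right (hupos i).ne') hee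
  choose c hc using hc
  obtain ⟨y, hy⟩ : ∃ y, B e y ≠ 0 := by
    by_contra! h
    exact he (hE.nondeg e h)
  have hterm : ∀ i, B (adStar y (u i)) (adStar e (u i)) = -(c i ^ 2 * B e y) := by
    intro i
    have h1 : B (u i) ⁅e, y⁆ = c i * B e y := by
      rw [← hE.adStar_apply, hc, map_smul, LinearMap.smul_apply, smul_eq_mul]
    rw [hc, map_smul, hE.adStar_apply, ← lie_skew, map_neg, h1, smul_eq_mul]
    ring
  have hlam : lam * B e y = (1/2 * ∑ i, c i ^ 2 / B (u i) (u i)) * B e y := by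
    rw [key y, mul_assoc (1/2 : ℝ), Finset.sum_mul, Finset.mul_sum, Finset.mul_sum]
    refine Finset.sum_congr rfl fun i _ => ?_
    rw [hterm]
    ring
  rw [mul_right_cancel₀ hy hlam]
  exact mul_nonneg (by norm_num)
    (Finset.sum_nonneg fun i _ => div_nonneg (sq_nonneg _) (hupos i).le)

/-- The case where the orthogonal complement `W` of the center plus the derived algebra is
positive definite. -/
theorem IsNilEinstein.nonneg_of_posDef [Nontrivial H] (hE : IsNilEinstein B adStar Jm lam)
    (hZ : ∀ z ∈ LieAlgebra.center ℝ H, z ≠ 0 → 0 < B z z) (W : Submodule ℝ H)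
    (hW : ∀ w ∈ W, w ≠ 0 → 0 < B w w) (hWJ : ∀ w ∈ W, ∀ a b : H, B w ⁅a, b⁆ = 0)
    (hWZ : ∀ w ∈ W, ∀ z ∈ LieAlgebra.center ℝ H, B z w = 0)
    (hDZ : ∀ d, (∀ w ∈ W, B w d = 0) → ∀ x : H, ⁅d, x⁆ ∈ LieAlgebra.center ℝ H)
    (hDD : ∀ d, (∀ w ∈ W, B w d = 0) → ∀ d', (∀ w ∈ W, B w d' = 0) → ⁅d, d'⁆ = 0) :
    0 ≤ lam := by
  have hZ0 : ∀ x ∈ (LieAlgebra.center ℝ H).toSubmodule,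
      (∀ y ∈ (LieAlgebra.center ℝ H).toSubmodule, B x y = 0) → x = 0 := by
    intro x hx h
    by_contra hne
    exact (hZ x hx hne).ne' (h x hx)
  have hW0 : ∀ x ∈ W, (∀ y ∈ W, B x y = 0) → x = 0 := by
    intro x hx h
    by_contra hne
    exact (hW x hx hne).ne' (h x hx)
  set Z : Submodule ℝ H := (LieAlgebra.center ℝ H).toSubmodule with hZdef
  set Zo : Submodule ℝ H := LinearMap.BilinForm.orthogonal B Z with hZo
  set D : Submodule ℝ H := Zo ⊓ LinearMap.BilinForm.orthogonal B W with hD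
  have hWZo : W ≤ Zo := fun w hw z hz => hWZ w hw z hz
  have hdec : ∀ x ∈ Zo, ∃ y ∈ D, ∃ z ∈ W, x = y + z := by
    intro x hx
    obtain ⟨y, hy, z, hz, rfl⟩ := exists_add_orthogonal hE.symm W hW0 x
    refine ⟨z, ⟨?_, fun w hw => hz w hw⟩, y, hy, add_comm _ _⟩
    have := Zo.sub_mem hx (hWZo hy)
    rwa [add_sub_cancel_left] at this
  have hdecZ : ∀ x : H, ∃ y ∈ Z, ∃ z ∈ Zo, x = y + z := by
    intro x
    obtain ⟨y, hy, z, hz, h⟩ := exists_add_orthogonal hE.symm Z hZ0 x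
    exact ⟨y, hy, z, fun w hw => hz w hw, h⟩
  have hDW : ∀ x ∈ D, ∀ y ∈ W, B x y = 0 := fun x hx y hy => by
    rw [hE.symm]; exact hx.2 y hy
  have hD0 : ∀ x ∈ D, (∀ y ∈ D, B x y = 0) → x = 0 := by
    intro x hx h
    refine hE.nondeg x fun y => ?_
    obtain ⟨z, hz, y, hy, rfl⟩ := hdecZ y
    obtain ⟨d, hd, w, hw, rfl⟩ := hdec y hy
    rw [map_add, map_add, h d hd, hDW x hx w hw, hE.symm, hx.1 z hz]
    simp
  obtain ⟨p, u, hu⟩ := exists_isOrthoFrame hE.symm Z hZ0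
  obtain ⟨q, d, hd⟩ := exists_isOrthoFrame hE.symm D hD0
  obtain ⟨r, w, hw⟩ := exists_isOrthoFrame hE.symm W hW0
  have hf : IsOrthoFrame B ⊤ (Sum.elim u (Sum.elim d w)) :=
    hu.sum (hd.sum hw inf_le_left hWZo hE.symm hDW hdec) le_top le_top hE.symm
      (fun x hx y hy => hy x hx) fun x _ => hdecZ x
  set f := Sum.elim u (Sum.elim d w) with hfdef
  have hdW : ∀ a, ∀ w ∈ W, B w (d a) = 0 := fun a w hw => (hd.1 a).2 w hw
  have hcent : ∀ (i) (x : H), ⁅u i, x⁆ = 0 := by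
    intro i x
    have : ⁅x, u i⁆ = 0 :=
      (LieModule.mem_maxTrivSubmodule (R := ℝ) (L := H) (M := H) _).1 (hu.1 i) x
    rw [← lie_skew, this, neg_zero]
  have main := sum_structure_constants (lam := lam)
    (fun j k l => B (f j) ⁅f k, f l⁆ ^ 2 / (B (f j) (f j) * B (f k) (f k) * B (f l) (f l)))
    (fun j k l => by
      rw [← lie_skew, map_neg, neg_sq, mul_right_comm])
    (fun j i l => by simp [hfdef, hcent])
    (fun m k l => by simp [hfdef, hWJ _ (hw.1 m)])
    (fun j a b => by simp [hfdef, hDD _ (hdW a) _ (hdW b)])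
    (fun a b m => by
      have : B (d a) ⁅d b, w m⁆ = 0 := by
        rw [hE.symm]
        exact (hd.1 a).1 _ (hDZ _ (hdW b) _)
      simp [hfdef, this])
    (fun j => by
      have hj := hf.2.1 j
      have h := hE.frame_eq hf (f j) (f j)
      have h1 : ∀ k, B (adStar (f j) (f k)) (adStar (f j) (f k)) / B (f k) (f k) =
          B (f j) (f j) * ∑ l, B (f k) ⁅f j, f l⁆ ^ 2 /
            (B (f k) (f k) * B (f j) (f j) * B (f l) (f l)) := by
        intro k
        have hk := hf.2.1 k
        rw [hf.inner_eq hE.symm, Finset.sum_div, Finset.mul_sum]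
        refine Finset.sum_congr rfl fun l _ => ?_
        have hl := hf.2.1 l
        rw [hE.adStar_apply]
        field_simp
      have h2 : ∀ k, B (Jm (f j) (f k)) (Jm (f j) (f k)) / B (f k) (f k) =
          B (f j) (f j) * ∑ l, B (f j) ⁅f k, f l⁆ ^ 2 /
            (B (f j) (f j) * B (f k) (f k) * B (f l) (f l)) := by
        intro k
        have hk := hf.2.1 k
        rw [hf.inner_eq hE.symm, Finset.sum_div, Finset.mul_sum]
        refine Finset.sum_congr rfl fun l _ => ?_
        have hl := hf.2.1 l
        rw [hE.Jm_apply]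
        field_simp
      simp only [h1, h2, ← Finset.mul_sum] at h
      apply mul_right_cancel₀ hj
      rw [h]
      ring)
  have hpu : ∀ i, 0 < B (u i) (u i) := fun i =>
    hZ _ (hu.1 i) fun h => hu.2.1 i (by rw [h, map_zero])
  have hpw : ∀ i, 0 < B (w i) (w i) := fun i =>
    hW _ (hw.1 i) fun h => hw.2.1 i (by rw [h, map_zero])
  have hnn : 0 ≤ 4 * lam * (3 * Fintype.card (Fin p) + 2 * Fintype.card (Fin q) +
      Fintype.card (Fin r) : ℝ) := by
    rw [main]
    refine Finset.sum_nonneg fun i _ => Finset.sum_nonneg fun m _ =>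
      Finset.sum_nonneg fun m' _ => div_nonneg (sq_nonneg _) ?_
    exact (mul_pos (mul_pos (hpu i) (hpw m)) (hpw m')).le
  have hcard : 0 < p + q + r := by
    by_contra h0
    obtain ⟨rfl, rfl, rfl⟩ : p = 0 ∧ q = 0 ∧ r = 0 := by omega
    obtain ⟨x, hx⟩ := exists_ne (0 : H)
    exact hx (by rw [hf.2.2 x trivial]; simp)
  have hpos : (0 : ℝ) < 3 * p + 2 * q + r := by
    have : 0 < 3 * p + 2 * q + r := by omega
    exact_mod_cast this
  simp only [Fintype.card_fin] at hnn
  have := nonneg_of_mul_nonneg_left hnn hpos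
  linarith

end Einstein

/-- Let `(h,[·,·],⟨·,·⟩)` be a `λ`-Einstein Lorentzian 3-step nilpotent Lie
algebra whose center is nondegenerate (hence Euclidean).  Then `λ ≥ 0`. -/
theorem statement9
    {H : Type*} [LieRing H] [LieAlgebra ℝ H] [Module.Finite ℝ H]
    (B : H →ₗ[ℝ] H →ₗ[ℝ] ℝ)
    (hsymm : ∀ u v : H, B u v = B v u)
    (hnd : ∀ u : H, (∀ v : H, B u v = 0) → u = 0)
    (hLor : IsLorentzianForm B)
    -- `h` is 3-step nilpotent: `C⁴(h) = 0` and `C³(h) ≠ 0`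
    (h3step : LieModule.lowerCentralSeries ℝ H H 3 = ⊥ ∧
      LieModule.lowerCentralSeries ℝ H H 2 ≠ ⊥)
    -- the center is nondegenerate ...
    (hZnd : ∀ z ∈ LieAlgebra.center ℝ H,
      (∀ w ∈ LieAlgebra.center ℝ H, B z w = 0) → z = 0)
    -- ... hence Euclidean: the restriction of `B` to the center is positive definite
    (hZeucl : ∀ z ∈ LieAlgebra.center ℝ H, z ≠ 0 → 0 < B z z)
    -- `adStar u` is the adjoint of `ad u` with respect to `B`
    (adStar : H → Module.End ℝ H)
    (hadStar : ∀ u v w : H, B (adStar u v) w = B v ⁅u, w⁆)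
    -- `Jm u` is the skew-symmetric endomorphism `J_u(v) = ad_v*(u)`
    (Jm : H → Module.End ℝ H)
    (hJm : ∀ u v w : H, B (Jm u v) w = B u ⁅v, w⁆)
    (lam : ℝ)
    -- `h` is `λ`-Einstein: `ric(u,v) = λ ⟨u,v⟩` for all `u v`
    (hEinstein : ∀ u v : H,
      -(1/2) * LinearMap.trace ℝ H ((LieAlgebra.ad ℝ H u : Module.End ℝ H) ∘ₗ adStar v)
        - (1/4) * LinearMap.trace ℝ H (Jm u ∘ₗ Jm v) = lam * B u v) :
    0 ≤ lam := by
  have hE : IsNilEinstein B adStar Jm lam := ⟨hsymm, hnd, hadStar, hJm, hEinstein⟩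
  obtain ⟨τ, hτ⟩ := hLor.exists_functional
  have hnt : Nontrivial H := by
    obtain ⟨n, b, -, h0, -⟩ := hLor
    refine ⟨b 0, 0, fun h => ?_⟩
    rw [h] at h0
    simp at h0
  have hcomm : ∀ x : H, x ∈ LieAlgebra.center ℝ H ↔ ∀ y : H, ⁅x, y⁆ = 0 := by
    intro x
    refine (LieModule.mem_maxTrivSubmodule (R := ℝ) (L := H) (M := H) x).trans ?_
    refine forall_congr' fun y => ?_
    rw [← lie_skew, neg_eq_zero]
  have h4 : ∀ a b c d : H, ⁅⁅⁅a, b⁆, c⁆, d⁆ = 0 := by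
    intro a b c d
    have h1 : ⁅d, ⁅c, ⁅a, b⁆⁆⁆ ∈ LieModule.lowerCentralSeries ℝ H H 3 := by
      simp only [LieModule.lowerCentralSeries_succ]
      exact LieSubmodule.lie_mem_lie (LieSubmodule.mem_top _)
        (LieSubmodule.lie_mem_lie (LieSubmodule.mem_top _)
          (LieSubmodule.lie_mem_lie (LieSubmodule.mem_top _) (by simp)))
    rw [h3step.1, LieSubmodule.mem_bot] at h1
    rw [← lie_skew, ← lie_skew ⁅a, b⁆ c, lie_neg, h1, neg_zero, neg_zero]
  set N : Submodule ℝ H :=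
    Submodule.span ℝ ({x | ∃ a b : H, ⁅a, b⁆ = x} ∪ {x | x ∈ LieAlgebra.center ℝ H}) with hN
  set W : Submodule ℝ H := LinearMap.BilinForm.orthogonal B N with hWdef
  have hWJ : ∀ w ∈ W, ∀ a b : H, B w ⁅a, b⁆ = 0 := fun w hw a b => by
    rw [hsymm]
    exact hw _ (Submodule.subset_span (Or.inl ⟨a, b, rfl⟩))
  have hWZ : ∀ w ∈ W, ∀ z ∈ LieAlgebra.center ℝ H, B z w = 0 := fun w hw z hz =>
    hw z (Submodule.subset_span (Or.inr hz))
  have hNZ : ∀ d ∈ N, ∀ x y : H, ⁅⁅d, x⁆, y⁆ = 0 := by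
    intro d hd x y
    induction hd using Submodule.span_induction with
    | mem d hd =>
      rcases hd with ⟨a, b, rfl⟩ | hd
      · exact h4 a b x y
      · rw [(hcomm d).1 hd x, zero_lie]
    | zero => simp
    | add a b _ _ ha hb => rw [add_lie, add_lie, ha, hb, add_zero]
    | smul c a _ ha => rw [smul_lie, smul_lie, ha, smul_zero]
  have hNN : ∀ d ∈ N, ∀ d' ∈ N, ⁅d, d'⁆ = 0 := by
    intro d hd d' hd'
    induction hd' using Submodule.span_induction with
    | mem d' hd' =>
      rcases hd' with ⟨a, b, rfl⟩ | hd'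
      · rw [leibniz_lie, hNZ d hd, ← lie_skew, hNZ d hd, neg_zero, add_zero]
      · rw [← lie_skew, (hcomm d').1 hd', neg_zero]
    | zero => simp
    | add a b _ _ ha hb => rw [lie_add, ha, hb, add_zero]
    | smul c a _ ha => rw [lie_smul, ha, smul_zero]
  have hB : LinearMap.BilinForm.Nondegenerate B :=
    ⟨fun x h => hnd x h, fun y h => hnd y fun x => by rw [hsymm, h]⟩
  have hWN : ∀ d, (∀ w ∈ W, B w d = 0) → d ∈ N := by
    intro d h
    rw [← LinearMap.BilinForm.orthogonal_orthogonal hB (isRefl_of_symm hsymm) N]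
    exact fun w hw => h w hw
  have hDZ : ∀ d, (∀ w ∈ W, B w d = 0) → ∀ x : H, ⁅d, x⁆ ∈ LieAlgebra.center ℝ H :=
    fun d hd x => (hcomm _).2 (hNZ d (hWN d hd) x)
  by_cases htl : ∃ f ∈ W, B f f < 0
  · obtain ⟨f, hf, hff⟩ := htl
    exact hE.nonneg_of_timelike hτ hff (hWJ f hf)
  push Not at htl
  by_cases hnull : ∃ e ∈ W, e ≠ 0 ∧ B e e = 0
  · obtain ⟨e, heW, he, hee⟩ := hnull
    refine hE.nonneg_of_null hτ hZeucl he hee (hWJ e heW) (hDZ e fun w hw => ?_)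
    by_contra hne
    have h := htl (w - ((B w w + 1) / (2 * B w e)) • e)
      (W.sub_mem hw (W.smul_mem _ heW))
    simp only [map_sub, map_smul, LinearMap.sub_apply, LinearMap.smul_apply, smul_eq_mul,
      hee, hsymm e w, mul_zero, sub_zero] at h
    have h' : (B w w + 1) / (2 * B w e) * B w e = (B w w + 1) / 2 := by field_simp
    rw [h'] at h
    linarith
  · push Not at hnull
    exact hE.nonneg_of_posDef hZeucl W
      (fun w hw hne => lt_of_le_of_ne (htl w hw) (Ne.symm (hnull w hw hne))) hWJ hWZ hDZ
      fun d hd d' hd' => hNN d (hWN d hd) d' (hWN d' hd')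
end
end
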